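/- arXiv:1702.08599 — 2 statements merged into one kernel-verified Lean document; each statement's English description precedes it below -/
import Mathlib

section
/- Let r ≥ 2 be an integer and let p be a prime with p > 8. Then 7·σ_7^{(1)}(2p^r, p) + 21·σ_7^{(2)}(2p^r, p) + 35·σ_7^{(3)}(2p^r, p) ≡ 756·B_{p−7}·p^{r−1} (mod p^r). -/
open Finset

attribute [local instance] Classical.propDecidable

/-- `x ≡ y (mod p^s)` for rational numbers `x, y`: the `p`-adic valuation of `x - y`
is at least `s` (where the valuation of `0` is regarded as `+∞`). -/
def padicCong (p s : ℕ) (x y : ℚ) : Prop :=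
  x = y ∨ (s : ℤ) ≤ padicValRat p (x - y)

/-- `Z_n(N,p)`: the sum of `1/(l₁⋯lₙ)` over all ordered `n`-tuples `(l₁,…,lₙ)` of
positive integers not divisible by `p` with `l₁+⋯+lₙ = N`. -/
noncomputable def Zsum (p n N : ℕ) : ℚ :=
  ∑ l ∈ (Finset.Nat.antidiagonalTuple n N).filter
      (fun l => ∀ i, 0 < l i ∧ ¬ p ∣ l i),
    ∏ i, (l i : ℚ)⁻¹

/-- `S_n^{(m)}(p^r)`: the sum of `1/(l₁⋯lₙ)` over all ordered `n`-tuples `(l₁,…,lₙ)` of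
positive integers not divisible by `p`, each `< p^r`, with `l₁+⋯+lₙ = m·p^r`. -/
noncomputable def Ssum (p n m r : ℕ) : ℚ :=
  ∑ l ∈ (Finset.Nat.antidiagonalTuple n (m * p ^ r)).filter
      (fun l => ∀ i, (0 < l i ∧ ¬ p ∣ l i) ∧ l i < p ^ r),
    ∏ i, (l i : ℚ)⁻¹

/-- `σ_n^{(b)}(N,p)`: the sum of `(-1)^(l₁+⋯+l_b)/(l₁⋯lₙ)` over all ordered `n`-tuples
`(l₁,…,lₙ)` of positive integers not divisible by `p` with `l₁+⋯+lₙ = N`. -/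
noncomputable def sigmaSum (p n b N : ℕ) : ℚ :=
  ∑ l ∈ (Finset.Nat.antidiagonalTuple n N).filter
      (fun l => ∀ i, 0 < l i ∧ ¬ p ∣ l i),
    (-1 : ℚ) ^ (∑ i ∈ univ.filter (fun i : Fin n => (i : ℕ) < b), l i) *
      ∏ i, (l i : ℚ)⁻¹

/-- The value of a finite tuple at position `j`, extended by `0`. -/
noncomputable def seqAt {k : ℕ} (u : Fin k → ℕ) (j : ℕ) : ℕ :=
  if h : j < k then u ⟨j, h⟩ else 0

/-- The chain `i₁, i₂, …, i_d, l₁+⋯+l_a` (indexed from `0`): position `j < d` gives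
`i_{j+1}` and position `d` (or beyond) gives `l₁+⋯+l_a`. -/
noncomputable def Fchain {d a : ℕ} (i : Fin d → ℕ) (l : Fin a → ℕ) : ℕ → ℕ :=
  fun j => if h : j < d then i ⟨j, h⟩ else ∑ k, l k

/-- The summation conditions for `F_a^{(b)}(s,N,p)`:
`N > i₁ > ⋯ > i_d > l₁+⋯+l_a`, each `l_k ∈ 𝒫_p`, and
`i₁, i₁-i₂, …, i_{d-1}-i_d, i_d-(l₁+⋯+l_a) ∈ 𝒫_p`.
(When `d = 0` this reduces to `l₁+⋯+l_a < N` and each `l_k ∈ 𝒫_p`.) -/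
def FCond (p : ℕ) {d a : ℕ} (i : Fin d → ℕ) (l : Fin a → ℕ) (N : ℕ) : Prop :=
  (∀ k, 0 < l k ∧ ¬ p ∣ l k) ∧
  Fchain i l 0 < N ∧
  (0 < d → 0 < Fchain i l 0 ∧ ¬ p ∣ Fchain i l 0) ∧
  ∀ j < d, Fchain i l (j + 1) < Fchain i l j ∧
    0 < Fchain i l j - Fchain i l (j + 1) ∧ ¬ p ∣ (Fchain i l j - Fchain i l (j + 1))

/-- `F_a^{(b)}(s,N,p)` where `s = (s₁,…,s_d)` is a vector of signs. -/
noncomputable def Fsum (p a b : ℕ) {d : ℕ} (s : Fin d → ℤ) (N : ℕ) : ℚ :=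
  ∑ il ∈ ((Fintype.piFinset fun _ : Fin d => Finset.range N) ×ˢ
          (Fintype.piFinset fun _ : Fin a => Finset.range N)).filter
      (fun il => FCond p il.1 il.2 N),
    (∏ j, (s j : ℚ) ^ il.1 j) *
      (-1 : ℚ) ^ (∑ k ∈ univ.filter (fun k : Fin a => (k : ℕ) < b), il.2 k) /
      ((∏ j, (il.1 j : ℚ)) * ∏ k, (il.2 k : ℚ))

/-- `A_s`: the total size of the odd-indexed blocks in the decomposition
`s = (X_{w₁}, Z_{w₂}, …, Z_{w_l})`; equivalently, the number of positions `j` such that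
the number of `-1`-entries among `s₁,…,s_j` is even. -/
noncomputable def Acount {d : ℕ} (s : Fin d → ℤ) : ℕ :=
  (univ.filter fun j : Fin d =>
    Even (univ.filter (fun k : Fin d => k ≤ j ∧ s k = -1)).card).card

/-- `B_s`: the total size of the even-indexed blocks in the decomposition
`s = (X_{w₁}, Z_{w₂}, …, Z_{w_l})`; equivalently, the number of positions `j` such that
the number of `-1`-entries among `s₁,…,s_j` is odd. -/
noncomputable def Bcount {d : ℕ} (s : Fin d → ℤ) : ℕ :=
  (univ.filter fun j : Fin d =>
    Odd (univ.filter (fun k : Fin d => k ≤ j ∧ s k = -1)).card).card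

/-- `len(W_s)`: the number of blocks, namely `1` plus the number of `-1`-entries of `s`. -/
noncomputable def lenW {d : ℕ} (s : Fin d → ℤ) : ℕ :=
  1 + (univ.filter fun k : Fin d => s k = -1).card

/-- `P_s` (for given `a ≥ b`): `a - b - A_s` if `len(W_s)` is even, `b - B_s` if odd.
For `s = ∅` this gives `P_∅ = b`. -/
noncomputable def Pval (a b : ℕ) {d : ℕ} (s : Fin d → ℤ) : ℕ :=
  if 2 ∣ lenW s then a - b - Acount s else b - Bcount s

/-- `C_{a,b}(A,B)`, defined via falling factorials `(x)_γ = x(x-1)⋯(x-γ+1)`. -/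
def Cab (a b A B : ℕ) : ℚ :=
  if A = 0 ∧ B = 0 then 1
  else if A = 0 then (b.descFactorial B : ℚ)
  else if B = 0 then ((a - b).descFactorial A : ℚ)
  else ((a - b).descFactorial A : ℚ) * (b.descFactorial B : ℚ)

/-- The power series `∑_{p ∤ l} x^l / l`. -/
noncomputable def fPlus (p : ℕ) : PowerSeries ℚ :=
  PowerSeries.mk fun l => if p ∣ l then 0 else (l : ℚ)⁻¹

/-- The power series `∑_{p ∤ l} (-x)^l / l`. -/
noncomputable def fMinus (p : ℕ) : PowerSeries ℚ :=
  PowerSeries.mk fun l => if p ∣ l then 0 else (-1) ^ l * (l : ℚ)⁻¹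

lemma coeff_prod_tuple {n : ℕ} (f : Fin n → PowerSeries ℚ) (N : ℕ) :
    PowerSeries.coeff N (∏ j, f j) =
      ∑ l ∈ Finset.Nat.antidiagonalTuple n N, ∏ i, PowerSeries.coeff (l i) (f i) := by
  rw [PowerSeries.coeff_prod]
  refine Finset.sum_bij (fun l _ => (l : Fin n → ℕ)) ?_ ?_ ?_ ?_
  · intro a ha
    rw [Finset.mem_finsuppAntidiag] at ha
    rw [Finset.Nat.mem_antidiagonalTuple]
    exact ha.1
  · intro a _ b _ h
    exact DFunLike.coe_injective h
  · intro b hb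
    rw [Finset.Nat.mem_antidiagonalTuple] at hb
    refine ⟨Finsupp.equivFunOnFinite.symm b, ?_, ?_⟩
    · rw [Finset.mem_finsuppAntidiag]
      exact ⟨by simpa using hb, by simp⟩
    · simp
  · intro a _
    rfl

lemma sigma_eq_coeff_prod (p n b N : ℕ) :
    sigmaSum p n b N = PowerSeries.coeff N
      (∏ i : Fin n, if (i : ℕ) < b then fMinus p else fPlus p) := by
  rw [coeff_prod_tuple, sigmaSum, Finset.sum_filter]
  refine Finset.sum_congr rfl fun l _ => ?_
  split_ifs with h
  · rw [← Finset.prod_pow_eq_pow_sum, Finset.prod_filter, ← Finset.prod_mul_distrib]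
    refine Finset.prod_congr rfl fun i _ => ?_
    have := (h i).2
    split_ifs with hi
    · simp [fMinus, this]
    · simp [fPlus, this]
  · push Not at h
    obtain ⟨i, hi⟩ := h
    have hd : p ∣ l i := by
      rcases Nat.eq_zero_or_pos (l i) with h0 | h0
      · rw [h0]; exact dvd_zero _
      · exact hi h0
    symm
    apply Finset.prod_eq_zero (Finset.mem_univ i)
    split_ifs
    · simp [fMinus, hd]
    · simp [fPlus, hd]

lemma fMinus_eq (p : ℕ) : PowerSeries.rescale (-1 : ℚ) (fPlus p) = fMinus p := by
  ext n
  simp [fPlus, fMinus, PowerSeries.coeff_rescale]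

lemma fPlus_eq (p : ℕ) : PowerSeries.rescale (-1 : ℚ) (fMinus p) = fPlus p := by
  ext n
  simp only [fPlus, fMinus, PowerSeries.coeff_rescale, PowerSeries.coeff_mk]
  split_ifs
  · simp
  · rw [← mul_assoc, ← mul_pow]; simp

lemma sum_eq_expand (p : ℕ) (hp : p.Prime) (hp8 : 8 < p) :
    fPlus p + fMinus p = PowerSeries.expand 2 two_ne_zero (fPlus p) := by
  have h2 : Nat.Coprime p 2 := (Nat.coprime_primes hp Nat.prime_two).2 (by omega)
  ext n
  rw [PowerSeries.coeff_expand]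
  simp only [fPlus, fMinus, map_add, PowerSeries.coeff_mk]
  rcases Nat.even_or_odd' n with ⟨m, rfl | rfl⟩
  · have : p ∣ 2 * m ↔ p ∣ m := h2.dvd_mul_left
    simp only [this, dvd_mul_right, if_true, Nat.mul_div_cancel_left m (Nat.succ_pos 1)]
    split_ifs with h
    · simp
    · have hm : (m : ℚ) ≠ 0 := by
        intro h0; apply h; rw [Nat.cast_eq_zero] at h0; simp [h0]
      push_cast
      rw [pow_mul]; field_simp; norm_num
  · have : ¬ 2 ∣ 2 * m + 1 := by omega
    simp only [this, if_false]
    split_ifs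
    · simp
    · rw [pow_succ, pow_mul]; simp

lemma sigma_combo (p : ℕ) (hp : p.Prime) (hp8 : 8 < p) (K : ℕ) :
    7 * sigmaSum p 7 1 (2 * K) + 21 * sigmaSum p 7 2 (2 * K) + 35 * sigmaSum p 7 3 (2 * K) =
      PowerSeries.coeff K (fPlus p ^ 7) / 2 - PowerSeries.coeff (2 * K) (fPlus p ^ 7) := by
  have hs : ∀ b c, PowerSeries.coeff (2 * K) (fMinus p ^ b * fPlus p ^ c) =
      PowerSeries.coeff (2 * K) (fMinus p ^ c * fPlus p ^ b) := by
    intro b c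
    have : fMinus p ^ c * fPlus p ^ b =
        PowerSeries.rescale (-1 : ℚ) (fMinus p ^ b * fPlus p ^ c) := by
      rw [map_mul, map_pow, map_pow, fMinus_eq, fPlus_eq, mul_comm]
    rw [this, PowerSeries.coeff_rescale, pow_mul]; simp
  have h1 : sigmaSum p 7 1 (2 * K) = PowerSeries.coeff (2 * K) (fMinus p ^ 1 * fPlus p ^ 6) := by
    rw [sigma_eq_coeff_prod]; congr 1
    simp [Fin.prod_univ_succ]
  have h2 : sigmaSum p 7 2 (2 * K) = PowerSeries.coeff (2 * K) (fMinus p ^ 2 * fPlus p ^ 5) := by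
    rw [sigma_eq_coeff_prod]; congr 1
    simp [Fin.prod_univ_succ]; ring
  have h3 : sigmaSum p 7 3 (2 * K) = PowerSeries.coeff (2 * K) (fMinus p ^ 3 * fPlus p ^ 4) := by
    rw [sigma_eq_coeff_prod]; congr 1
    simp [Fin.prod_univ_succ]; ring
  have h0 := hs 0 7
  have h1' := hs 1 6
  have h2' := hs 2 5
  have h3' := hs 3 4
  have key : PowerSeries.coeff (2 * K) ((fPlus p + fMinus p) ^ 7) =
      PowerSeries.coeff K (fPlus p ^ 7) := by
    rw [sum_eq_expand p hp hp8, ← map_pow, PowerSeries.coeff_expand_mul]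
  have e : (fPlus p + fMinus p) ^ 7 = fMinus p ^ 0 * fPlus p ^ 7 + fMinus p ^ 7 * fPlus p ^ 0
     + (7 : ℚ) • (fMinus p ^ 1 * fPlus p ^ 6) + (7 : ℚ) • (fMinus p ^ 6 * fPlus p ^ 1)
     + (21 : ℚ) • (fMinus p ^ 2 * fPlus p ^ 5) + (21 : ℚ) • (fMinus p ^ 5 * fPlus p ^ 2)
     + (35 : ℚ) • (fMinus p ^ 3 * fPlus p ^ 4) + (35 : ℚ) • (fMinus p ^ 4 * fPlus p ^ 3) := by
    simp only [Algebra.smul_def, map_ofNat]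
    ring
  rw [e] at key
  simp only [map_add, PowerSeries.coeff_smul, smul_eq_mul] at key
  have e0 : PowerSeries.coeff (2 * K) (fPlus p ^ 7) =
      PowerSeries.coeff (2 * K) (fMinus p ^ 0 * fPlus p ^ 7) := by rw [pow_zero, one_mul]
  rw [h1, h2, h3, e0]
  linarith

/-- `x` is `p^s` times a `p`-integral rational number. -/
def PI (p s : ℕ) (x : ℚ) : Prop := ∃ a b : ℤ, ¬ (p : ℤ) ∣ b ∧ x * b = p ^ s * a

lemma PI.add {p s : ℕ} (hp : p.Prime) {x y : ℚ} (hx : PI p s x) (hy : PI p s y) :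
    PI p s (x + y) := by
  obtain ⟨a, b, hb, h⟩ := hx
  obtain ⟨c, d, hd, h'⟩ := hy
  refine ⟨a * d + c * b, b * d, ?_, ?_⟩
  · rw [(Nat.prime_iff_prime_int.1 hp).dvd_mul]; tauto
  · push_cast
    linear_combination (d : ℚ) * h + (b : ℚ) * h'

lemma PI.neg {p s : ℕ} {x : ℚ} (hx : PI p s x) : PI p s (-x) := by
  obtain ⟨a, b, hb, h⟩ := hx
  refine ⟨-a, b, hb, ?_⟩
  push_cast
  linear_combination -h

lemma PI.sub {p s : ℕ} (hp : p.Prime) {x y : ℚ} (hx : PI p s x) (hy : PI p s y) :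
    PI p s (x - y) := by
  rw [sub_eq_add_neg]; exact hx.add hp hy.neg

lemma PI.mul {p s t : ℕ} (hp : p.Prime) {x y : ℚ} (hx : PI p s x) (hy : PI p t y) :
    PI p (s + t) (x * y) := by
  obtain ⟨a, b, hb, h⟩ := hx
  obtain ⟨c, d, hd, h'⟩ := hy
  refine ⟨a * c, b * d, ?_, ?_⟩
  · rw [(Nat.prime_iff_prime_int.1 hp).dvd_mul]; tauto
  · push_cast
    rw [pow_add]
    linear_combination (y * d) * h + (p ^ s * a : ℚ) * h'

lemma PI.int {p : ℕ} (hp : p.Prime) (s : ℕ) (z : ℤ) : PI p s (p ^ s * z) :=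
  ⟨z, 1, fun h => (Nat.prime_iff_prime_int.1 hp).not_isUnit (isUnit_of_dvd_one h), by simp⟩

lemma PI.int0 {p : ℕ} (hp : p.Prime) (z : ℤ) : PI p 0 z := by
  simpa using PI.int hp 0 z

lemma PI.zero {p : ℕ} (hp : p.Prime) (s : ℕ) : PI p s 0 := by
  simpa using PI.int hp s 0

lemma PI.mono {p s t : ℕ} (h : t ≤ s) {x : ℚ} (hx : PI p s x) : PI p t x := by
  obtain ⟨a, b, hb, h'⟩ := hx
  refine ⟨p ^ (s - t) * a, b, hb, ?_⟩
  rw [h']; push_cast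
  rw [← mul_assoc, ← pow_add, Nat.add_sub_cancel' h]

lemma PI.sum {p s : ℕ} (hp : p.Prime) {ι : Type*} (S : Finset ι) (f : ι → ℚ)
    (h : ∀ i ∈ S, PI p s (f i)) : PI p s (∑ i ∈ S, f i) := by
  induction S using Finset.induction_on with
  | empty => simpa using PI.zero hp s
  | insert a S ha ih =>
    rw [Finset.sum_insert ha]
    exact (h a (Finset.mem_insert_self a S)).add hp
      (ih fun i hi => h i (Finset.mem_insert_of_mem hi))

/-- Cancel an integer prime to `p`. -/
lemma PI.cancel {p s : ℕ} (hp : p.Prime) {x : ℚ} {c : ℤ} (hc : ¬ (p : ℤ) ∣ c)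
    (hx : PI p s (c * x)) : PI p s x := by
  obtain ⟨a, b, hb, h⟩ := hx
  refine ⟨a, c * b, ?_, ?_⟩
  · rw [(Nat.prime_iff_prime_int.1 hp).dvd_mul]; tauto
  · push_cast
    linear_combination h

lemma PI.cancel_pow {p s t : ℕ} (hp : p.Prime) {x : ℚ}
    (hx : PI p (s + t) (p ^ s * x)) : PI p t x := by
  obtain ⟨a, b, hb, h⟩ := hx
  refine ⟨a, b, hb, ?_⟩
  have : (p : ℚ) ^ s ≠ 0 := pow_ne_zero _ (Nat.cast_ne_zero.2 hp.ne_zero)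
  apply mul_left_cancel₀ this
  rw [← mul_assoc, h, pow_add, mul_assoc]

lemma PI.toCong {p s : ℕ} (hp : p.Prime) {x y : ℚ} (h : PI p s (x - y)) :
    padicCong p s x y := by
  by_cases hxy : x = y
  · exact Or.inl hxy
  · right
    have := Fact.mk hp
    obtain ⟨a, b, hb, h⟩ := h
    have hb0 : (b : ℚ) ≠ 0 := by
      rw [Int.cast_ne_zero]; rintro rfl; exact hb (dvd_zero _)
    have hx0 : x - y ≠ 0 := sub_ne_zero.2 hxy
    have hp0 : (p : ℚ) ≠ 0 := Nat.cast_ne_zero.2 hp.ne_zero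
    have ha0 : (a : ℚ) ≠ 0 := by
      intro h0; rw [h0, mul_zero] at h
      exact mul_ne_zero hx0 hb0 h
    have h2 := congrArg (padicValRat p) h
    rw [padicValRat.mul hx0 hb0, padicValRat.mul (pow_ne_zero _ hp0) ha0, padicValRat.pow,
      padicValRat.self hp.one_lt, padicValRat.of_int, padicValRat.of_int,
      padicValInt.eq_zero_of_not_dvd hb] at h2
    simp at h2
    rw [h2]; omega

open Polynomial in
/-- The integer polynomial `(1 - X^p - (1-X)^p)/p`. -/
noncomputable def PP (p : ℕ) : ℤ[X] :=
  ∑ k ∈ Finset.Ico 1 p, C ((-1 : ℤ) ^ (k + 1) * ((p.choose k / p : ℕ) : ℤ)) * X ^ k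

open Polynomial in
lemma PP_spec {p : ℕ} (hp : p.Prime) (hp8 : 8 < p) :
    (p : ℤ[X]) * PP p = 1 - X ^ p - (1 - X) ^ p := by
  have h1 : (1 - X : ℤ[X]) ^ p = ∑ m ∈ Finset.range (p + 1), (-X) ^ m * (p.choose m : ℤ[X]) := by
    rw [sub_eq_neg_add, add_pow]; simp
  have hodd : Odd p := hp.odd_of_ne_two (by omega)
  rw [h1, Finset.sum_range_succ, Finset.range_eq_Ico, Finset.sum_eq_sum_Ico_succ_bot hp.pos,
    PP, Finset.mul_sum]
  simp only [pow_zero, Nat.choose_zero_right, Nat.choose_self, Nat.cast_one, hodd.neg_pow]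
  have : ∑ i ∈ Finset.Ico 1 p, (p : ℤ[X]) *
      (C ((-1 : ℤ) ^ (i + 1) * ((p.choose i / p : ℕ) : ℤ)) * X ^ i)
      = - ∑ k ∈ Finset.Ico (0 + 1) p, (-X) ^ k * (p.choose k : ℤ[X]) := by
    rw [← Finset.sum_neg_distrib]
    refine Finset.sum_congr (by simp) fun k hk => ?_
    rw [Finset.mem_Ico] at hk
    obtain ⟨q, hq⟩ := hp.dvd_choose_self (by omega : k ≠ 0) hk.2
    rw [hq, Nat.mul_div_cancel_left _ hp.pos, neg_pow (X : ℤ[X]) k]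
    simp
    ring
  rw [this]; ring

open Polynomial in
lemma PP_coeff_zero (p : ℕ) : (PP p).coeff 0 = 0 := by
  rw [PP, finsetSum_coeff]
  refine Finset.sum_eq_zero fun k hk => ?_
  rw [Finset.mem_Ico] at hk
  rw [coeff_C_mul_X_pow, if_neg (by omega)]

open Polynomial in
lemma PP_natDegree (p : ℕ) : (PP p).natDegree ≤ p - 1 := by
  rw [PP]
  refine natDegree_sum_le_of_forall_le _ _ fun k hk => ?_
  rw [Finset.mem_Ico] at hk
  exact (natDegree_C_mul_X_pow_le _ _).trans (by omega)

/-- The coefficients `a_i = [x^{pi}] P^k`. -/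
noncomputable def aco (p k i : ℕ) : ℤ := ((PP p) ^ k).coeff (p * i)

lemma aco_zero (p k : ℕ) (hk : k ≠ 0) : aco p k 0 = 0 := by
  rw [aco, mul_zero, Polynomial.coeff_zero_eq_eval_zero, Polynomial.eval_pow,
    ← Polynomial.coeff_zero_eq_eval_zero, PP_coeff_zero, zero_pow hk]

lemma aco_big {p : ℕ} (hp : p.Prime) {k i : ℕ} (hk : k ≠ 0) (hi : k ≤ i) : aco p k i = 0 := by
  rw [aco]
  apply Polynomial.coeff_eq_zero_of_natDegree_lt
  refine lt_of_le_of_lt (Polynomial.natDegree_pow_le_of_le k (PP_natDegree p)) ?_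
  have h1 : k * (p - 1) < k * p := by
    apply Nat.mul_lt_mul_of_pos_left (by have := hp.pos; omega) (by omega)
  calc k * (p - 1) < k * p := h1
    _ ≤ i * p := Nat.mul_le_mul_right _ hi
    _ = p * i := mul_comm _ _

open PowerSeries in
/-- `g = P / (1 - X^p)`. -/
noncomputable def gS (p : ℕ) (h : p ≠ 0) : PowerSeries ℚ :=
  (((PP p).map (Int.castRingHom ℚ) : Polynomial ℚ) : PowerSeries ℚ) *
    expand p h (PowerSeries.mk 1)

open PowerSeries in
lemma expand_inv (p : ℕ) (h : p ≠ 0) :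
    expand p h (PowerSeries.mk 1 : PowerSeries ℚ) * (1 - X ^ p) = 1 := by
  have := congrArg (expand p h) (PowerSeries.mk_one_mul_one_sub_eq_one ℚ)
  rwa [map_mul, map_sub, map_one, expand_X] at this

open PowerSeries in
lemma gS_spec {p : ℕ} (hp : p.Prime) (hp8 : 8 < p) :
    (1 - X : PowerSeries ℚ) ^ p = (1 - X ^ p) * (1 - (p : PowerSeries ℚ) * gS p hp.ne_zero) := by
  have h := congrArg (fun q : Polynomial ℤ =>
    ((q.map (Int.castRingHom ℚ) : Polynomial ℚ) : PowerSeries ℚ)) (PP_spec hp hp8)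
  simp only [Polynomial.map_mul, Polynomial.map_sub, Polynomial.map_pow, Polynomial.map_one,
    Polynomial.map_X, Polynomial.map_natCast, Polynomial.coe_mul, Polynomial.coe_sub,
    Polynomial.coe_pow, Polynomial.coe_one, Polynomial.coe_X] at h
  have hc : (((p : Polynomial ℚ)) : PowerSeries ℚ) = (p : PowerSeries ℚ) := by
    exact map_natCast (Polynomial.coeToPowerSeries.ringHom (R := ℚ)) p
  rw [hc] at h
  have e := expand_inv p hp.ne_zero
  rw [gS]
  linear_combination ((expand p hp.ne_zero (PowerSeries.mk 1)) * (1 - X ^ p)) * h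
    + (1 - X ^ p - (1 - X) ^ p) * e

open PowerSeries in
lemma deriv_fPlus {p : ℕ} (hp : p.Prime) :
    derivative ℚ (fPlus p) = PowerSeries.mk 1 -
      X ^ (p - 1) * expand p hp.ne_zero (PowerSeries.mk 1) := by
  have hpos := hp.pos
  ext n
  rw [coeff_derivative, map_sub, coeff_X_pow_mul', fPlus, coeff_mk, coeff_mk]
  by_cases h : p ∣ n + 1
  · obtain ⟨q, hq⟩ := h
    have hq0 : q ≠ 0 := by rintro rfl; omega
    obtain ⟨m, rfl⟩ := Nat.exists_eq_succ_of_ne_zero hq0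
    have hn : n - (p - 1) = p * m := by
      rw [Nat.succ_eq_add_one, mul_add] at hq; omega
    have hle : p - 1 ≤ n := by
      rw [Nat.succ_eq_add_one, mul_add] at hq; omega
    rw [if_pos ⟨_, hq⟩, if_pos hle, hn, coeff_expand_mul]
    simp
  · rw [if_neg h]
    have h0 : ((n : ℚ) + 1) ≠ 0 := by positivity
    have : (if p - 1 ≤ n then
        (coeff (n - (p - 1))) ((expand p hp.ne_zero) (PowerSeries.mk (1 : ℕ → ℚ))) else 0) = 0 := by
      split_ifs with hle
      · apply coeff_expand_of_not_dvd
        intro hd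
        apply h
        have : n + 1 = (n - (p - 1)) + p := by omega
        rw [this]
        exact dvd_add hd (dvd_refl p)
      · rfl
    rw [this]
    simp [h0]

open PowerSeries in
lemma deriv_gS {p : ℕ} (hp : p.Prime) (hp8 : 8 < p) :
    derivative ℚ (gS p hp.ne_zero) =
      (1 - (p : PowerSeries ℚ) * gS p hp.ne_zero) * derivative ℚ (fPlus p) := by
  have h := gS_spec hp hp8
  have e := expand_inv p hp.ne_zero
  have e1 := PowerSeries.mk_one_mul_one_sub_eq_one ℚ
  have hd := congrArg (derivative ℚ) h
  have hpn : (p : PowerSeries ℚ) ≠ 0 := by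
    intro h0
    have := congrArg constantCoeff h0
    rw [map_natCast, map_zero] at this
    exact hp.ne_zero (Nat.cast_eq_zero.1 this)
  simp only [Derivation.leibniz, Derivation.leibniz_pow, map_sub, smul_eq_mul,
    derivative_X, Derivation.map_one_eq_zero, Derivation.map_natCast, nsmul_eq_mul] at hd
  rw [deriv_fPlus hp]
  set g := gS p hp.ne_zero
  set E := expand p hp.ne_zero (PowerSeries.mk 1 : PowerSeries ℚ)
  set I := (PowerSeries.mk 1 : PowerSeries ℚ)
  have hX : (X : PowerSeries ℚ) ^ p = X ^ (p - 1) * X := by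
    rw [← pow_succ, Nat.sub_add_cancel hp.pos]
  have hX1 : (1 - X : PowerSeries ℚ) ^ p = (1 - X) ^ (p - 1) * (1 - X) := by
    rw [← pow_succ, Nat.sub_add_cancel hp.pos]
  have h1 : derivative ℚ g * (1 - (X : PowerSeries ℚ) ^ p) =
      (1 - (X : PowerSeries ℚ)) ^ (p - 1) - X ^ (p - 1) * (1 - (p : PowerSeries ℚ) * g) := by
    apply mul_left_cancel₀ hpn
    linear_combination hd
  -- multiply by `E * I * (1 - X)`
  have h2 : derivative ℚ g = E * I * (1 - X) *
      ((1 - (X : PowerSeries ℚ)) ^ (p - 1) - X ^ (p - 1) * (1 - (p : PowerSeries ℚ) * g)) := by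
    rw [← h1]
    linear_combination (-derivative ℚ g) * e - (derivative ℚ g * (1 - X ^ p) * E) * e1
  rw [h2]
  have h3 : E * I * ((1 - X) ^ (p - 1) * (1 - X)) = I * (1 - (p : PowerSeries ℚ) * g) := by
    rw [← hX1, h]
    linear_combination (I * (1 - (p : PowerSeries ℚ) * g)) * e
  linear_combination h3 - (X ^ (p - 1) * (1 - (p : PowerSeries ℚ) * g) * E) * e1

/-- Truncated series: `f = g * Ψ(g) + O(X^{L+1})`. -/
noncomputable def Psi (p L : ℕ) : Polynomial ℚ :=
  ∑ j ∈ Finset.range L, Polynomial.C ((p : ℚ) ^ j / (j + 1)) * Polynomial.X ^ j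

open PowerSeries in
lemma X_dvd_gS (p : ℕ) (h : p ≠ 0) : (X : PowerSeries ℚ) ∣ gS p h := by
  rw [X_dvd_iff, gS, map_mul, ← coeff_zero_eq_constantCoeff_apply, Polynomial.coeff_coe,
    Polynomial.coeff_map, PP_coeff_zero]
  simp

open PowerSeries in
lemma f_sub_dvd {p : ℕ} (hp : p.Prime) (hp8 : 8 < p) (L : ℕ) :
    (X : PowerSeries ℚ) ^ (L + 1) ∣
      fPlus p - gS p hp.ne_zero * Polynomial.aeval (gS p hp.ne_zero) (Psi p L) := by
  set g := gS p hp.ne_zero with hg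
  have hXg : X ∣ g := X_dvd_gS p hp.ne_zero
  have hphi : g * Polynomial.aeval g (Psi p L) =
      ∑ j ∈ Finset.range L, ((p : ℚ) ^ j / (j + 1)) • g ^ (j + 1) := by
    rw [Psi, map_sum, Finset.mul_sum]
    refine Finset.sum_congr rfl fun j _ => ?_
    rw [map_mul, Polynomial.aeval_C, map_pow, Polynomial.aeval_X, Algebra.smul_def]
    ring
  have hder : derivative ℚ (fPlus p - g * Polynomial.aeval g (Psi p L)) =
      ((p : PowerSeries ℚ) * g) ^ L * derivative ℚ (fPlus p) := by
    rw [map_sub, hphi, map_sum]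
    have : ∀ j ∈ Finset.range L, derivative ℚ (((p : ℚ) ^ j / (j + 1)) • g ^ (j + 1)) =
        ((p : PowerSeries ℚ) * g) ^ j * derivative ℚ g := by
      intro j _
      rw [Derivation.map_smul, Derivation.leibniz_pow, Nat.add_sub_cancel, smul_eq_mul,
        nsmul_eq_mul, Algebra.smul_def, mul_pow]
      have h0 : ((j : ℚ) + 1) ≠ 0 := by positivity
      have : (algebraMap ℚ (PowerSeries ℚ)) ((p : ℚ) ^ j / (j + 1)) * ((j + 1 : ℕ) : PowerSeries ℚ)
          = (p : PowerSeries ℚ) ^ j := by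
        have e1 : ((j + 1 : ℕ) : PowerSeries ℚ) = algebraMap ℚ (PowerSeries ℚ) ((j : ℚ) + 1) := by
          simp
        rw [e1, ← map_mul, div_mul_cancel₀ _ h0]
        simp
      linear_combination (g ^ j * derivative ℚ g) * this
    rw [Finset.sum_congr rfl this, ← Finset.sum_mul, deriv_gS hp hp8]
    have hgeom := geom_sum_mul_neg ((p : PowerSeries ℚ) * g) L
    linear_combination (-derivative ℚ (fPlus p)) * hgeom
  have hdvd : X ^ L ∣ derivative ℚ (fPlus p - g * Polynomial.aeval g (Psi p L)) := by
    rw [hder]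
    exact Dvd.dvd.mul_right (pow_dvd_pow_of_dvd (hXg.mul_left _) L) _
  rw [X_pow_dvd_iff] at hdvd ⊢
  intro m hm
  rcases m with _ | m
  · rw [map_sub, coeff_zero_eq_constantCoeff_apply (g * _), map_mul,
      X_dvd_iff.1 hXg]
    simp [fPlus]
  · have := hdvd m (by omega)
    rw [coeff_derivative] at this
    have h0 : ((m : ℚ) + 1) ≠ 0 := by positivity
    exact (mul_eq_zero.1 this).resolve_right h0

lemma Psi_coeff (p L l : ℕ) : (Psi p L).coeff l = if l < L then (p : ℚ) ^ l / (l + 1) else 0 := by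
  rw [Psi, Polynomial.finsetSum_coeff]
  simp only [Polynomial.coeff_C_mul_X_pow]
  rw [Finset.sum_ite_eq]
  simp

lemma Psi_pow_coeff (p L n : ℕ) : ∀ j : ℕ, ∃ z : ℤ,
    ((n + j).factorial : ℚ) * ((Psi p L) ^ n).coeff j = p ^ j * z := by
  induction n with
  | zero =>
    intro j
    rcases j with _ | j
    · exact ⟨1, by simp⟩
    · exact ⟨0, by simp [Polynomial.coeff_one]⟩
  | succ n ih =>
    intro j
    choose z hz using ih
    refine ⟨∑ x ∈ Finset.HasAntidiagonal.antidiagonal j, ((n + 1 + j).choose (x.2 + 1) : ℤ) * z x.1 *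
      (if x.2 < L then (x.2.factorial : ℤ) else 0), ?_⟩
    rw [pow_succ, Polynomial.coeff_mul, Finset.mul_sum, Int.cast_sum, Finset.mul_sum]
    refine Finset.sum_congr rfl fun x hx => ?_
    rw [Finset.HasAntidiagonal.mem_antidiagonal] at hx
    have hch := Nat.choose_mul_factorial_mul_factorial (show x.2 + 1 ≤ n + 1 + j by omega)
    have hsub : n + 1 + j - (x.2 + 1) = n + x.1 := by omega
    rw [hsub] at hch
    have h1 : (((x.2 + 1).factorial : ℕ) : ℚ) * (Psi p L).coeff x.2 =
        p ^ x.2 * (if x.2 < L then (x.2.factorial : ℚ) else 0) := by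
      rw [Psi_coeff]
      split_ifs
      · rw [Nat.factorial_succ]; push_cast
        have h0 : ((x.2 : ℚ) + 1) ≠ 0 := by positivity
        field_simp
      · simp
    rw [← hch, ← hx, pow_add]
    push_cast
    have hz1 := hz x.1
    rw [← hx] at *
    linear_combination ((n + 1 + (x.1 + x.2)).choose (x.2 + 1) : ℚ) * ((x.2 + 1).factorial : ℚ)
      * (Psi p L).coeff x.2 * hz1 + ((n + 1 + (x.1 + x.2)).choose (x.2 + 1) : ℚ) * p ^ x.1 * z x.1 * h1

open PowerSeries in
lemma coeff_f_pow {p : ℕ} (hp : p.Prime) (hp8 : 8 < p) (L : ℕ) :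
    coeff L (fPlus p ^ 7) = ∑ j ∈ Finset.range (((Psi p L) ^ 7).natDegree + 1),
      ((Psi p L) ^ 7).coeff j * coeff L (gS p hp.ne_zero ^ (7 + j)) := by
  have h1 := (f_sub_dvd hp hp8 L).trans (sub_dvd_pow_sub_pow (fPlus p) _ 7)
  rw [X_pow_dvd_iff] at h1
  have h2 := h1 L (by omega)
  rw [map_sub, sub_eq_zero] at h2
  rw [h2, mul_pow, ← map_pow, Polynomial.aeval_eq_sum_range, Finset.mul_sum, map_sum]
  refine Finset.sum_congr rfl fun j _ => ?_
  rw [mul_smul_comm, coeff_smul, smul_eq_mul, pow_add]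

open PowerSeries in
lemma coeff_mul_expand {p : ℕ} (hp0 : p ≠ 0) (A B : PowerSeries ℚ) (M : ℕ) :
    coeff (p * M) (A * expand p hp0 B) =
      ∑ i ∈ Finset.range (M + 1), coeff (p * i) A * coeff (M - i) B := by
  have hpos : 0 < p := Nat.pos_of_ne_zero hp0
  rw [coeff_mul, Finset.Nat.sum_antidiagonal_eq_sum_range_succ_mk]
  symm
  refine Finset.sum_of_injOn (fun i => p * i) ?_ ?_ ?_ ?_
  · intro a _ b _ h
    exact Nat.eq_of_mul_eq_mul_left hpos h
  · intro i hi
    simp only [Finset.coe_range, Set.mem_Iio] at hi ⊢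
    have := Nat.mul_le_mul_left p (show i ≤ M by omega)
    omega
  · intro i hi hni
    simp only
    rw [coeff_expand_of_not_dvd, mul_zero]
    intro hd
    apply hni
    rw [Finset.mem_range] at hi
    have h1 : p ∣ i := by
      have := (Nat.dvd_sub (dvd_mul_right p M) hd)
      rwa [Nat.sub_sub_self (by omega)] at this
    obtain ⟨q, rfl⟩ := h1
    refine ⟨q, ?_, rfl⟩
    simp only [Finset.coe_range, Set.mem_Iio]
    have := Nat.le_of_mul_le_mul_left (show p * q ≤ p * M by omega) hpos
    omega
  · intro i hi
    simp only
    rw [← Nat.mul_sub, coeff_expand_mul]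

open PowerSeries in
lemma coeff_gS_pow {p : ℕ} (hp0 : p ≠ 0) (k M : ℕ) (hk : 0 < k) :
    coeff (p * M) (gS p hp0 ^ k) =
      ∑ i ∈ Finset.range (M + 1), (aco p k i : ℚ) * ((k - 1 + (M - i)).choose (k - 1) : ℚ) := by
  have h1 : (PowerSeries.mk 1 : PowerSeries ℚ) ^ k = 
      PowerSeries.mk fun n => ((k - 1 + n).choose (k - 1) : ℚ) := by
    have := PowerSeries.invOneSubPow_val_eq_mk_sub_one_add_choose_of_pos ℚ k hk
    rw [← this]
    have e1 := PowerSeries.mk_one_mul_one_sub_eq_one ℚ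
    have e2 := (invOneSubPow ℚ k).mul_inv
    change (invOneSubPow ℚ k).val * (invOneSubPow ℚ k).inv = 1 at e2
    rw [PowerSeries.invOneSubPow_inv_eq_one_sub_pow] at e2
    calc (PowerSeries.mk 1 : PowerSeries ℚ) ^ k
        = (PowerSeries.mk 1 : PowerSeries ℚ) ^ k * ((invOneSubPow ℚ k).val * (1 - X) ^ k) := by
          rw [e2, mul_one]
      _ = (PowerSeries.mk 1 * (1 - X) : PowerSeries ℚ) ^ k * (invOneSubPow ℚ k).val := by
          rw [mul_pow]; ring
      _ = _ := by rw [e1, one_pow, one_mul]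
  have h2 : gS p hp0 ^ k = (((PP p ^ k).map (Int.castRingHom ℚ) : Polynomial ℚ) : PowerSeries ℚ) *
      expand p hp0 (PowerSeries.mk fun n => ((k - 1 + n).choose (k - 1) : ℚ)) := by
    rw [← h1, gS, mul_pow, map_pow, Polynomial.map_pow, Polynomial.coe_pow]
  rw [h2, coeff_mul_expand]
  refine Finset.sum_congr rfl fun i _ => ?_
  rw [Polynomial.coeff_coe, Polynomial.coeff_map, coeff_mk, aco]
  simp

lemma coeff_gS_pow_dvd {p : ℕ} (hp : p.Prime) (k M : ℕ) (hk : 0 < k) :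
    ∃ z : ℤ, ((k - 1).factorial : ℚ) * PowerSeries.coeff (p * M) (gS p hp.ne_zero ^ k) = M * z := by
  have key : ∀ i ∈ Finset.range (M + 1), ∃ z : ℤ, (aco p k i) * 
      (((k - 1).factorial * (k - 1 + (M - i)).choose (k - 1) : ℕ) : ℤ) = M * z := by
    intro i hi
    rw [Finset.mem_range] at hi
    by_cases h0 : i = 0
    · subst h0; exact ⟨0, by rw [aco_zero p k (by omega)]; simp⟩
    by_cases h1 : k ≤ i
    · exact ⟨0, by rw [aco_big hp (by omega) h1]; simp⟩
    rw [← Nat.descFactorial_eq_factorial_mul_choose, Nat.descFactorial_eq_prod_range]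
    have hd := Finset.dvd_prod_of_mem (fun t => k - 1 + (M - i) - t)
      (show k - 1 - i ∈ Finset.range (k - 1) by rw [Finset.mem_range]; omega)
    have he : k - 1 + (M - i) - (k - 1 - i) = M := by omega
    simp only [he] at hd
    obtain ⟨c, hc⟩ := hd
    refine ⟨aco p k i * c, ?_⟩
    rw [hc]; push_cast; ring
  choose! z hz using key
  refine ⟨∑ i ∈ Finset.range (M + 1), z i, ?_⟩
  rw [coeff_gS_pow hp.ne_zero k M hk, Finset.mul_sum, Int.cast_sum, Finset.mul_sum]
  refine Finset.sum_congr rfl fun i hi => ?_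
  have := hz i hi
  have h2 : (aco p k i : ℚ) * ((k - 1).factorial * (k - 1 + (M - i)).choose (k - 1)) = M * z i := by
    exact_mod_cast this
  rw [← h2]; ring

lemma descFac_six (n : ℕ) : ((6 : ℕ).factorial : ℚ) * ((6 + n).choose 6 : ℚ) =
    (n + 6) * (n + 5) * (n + 4) * (n + 3) * (n + 2) * (n + 1) := by
  rw [← Nat.cast_mul, ← Nat.descFactorial_eq_factorial_mul_choose]
  simp only [Nat.descFactorial_succ, Nat.descFactorial_zero]
  have h : 6 + n - 5 = n + 1 := by omega
  have h4 : 6 + n - 4 = n + 2 := by omega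
  have h3 : 6 + n - 3 = n + 3 := by omega
  have h2 : 6 + n - 2 = n + 4 := by omega
  have h1 : 6 + n - 1 = n + 5 := by omega
  rw [h, h1, h2, h3, h4, Nat.sub_zero]
  push_cast; ring

lemma coeff_g7 {p : ℕ} (hp : p.Prime) (M : ℕ) (hM : 6 ≤ M) : ∃ z : ℤ,
    720 * PowerSeries.coeff (p * M) (gS p hp.ne_zero ^ 7) =
      M * ((120 * aco p 7 1 - 24 * aco p 7 2 + 12 * aco p 7 3 - 12 * aco p 7 4 + 24 * aco p 7 5
        - 120 * aco p 7 6 : ℤ) : ℚ) + M ^ 2 * z := by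
  obtain ⟨n, rfl⟩ := Nat.exists_eq_add_of_le hM
  have h720 : (720 : ℚ) = ((6 : ℕ).factorial : ℚ) := by norm_num [Nat.factorial]
  have hs : PowerSeries.coeff (p * (6 + n)) (gS p hp.ne_zero ^ 7) =
      ∑ i ∈ Finset.range 7, (aco p 7 i : ℚ) * ((6 + (6 + n - i)).choose 6 : ℚ) := by
    rw [coeff_gS_pow hp.ne_zero 7 _ (by norm_num)]
    symm
    apply Finset.sum_subset
    · intro i hi; rw [Finset.mem_range] at *; omega
    · intro i _ hi; rw [Finset.mem_range] at hi
      rw [aco_big hp (by norm_num) (by omega)]; simp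
  have key : ∀ i, i ≤ 6 → 720 * ((6 + (6 + n - i)).choose 6 : ℚ) =
      (((6 + n : ℕ) : ℚ) - i + 6) * (((6 + n : ℕ) : ℚ) - i + 5) * (((6 + n : ℕ) : ℚ) - i + 4) *
      (((6 + n : ℕ) : ℚ) - i + 3) * (((6 + n : ℕ) : ℚ) - i + 2) * (((6 + n : ℕ) : ℚ) - i + 1) := by
    intro i hi
    rw [h720, descFac_six, Nat.cast_sub (by omega)]
  have k1 := key 1 (by norm_num)
  have k2 := key 2 (by norm_num)
  have k3 := key 3 (by norm_num)
  have k4 := key 4 (by norm_num)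
  have k5 := key 5 (by norm_num)
  have k6 := key 6 (by norm_num)
  rw [hs]
  simp only [Finset.sum_range_succ, Finset.sum_range_zero]
  rw [aco_zero p 7 (by norm_num)]
  set M : ℕ := 6 + n with hMd
  refine ⟨aco p 7 1 * ((274) * (M : ℤ) ^ 0 + (225) * (M : ℤ) ^ 1 + (85) * (M : ℤ) ^ 2 + (15) * (M : ℤ) ^ 3 + (1) * (M : ℤ) ^ 4) +
    aco p 7 2 * ((-26) * (M : ℤ) ^ 0 + (15) * (M : ℤ) ^ 1 + (25) * (M : ℤ) ^ 2 + (9) * (M : ℤ) ^ 3 + (1) * (M : ℤ) ^ 4) +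
    aco p 7 3 * ((4) * (M : ℤ) ^ 0 + (-15) * (M : ℤ) ^ 1 + (-5) * (M : ℤ) ^ 2 + (3) * (M : ℤ) ^ 3 + (1) * (M : ℤ) ^ 4) +
    aco p 7 4 * ((4) * (M : ℤ) ^ 0 + (15) * (M : ℤ) ^ 1 + (-5) * (M : ℤ) ^ 2 + (-3) * (M : ℤ) ^ 3 + (1) * (M : ℤ) ^ 4) +
    aco p 7 5 * ((-26) * (M : ℤ) ^ 0 + (-15) * (M : ℤ) ^ 1 + (25) * (M : ℤ) ^ 2 + (-9) * (M : ℤ) ^ 3 + (1) * (M : ℤ) ^ 4) +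
    aco p 7 6 * ((274) * (M : ℤ) ^ 0 + (-225) * (M : ℤ) ^ 1 + (85) * (M : ℤ) ^ 2 + (-15) * (M : ℤ) ^ 3 + (1) * (M : ℤ) ^ 4), ?_⟩
  push_cast at *
  linear_combination (aco p 7 1 : ℚ) * k1 + (aco p 7 2 : ℚ) * k2 + (aco p 7 3 : ℚ) * k3
   + (aco p 7 4 : ℚ) * k4 + (aco p 7 5 : ℚ) * k5 + (aco p 7 6 : ℚ) * k6
lemma fact_val {p : ℕ} (hp : p.Prime) (hp8 : 8 < p) (j : ℕ) (hj : 1 ≤ j) :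
    ∃ v u : ℕ, v + 1 ≤ j ∧ ¬ p ∣ u ∧ (7 + j).factorial * (7 + j - 1).factorial = p ^ v * u := by
  have := Fact.mk hp
  have hp11 : 10 ≤ p - 1 := by
    rcases Nat.lt_or_ge p 11 with h | h
    · interval_cases p <;> revert hp <;> norm_num
    · omega
  have h1 := sub_one_mul_padicValNat_factorial_lt_of_ne_zero p (show 7 + j ≠ 0 by omega)
  have h2 := sub_one_mul_padicValNat_factorial_lt_of_ne_zero p (show 7 + j - 1 ≠ 0 by omega)
  set v1 := padicValNat p (7 + j).factorial with hv1
  set v2 := padicValNat p (7 + j - 1).factorial with hv2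
  have h1' := lt_of_le_of_lt (Nat.mul_le_mul_right v1 hp11) h1
  have h2' := lt_of_le_of_lt (Nat.mul_le_mul_right v2 hp11) h2
  have hne : (7 + j).factorial * (7 + j - 1).factorial ≠ 0 :=
    mul_ne_zero (Nat.factorial_ne_zero _) (Nat.factorial_ne_zero _)
  obtain ⟨v, u, hu, h⟩ := Nat.exists_eq_pow_mul_and_not_dvd hne p hp.ne_one
  refine ⟨v, u, ?_, hu, h⟩
  have hv := congrArg (padicValNat p) h
  rw [padicValNat.mul (Nat.factorial_ne_zero _) (Nat.factorial_ne_zero _),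
    padicValNat.mul (pow_ne_zero _ hp.ne_zero) (by rintro rfl; exact hu (dvd_zero _)),
    padicValNat.prime_pow, padicValNat.eq_zero_of_not_dvd hu] at hv
  omega

lemma term_PI {p : ℕ} (hp : p.Prime) (hp8 : 8 < p) (L t m j : ℕ) (hj : 1 ≤ j) :
    PI p (t + 1) (((Psi p L) ^ 7).coeff j *
      PowerSeries.coeff (p * (p ^ t * m)) (gS p hp.ne_zero ^ (7 + j))) := by
  obtain ⟨v, u, hv, hu, h⟩ := fact_val hp hp8 j hj
  obtain ⟨z, hz⟩ := Psi_pow_coeff p L 7 j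
  obtain ⟨w, hw⟩ := coeff_gS_pow_dvd hp (7 + j) (p ^ t * m) (by omega)
  have h' : ((7 + j).factorial : ℚ) * ((7 + j - 1).factorial : ℚ) = p ^ v * u := by exact_mod_cast h
  set c := ((Psi p L) ^ 7).coeff j
  set G := PowerSeries.coeff (p * (p ^ t * m)) (gS p hp.ne_zero ^ (7 + j))
  have e : (p : ℚ) ^ v * (((u : ℤ) : ℚ) * (c * G)) = p ^ (v + (j + t - v)) * ((m * z * w : ℤ) : ℚ) := by
    have : v + (j + t - v) = j + t := by omega
    rw [this, pow_add]
    push_cast at hw ⊢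
    linear_combination (-(c * G)) * h' + ((7 + j - 1).factorial : ℚ) * G * hz + (p ^ j * z : ℚ) * hw
  have h1 : PI p (j + t - v) (((u : ℤ) : ℚ) * (c * G)) := by
    apply PI.cancel_pow hp (s := v)
    rw [e]
    exact PI.int hp _ _
  have h2 := PI.cancel hp (c := (u : ℤ)) (by exact_mod_cast hu) h1
  exact h2.mono (by omega)

lemma coeff_f_sub_g {p : ℕ} (hp : p.Prime) (hp8 : 8 < p) (t m : ℕ) (hm : 0 < m) :
    PI p (t + 1) (PowerSeries.coeff (p * (p ^ t * m)) (fPlus p ^ 7) -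
      PowerSeries.coeff (p * (p ^ t * m)) (gS p hp.ne_zero ^ 7)) := by
  set L := p * (p ^ t * m) with hL
  have hLpos : 0 < L := Nat.mul_pos hp.pos (Nat.mul_pos (pow_pos hp.pos _) hm)
  have h0 : ((Psi p L) ^ 7).coeff 0 = 1 := by
    rw [Polynomial.coeff_zero_eq_eval_zero, Polynomial.eval_pow,
      ← Polynomial.coeff_zero_eq_eval_zero, Psi_coeff, if_pos hLpos]
    norm_num
  rw [coeff_f_pow hp hp8 L, Finset.sum_range_succ', h0, one_mul, add_zero, add_sub_cancel_right]
  refine PI.sum hp _ _ fun j _ => ?_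
  exact term_PI hp hp8 L t m (j + 1) (by omega)

lemma coeff_f_p {p : ℕ} (hp : p.Prime) (hp8 : 8 < p) :
    PI p 1 (PowerSeries.coeff p (fPlus p ^ 7) - aco p 7 1) := by
  have h := coeff_f_sub_g hp hp8 0 1 one_pos
  rw [pow_zero, mul_one, coeff_gS_pow hp.ne_zero 7 1 (by norm_num)] at h
  simpa [Finset.sum_range_succ, aco_zero p 7 (by norm_num)] using h
open Polynomial in
lemma PP_coeff (p k : ℕ) : (PP p).coeff k =
    if 1 ≤ k ∧ k < p then (-1 : ℤ) ^ (k + 1) * ((p.choose k / p : ℕ) : ℤ) else 0 := by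
  rw [PP, finsetSum_coeff]
  simp only [coeff_C_mul_X_pow]
  rw [Finset.sum_ite_eq]
  simp

open Polynomial in
lemma PP_reflect {p : ℕ} (hp : p.Prime) (hp8 : 8 < p) : (PP p).reflect p = - PP p := by
  have hodd : Odd p := hp.odd_of_ne_two (by omega)
  ext k
  rw [coeff_reflect, coeff_neg, PP_coeff, PP_coeff]
  by_cases hk : k ≤ p
  · rw [revAt_le hk]
    by_cases h1 : 1 ≤ k ∧ k < p
    · rw [if_pos h1, if_pos (by omega), Nat.choose_symm hk]
      have : (-1 : ℤ) ^ (p - k + 1) = - (-1) ^ (k + 1) := by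
        have h2 : (-1 : ℤ) ^ (p - k + 1) * (-1) ^ (k + 1) = -1 := by
          rw [← pow_add, show p - k + 1 + (k + 1) = p + 2 by omega]
          exact (hodd.add_even even_two).neg_one_pow
        have h3 : (-1 : ℤ) ^ (k + 1) * (-1) ^ (k + 1) = 1 := by
          rw [← mul_pow]; norm_num
        linear_combination (-1 : ℤ) ^ (k + 1) * h2 - (-1 : ℤ) ^ (p - k + 1) * h3
      rw [this]; ring
    · rw [if_neg h1, if_neg (by omega)]; simp
  · rw [revAt_eq_self_of_lt (by omega), if_neg (by omega)]; simp

open Polynomial in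
lemma PP_pow_reflect {p : ℕ} (hp : p.Prime) (hp8 : 8 < p) (k : ℕ) :
    ((PP p) ^ k).reflect (k * p) = (- PP p) ^ k := by
  have hdeg : (PP p).natDegree ≤ p := (PP_natDegree p).trans (by omega)
  induction k with
  | zero => simp
  | succ k ih =>
    rw [pow_succ, add_mul, one_mul, reflect_mul _ _ (natDegree_pow_le_of_le k hdeg) hdeg, ih,
      PP_reflect hp hp8, pow_succ]

open Polynomial in
lemma aco_symm {p : ℕ} (hp : p.Prime) (hp8 : 8 < p) (i : ℕ) (hi : i ≤ 7) :
    aco p 7 (7 - i) = - aco p 7 i := by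
  have h := congrArg (fun q => q.coeff (p * i)) (PP_pow_reflect hp hp8 7)
  simp only [coeff_reflect] at h
  have hle : p * i ≤ 7 * p := by rw [mul_comm]; exact Nat.mul_le_mul_right _ hi
  rw [revAt_le hle, Odd.neg_pow (by decide), coeff_neg] at h
  rw [aco, aco, ← h, Nat.mul_sub, mul_comm 7 p]

open Polynomial in
lemma PP_comp {p : ℕ} (hp : p.Prime) (hp8 : 8 < p) : (PP p).comp (1 - X) = PP p := by
  have hpn : (p : ℤ[X]) ≠ 0 := Nat.cast_ne_zero.2 hp.ne_zero
  have h := PP_spec hp hp8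
  have h2 := congrArg (fun q => q.comp (1 - X)) h
  simp only [mul_comp, natCast_comp, sub_comp, one_comp, pow_comp, X_comp, sub_sub_cancel] at h2
  apply mul_left_cancel₀ hpn
  rw [h, h2]; ring

open Polynomial in
lemma PP_deriv {p : ℕ} (hp : p.Prime) (hp8 : 8 < p) :
    derivative (PP p) = (1 - X) ^ (p - 1) - X ^ (p - 1) := by
  have hpn : (p : ℤ[X]) ≠ 0 := Nat.cast_ne_zero.2 hp.ne_zero
  have h2 := congrArg derivative (PP_spec hp hp8)
  simp only [derivative_mul, derivative_natCast, derivative_sub, derivative_one, derivative_pow,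
    derivative_X] at h2
  apply mul_left_cancel₀ hpn
  simp at h2
  linear_combination h2

open Polynomial in
/-- the generating polynomial of the `a_i` modulo `p`. -/
noncomputable def apol (p : ℕ) : (ZMod p)[X] :=
  ∑ i ∈ Finset.range 7, C ((aco p 7 i : ℤ) : ZMod p) * X ^ i

open Polynomial in
lemma apol_coeff {p : ℕ} (hp : p.Prime) (i : ℕ) :
    (apol p).coeff i = ((aco p 7 i : ℤ) : ZMod p) := by
  rw [apol, finsetSum_coeff]
  simp only [coeff_C_mul_X_pow]
  rw [Finset.sum_ite_eq]
  split_ifs with h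
  · rfl
  · rw [Finset.mem_range] at h
    rw [aco_big hp (by norm_num) (by omega)]; simp

open Polynomial in
lemma iter_deriv_P {p : ℕ} (hp : p.Prime) (q : ℤ[X]) :
    derivative^[p - 1] (q.map (Int.castRingHom (ZMod p)) * X ^ (p - 1)) =
    C (((p - 1).factorial : ℕ) : ZMod p) * expand (ZMod p) p
      (∑ i ∈ Finset.range (q.natDegree + 1), C ((q.coeff (p * i) : ℤ) : ZMod p) * X ^ i) := by
  have hpos := hp.pos
  ext m
  rw [coeff_iterate_derivative, coeff_mul_X_pow, coeff_C_mul, coeff_expand hpos, nsmul_eq_mul,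
    Nat.descFactorial_eq_prod_range]
  split_ifs with h
  · obtain ⟨i, rfl⟩ := h
    rw [Nat.mul_div_cancel_left _ hpos, finsetSum_coeff, coeff_map]
    simp only [coeff_C_mul_X_pow]
    rw [Finset.sum_ite_eq]
    have hfac : ((∏ t ∈ Finset.range (p - 1), (p * i + (p - 1) - t) : ℕ) : ZMod p) =
        (((p - 1).factorial : ℕ) : ZMod p) := by
      rw [← Nat.descFactorial_self, Nat.descFactorial_eq_prod_range, Nat.cast_prod, Nat.cast_prod]
      refine Finset.prod_congr rfl fun t ht => ?_
      rw [Finset.mem_range] at ht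
      rw [show p * i + (p - 1) - t = p * i + (p - 1 - t) by omega]
      push_cast
      simp
    rw [hfac]
    congr 1
    split_ifs with hi
    · rfl
    · rw [Finset.mem_range] at hi
      rw [coeff_eq_zero_of_natDegree_lt]
      · simp
      · have := Nat.le_mul_of_pos_left i hpos
        omega
  · have : ((∏ t ∈ Finset.range (p - 1), (m + (p - 1) - t) : ℕ) : ZMod p) = 0 := by
      rw [ZMod.natCast_eq_zero_iff]
      have hm := Nat.mod_lt m hpos
      have hm0 : m % p ≠ 0 := fun h0 => h (Nat.dvd_of_mod_eq_zero h0)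
      have hd := Nat.div_add_mod m p
      refine dvd_trans ?_ (Finset.dvd_prod_of_mem _ (show m % p - 1 ∈ Finset.range (p - 1) by
        rw [Finset.mem_range]; omega))
      refine ⟨m / p + 1, ?_⟩
      rw [mul_add]; omega
    rw [this]; simp

open Polynomial in
lemma apol_comp {p : ℕ} (hp : p.Prime) (hp8 : 8 < p) : (apol p).comp (1 - X) = apol p := by
  have := Fact.mk hp
  set P := (PP p).map (Int.castRingHom (ZMod p)) with hP
  have hPc : P.comp (1 - X) = P := by
    have h := congrArg (Polynomial.map (Int.castRingHom (ZMod p))) (PP_comp hp hp8)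
    rw [Polynomial.map_comp] at h
    simpa using h
  have hPd : derivative P = (1 - X) ^ (p - 1) - X ^ (p - 1) := by
    have h := congrArg (Polynomial.map (Int.castRingHom (ZMod p))) (PP_deriv hp hp8)
    rw [hP, derivative_map]
    simpa using h
  set h := P ^ 7 * X ^ (p - 1) with hh
  have hD : ∃ c : ZMod p, c ≠ 0 ∧ derivative^[p - 1] h = C c * expand (ZMod p) p (apol p) := by
    refine ⟨(((p - 1).factorial : ℕ) : ZMod p), ?_, ?_⟩
    · rw [Ne, ZMod.natCast_eq_zero_iff, hp.dvd_factorial]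
      have := hp.pos; omega
    · have e := iter_deriv_P hp ((PP p) ^ 7)
      rw [Polynomial.map_pow] at e
      rw [hh, e]
      congr 2
      ext i
      rw [apol_coeff hp, finsetSum_coeff]
      simp only [coeff_C_mul_X_pow]
      rw [Finset.sum_ite_eq]
      split_ifs with hi
      · rfl
      · rw [Finset.mem_range] at hi
        rw [aco, coeff_eq_zero_of_natDegree_lt]
        · simp
        · have := Nat.le_mul_of_pos_left i hp.pos
          omega
  have hinv : (derivative^[p - 1] h).comp (1 - X) = derivative^[p - 1] h := by
    have e1 := iterate_derivative_comp_one_sub_X h (p - 1)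
    have hev : Even (p - 1) := by
      have hodd : Odd p := hp.odd_of_ne_two (by omega)
      obtain ⟨q, hq⟩ := hodd
      exact ⟨q, by omega⟩
    rw [hev.neg_one_pow, one_mul] at e1
    rw [← e1]
    have e2 : 8 * (h.comp (1 - X) - h) = derivative (P ^ 8) := by
      rw [hh, derivative_pow, hPd, mul_comp, pow_comp, hPc, pow_comp, X_comp]
      have hC8 : (C (8 : ZMod p)) = 8 := rfl
      simp [hC8]
      ring
    have e3 : derivative^[p - 1] (derivative (P ^ 8)) = 0 := by
      rw [← Function.iterate_succ_apply, Nat.succ_eq_add_one, Nat.sub_add_cancel hp.pos]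
      ext m
      rw [coeff_iterate_derivative, nsmul_eq_mul]
      have : (((m + p).descFactorial p : ℕ) : ZMod p) = 0 := by
        rw [ZMod.natCast_eq_zero_iff]
        exact (Nat.dvd_factorial hp.pos le_rfl).trans (Nat.factorial_dvd_descFactorial _ _)
      rw [this]; simp
    have h8 : (8 : ZMod p) ≠ 0 := by
      have : ((8 : ℕ) : ZMod p) ≠ 0 := by
        rw [Ne, ZMod.natCast_eq_zero_iff]
        intro hd
        exact absurd (Nat.le_of_dvd (by norm_num) hd) (by omega)
      exact_mod_cast this
    have e4 : derivative^[p - 1] (C (8 : ZMod p) * (h.comp (1 - X) - h)) = 0 := by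
      rw [← e3, ← e2]; rfl
    rw [iterate_derivative_C_mul, iterate_derivative_sub] at e4
    have e5 := (mul_eq_zero.1 e4).resolve_left (fun h0 => h8 (C_eq_zero.1 h0))
    exact sub_eq_zero.1 e5
  obtain ⟨c, hc, hD⟩ := hD
  rw [hD, mul_comp, C_comp] at hinv
  have h2 := mul_left_cancel₀ (show C c ≠ 0 by rwa [Ne, C_eq_zero]) hinv
  apply expand_injective hp.pos
  rw [← h2, expand_eq_comp_X_pow, expand_eq_comp_X_pow, comp_assoc, comp_assoc]
  congr 1
  simp
  rw [sub_pow_expChar]; simp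

open Polynomial in
lemma aco_rel {p : ℕ} (hp : p.Prime) (hp8 : 8 < p) :
    (p : ℤ) ∣ (120 * aco p 7 1 - 24 * aco p 7 2 + 12 * aco p 7 3 - 12 * aco p 7 4 + 24 * aco p 7 5
        - 120 * aco p 7 6) - 504 * aco p 7 1 := by
  have := Fact.mk hp
  have h := apol_comp hp hp8
  have s6 := aco_symm hp hp8 1 (by norm_num)
  have s5 := aco_symm hp hp8 2 (by norm_num)
  have s4 := aco_symm hp hp8 3 (by norm_num)
  norm_num at s6 s5 s4
  have h1 := congrArg (fun q => eval 0 (derivative^[1] q)) h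
  have h2 := congrArg (fun q => eval 0 (derivative^[2] q)) h
  simp only [iterate_derivative_comp_one_sub_X] at h1 h2
  simp [apol, Finset.sum_range_succ, aco_zero, s4, s5, s6] at h1 h2
  rw [← ZMod.intCast_zmod_eq_zero_iff_dvd, s4, s5, s6]
  push_cast
  linear_combination 384 * h1 + 60 * h2
/-- the logarithm series. -/
noncomputable def Lser : PowerSeries ℚ := PowerSeries.mk fun l => (1 : ℚ) / l

open PowerSeries in
lemma deriv_Lser : derivative ℚ Lser * (1 - X) = 1 := by
  have : derivative ℚ Lser = PowerSeries.mk 1 := by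
    ext n
    rw [coeff_derivative, Lser, coeff_mk, coeff_mk]
    have h0 : ((n : ℚ) + 1) ≠ 0 := by positivity
    push_cast
    rw [Pi.one_apply, one_div_mul_cancel h0]
  rw [this]
  exact PowerSeries.mk_one_mul_one_sub_eq_one ℚ

open PowerSeries in
lemma coeff_f_eq_L (p : ℕ) :
    coeff p (fPlus p ^ 7) = coeff p (Lser ^ 7) := by
  have hf : X ∣ fPlus p := by
    rw [X_dvd_iff, ← coeff_zero_eq_constantCoeff_apply, fPlus, coeff_mk]; simp
  have hL : X ∣ Lser := by
    rw [X_dvd_iff, ← coeff_zero_eq_constantCoeff_apply, Lser, coeff_mk]; simp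
  have hd : X ^ p ∣ fPlus p - Lser := by
    rw [X_pow_dvd_iff]
    intro m hm
    rw [map_sub, fPlus, Lser, coeff_mk, coeff_mk]
    split_ifs with h
    · rcases Nat.eq_zero_or_pos m with rfl | h0
      · simp
      · exact absurd (Nat.le_of_dvd h0 h) (by omega)
    · simp
  have h1 : X ^ (p + 1) ∣ fPlus p ^ 7 - Lser ^ 7 := by
    have e : fPlus p ^ 7 - Lser ^ 7 = (fPlus p - Lser) *
        (fPlus p * (fPlus p ^ 5 + fPlus p ^ 4 * Lser + fPlus p ^ 3 * Lser ^ 2 +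
          fPlus p ^ 2 * Lser ^ 3 + fPlus p * Lser ^ 4 + Lser ^ 5) + Lser * Lser ^ 5) := by ring
    rw [e, pow_succ]
    exact mul_dvd_mul hd (dvd_add (hf.mul_right _) (hL.mul_right _))
  rw [X_pow_dvd_iff] at h1
  have := h1 p (by omega)
  rwa [map_sub, sub_eq_zero] at this

open PowerSeries in
lemma coeff_L_rec (n N : ℕ) : ((N : ℚ) + 1) * coeff (N + 1) (Lser ^ (n + 1)) =
    N * coeff N (Lser ^ (n + 1)) + (n + 1) * coeff N (Lser ^ n) := by
  have h : derivative ℚ (Lser ^ (n + 1)) * (1 - X) = ((n + 1 : ℕ) : PowerSeries ℚ) * Lser ^ n := by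
    rw [Derivation.leibniz_pow, Nat.add_sub_cancel, smul_eq_mul, nsmul_eq_mul]
    linear_combination (((n + 1 : ℕ) : PowerSeries ℚ) * Lser ^ n) * deriv_Lser
  have h2 := congrArg (coeff N) h
  rw [mul_sub, mul_one, map_sub, coeff_derivative, ← nsmul_eq_mul, map_nsmul, nsmul_eq_mul] at h2
  rcases N with _ | N
  · rw [coeff_zero_mul_X] at h2
    push_cast at h2 ⊢
    linear_combination h2
  · rw [coeff_succ_mul_X, coeff_derivative] at h2
    push_cast at h2 ⊢
    linear_combination h2

open Polynomial in
/-- rising factorial polynomial. -/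
noncomputable def Rpol (N : ℕ) : ℚ[X] := ∏ i ∈ Finset.range N, (X + C (i : ℚ))

open Polynomial in
lemma L_stirling (N : ℕ) : ∀ n : ℕ, (N.factorial : ℚ) * PowerSeries.coeff N (Lser ^ n) =
    n.factorial * (Rpol N).coeff n := by
  induction N with
  | zero =>
    intro n
    rw [PowerSeries.coeff_zero_eq_constantCoeff_apply, map_pow]
    have : PowerSeries.constantCoeff Lser = 0 := by
      rw [← PowerSeries.coeff_zero_eq_constantCoeff_apply, Lser, PowerSeries.coeff_mk]; simp
    rw [this]
    rcases n with _ | n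
    · simp [Rpol]
    · simp [Rpol, coeff_one]
  | succ N ih =>
    intro n
    have hR : Rpol (N + 1) = Rpol N * (X + C (N : ℚ)) := by
      rw [Rpol, Finset.prod_range_succ, ← Rpol]
    rcases n with _ | n
    · have h0 := ih 0
      rw [pow_zero, PowerSeries.coeff_one, if_neg (by omega), hR, mul_add, coeff_add, coeff_mul_C,
        mul_coeff_zero, coeff_X_zero]
      rw [pow_zero, PowerSeries.coeff_one] at h0
      split_ifs at h0 with hN
      · subst hN; simp
      · simp at h0; rw [← h0]; simp
    · rw [hR, mul_add, coeff_add, coeff_mul_C, coeff_mul_X]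
      have h1 := ih n
      have h2 := ih (n + 1)
      have h3 := coeff_L_rec n N
      rw [Nat.factorial_succ N] 
      rw [Nat.factorial_succ n] at h2 ⊢
      push_cast at h2 ⊢
      linear_combination (N.factorial : ℚ) * h3 + N * h2 + (n + 1 : ℚ) * h1

lemma bern_PI {p : ℕ} (hp : p.Prime) : ∀ i : ℕ, i + 1 < p → PI p 0 (bernoulli i) := by
  intro i
  induction i using Nat.strong_induction_on with
  | _ i ih =>
    intro hi
    have h := sum_bernoulli (i + 1)
    rw [Finset.sum_range_succ, Nat.choose_succ_self_right] at h
    apply PI.cancel hp (c := ((i + 1 : ℕ) : ℤ))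
    · intro hd
      exact absurd (Nat.le_of_dvd (by omega) (Int.natCast_dvd_natCast.1 hd)) (by omega)
    have e : (((i + 1 : ℕ) : ℤ) : ℚ) * bernoulli i = ((if i + 1 = 1 then 1 else 0 : ℤ) : ℚ) -
        ∑ x ∈ Finset.range i, ((i + 1).choose x : ℚ) * bernoulli x := by
      push_cast at h ⊢
      linear_combination h
    rw [e]
    refine (PI.int0 hp _).sub hp (PI.sum hp _ _ fun x hx => ?_)
    rw [Finset.mem_range] at hx
    exact (PI.int0 hp ((i + 1).choose x : ℤ)).mul hp (ih x hx (by omega))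

lemma psum_PI2 {p : ℕ} (hp : p.Prime) (k : ℕ) (hk : k + 1 < p) :
    PI p 2 (∑ i ∈ Finset.range p, (i : ℚ) ^ k - p * bernoulli k) := by
  rw [sum_range_pow, Finset.sum_range_succ]
  have hk0 : ((k : ℚ) + 1) ≠ 0 := by positivity
  have e : bernoulli k * ((k + 1).choose k : ℚ) * (p : ℚ) ^ (k + 1 - k) / (k + 1) = p * bernoulli k := by
    rw [Nat.choose_succ_self_right, Nat.add_sub_cancel_left]
    push_cast
    field_simp
  rw [e, add_sub_cancel_right]
  refine PI.sum hp _ _ fun i hi => ?_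
  rw [Finset.mem_range] at hi
  apply PI.cancel hp (c := ((k + 1 : ℕ) : ℤ))
  · intro hd
    exact absurd (Nat.le_of_dvd (by omega) (Int.natCast_dvd_natCast.1 hd)) (by omega)
  have e2 : (((k + 1 : ℕ) : ℤ) : ℚ) * (bernoulli i * ((k + 1).choose i : ℚ) * (p : ℚ) ^ (k + 1 - i) /
      (k + 1)) = (p ^ (k + 1 - i) * (((k + 1).choose i : ℤ) : ℚ)) * bernoulli i := by
    push_cast
    field_simp
  rw [e2]
  exact ((PI.int hp (k + 1 - i) _).mul hp (bern_PI hp i (by omega))).mono (by omega)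

lemma psum_PI1 {p : ℕ} (hp : p.Prime) (k : ℕ) (hk : k + 1 < p) :
    PI p 1 (∑ i ∈ Finset.range p, (i : ℚ) ^ k) := by
  have h1 := (psum_PI2 hp k hk).mono (show 1 ≤ 2 by norm_num)
  have h2 : PI p 1 ((p : ℚ) * bernoulli k) := by
    have := (PI.int hp 1 1).mul hp (bern_PI hp k hk)
    simpa using this
  simpa using h1.add hp h2

/-- elementary symmetric functions of `0, …, p-1`. -/
noncomputable def eP (p k : ℕ) : ℚ :=
  MvPolynomial.aeval (fun i : Fin p => (i.val : ℚ)) (MvPolynomial.esymm (Fin p) ℚ k)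

lemma eP_zero (p : ℕ) : eP p 0 = 1 := by simp [eP]

lemma eP_newton (p k : ℕ) : (k : ℚ) * eP p k = (-1) ^ (k + 1) *
    ∑ i ∈ Finset.range k, (-1) ^ i * eP p i * ∑ t ∈ Finset.range p, (t : ℚ) ^ (k - i) := by
  have h := congrArg (MvPolynomial.aeval (fun i : Fin p => (i.val : ℚ)))
    (MvPolynomial.mul_esymm_eq_sum (Fin p) ℚ k)
  simp only [map_mul, map_pow, map_neg, map_one, map_sum, map_natCast] at h
  rw [← eP] at h
  rw [h]
  congr 1
  rw [Finset.sum_filter, Finset.Nat.sum_antidiagonal_eq_sum_range_succ_mk,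
    Finset.sum_range_succ]
  simp only [lt_irrefl, if_false, add_zero]
  refine Finset.sum_congr rfl fun i hi => ?_
  rw [Finset.mem_range] at hi
  rw [if_pos hi, ← eP]
  congr 1
  rw [MvPolynomial.psum, map_sum, Finset.sum_range]
  simp

lemma eP_PI {p : ℕ} (hp : p.Prime) : ∀ k : ℕ, 1 ≤ k → k + 1 < p → PI p 1 (eP p k) := by
  intro k
  induction k using Nat.strong_induction_on with
  | _ k ih =>
    intro h1 hk
    apply PI.cancel hp (c := (k : ℤ))
    · intro hd
      exact absurd (Nat.le_of_dvd (by omega) (Int.natCast_dvd_natCast.1 hd)) (by omega)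
    rw [Int.cast_natCast, eP_newton]
    have hs : ∀ n : ℕ, PI p 0 ((-1 : ℚ) ^ n) := fun n => by
      simpa using PI.int0 hp ((-1) ^ n)
    have := (hs (k + 1)).mul hp (PI.sum (s := 1) hp (Finset.range k) (fun i => (-1) ^ i * eP p i *
      ∑ t ∈ Finset.range p, (t : ℚ) ^ (k - i)) ?_)
    · simpa using this
    intro i hi
    rw [Finset.mem_range] at hi
    have hei : PI p 0 (eP p i) := by
      rcases Nat.eq_zero_or_pos i with rfl | h0
      · rw [eP_zero]; simpa using PI.int0 hp 1
      · exact (ih i hi h0 (by omega)).mono (by norm_num)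
    simpa using ((hs i).mul hp hei).mul hp (psum_PI1 hp (k - i) (by omega))

lemma eP_PI2 {p : ℕ} (hp : p.Prime) (k : ℕ) (h1 : 1 ≤ k) (hk : k + 1 < p) (hev : Even k) :
    PI p 2 (k * eP p k + p * bernoulli k) := by
  have hs : ∀ n : ℕ, PI p 0 ((-1 : ℚ) ^ n) := fun n => by
    simpa using PI.int0 hp ((-1) ^ n)
  obtain ⟨m, rfl⟩ := Nat.exists_eq_add_of_le' h1
  have e : ((m + 1 : ℕ) : ℚ) * eP p (m + 1) + p * bernoulli (m + 1) =
      -(∑ i ∈ Finset.range m, (-1) ^ (i + 1) * eP p (i + 1) *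
        ∑ t ∈ Finset.range p, (t : ℚ) ^ (m + 1 - (i + 1))) -
      (∑ i ∈ Finset.range p, (i : ℚ) ^ (m + 1) - p * bernoulli (m + 1)) := by
    rw [eP_newton, hev.add_one.neg_one_pow, Finset.sum_range_succ', eP_zero, pow_zero]
    simp only [Nat.sub_zero]
    ring
  rw [e]
  refine PI.sub hp (PI.neg (PI.sum hp _ _ fun i hi => ?_)) (psum_PI2 hp _ hk)
  rw [Finset.mem_range] at hi
  simpa using ((hs (i + 1)).mul hp (eP_PI hp (i + 1) (by omega) (by omega))).mul hp
    (psum_PI1 hp (m + 1 - (i + 1)) (by omega))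

open Polynomial in
lemma Rpol_coeff (p k : ℕ) (hk : k ≤ p) : (Rpol p).coeff k = eP p (p - k) := by
  rw [eP, MvPolynomial.aeval_esymm_eq_multiset_esymm, Rpol, Finset.prod_range]
  have := Multiset.prod_X_add_C_coeff' (Finset.univ : Finset (Fin p)).val
    (fun i : Fin p => (i.val : ℚ)) (k := k) (by simpa using hk)
  rw [show Multiset.card (Finset.univ : Finset (Fin p)).val = p by simp] at this
  rw [← this]; rfl

lemma a1_bern {p : ℕ} (hp : p.Prime) (hp8 : 8 < p) :
    PI p 1 ((aco p 7 1 : ℚ) + 720 * bernoulli (p - 7)) := by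
  have := Fact.mk hp
  have hca := coeff_f_p hp hp8
  have hodd : Odd p := hp.odd_of_ne_two (by omega)
  have hev : Even (p - 7) := Nat.Odd.sub_odd hodd (by decide)
  have h2 := eP_PI2 hp (p - 7) (by omega) (by omega) hev
  have h1 := eP_PI hp (p - 7) (by omega) (by omega)
  have hL := L_stirling p 7
  rw [Rpol_coeff p 7 (by omega), ← coeff_f_eq_L p] at hL
  set c := PowerSeries.coeff p (fPlus p ^ 7)
  set e := eP p (p - 7)
  set B := bernoulli (p - 7)
  have hc0 : PI p 0 c := by
    have := (hca.mono (show 0 ≤ 1 by norm_num)).add hp (PI.int0 hp (aco p 7 1))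
    simpa using this
  rw [Nat.cast_sub (by omega)] at h2
  have h3 : PI p 2 ((p : ℚ) * e) := by
    have := (PI.int hp 1 1).mul hp h1
    simpa using this
  have h4 : PI p 2 (720 * ((p : ℚ) * e - ((p - (7 : ℕ) : ℚ) * e + p * B))) := by
    have := (PI.int0 hp 720).mul hp (h3.sub hp h2)
    simpa using this
  have hfac : (p.factorial : ℚ) = p * ((p - 1).factorial : ℚ) := by
    rw [← Nat.cast_mul, Nat.mul_factorial_pred hp.ne_zero]
  have h5 : PI p (1 + 1) ((p : ℚ) ^ 1 * (((p - 1).factorial : ℚ) * c - 720 * B)) := by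
    have e5 : (p : ℚ) ^ 1 * (((p - 1).factorial : ℚ) * c - 720 * B) =
        720 * ((p : ℚ) * e - ((p - (7 : ℕ) : ℚ) * e + p * B)) := by
      rw [hfac] at hL
      have : ((7 : ℕ).factorial : ℚ) = 5040 := by norm_num [Nat.factorial]
      rw [this] at hL
      push_cast
      linear_combination hL
    rw [e5]; exact h4
  have h6 := PI.cancel_pow hp h5
  obtain ⟨w, hw⟩ : (p : ℤ) ∣ ((p - 1).factorial : ℤ) + 1 := by
    rw [← ZMod.intCast_zmod_eq_zero_iff_dvd]
    push_cast
    rw [ZMod.wilsons_lemma]; ring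
  have hwq : ((p - 1).factorial : ℚ) + 1 = p * w := by exact_mod_cast hw
  have h7 : PI p 1 ((p : ℚ) ^ 1 * w * c) := by
    simpa using (PI.int hp 1 w).mul hp hc0
  have e8 : (aco p 7 1 : ℚ) + 720 * B = (p : ℚ) ^ 1 * w * c - (((p - 1).factorial : ℚ) * c - 720 * B)
      - (c - aco p 7 1) := by
    linear_combination c * hwq
  rw [e8]
  exact (h7.sub hp h6).sub hp hca
lemma Z_cong {p : ℕ} (hp : p.Prime) (hp8 : 8 < p) (r : ℕ) (hr : 2 ≤ r) (m : ℕ) (hm : 0 < m) :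
    PI p r (PowerSeries.coeff (m * p ^ r) (fPlus p ^ 7) +
      504 * m * (bernoulli (p - 7) * (p : ℚ) ^ (r - 1))) := by
  obtain ⟨t, rfl⟩ := Nat.exists_eq_add_of_le' hr
  have hidx : m * p ^ (t + 2) = p * (p ^ (t + 1) * m) := by ring
  rw [hidx, show t + 2 - 1 = t + 1 by omega]
  have h1 := coeff_f_sub_g hp hp8 (t + 1) m hm
  have hM : 6 ≤ p ^ (t + 1) * m := by
    have := Nat.le_self_pow (show t + 1 ≠ 0 by omega) p
    have := Nat.le_mul_of_pos_right (p ^ (t + 1)) hm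
    omega
  obtain ⟨z, hz⟩ := coeff_g7 hp (p ^ (t + 1) * m) hM
  obtain ⟨s, hs⟩ := aco_rel hp hp8
  have ha := a1_bern hp hp8
  set Z := PowerSeries.coeff (p * (p ^ (t + 1) * m)) (fPlus p ^ 7)
  set G := PowerSeries.coeff (p * (p ^ (t + 1) * m)) (gS p hp.ne_zero ^ 7)
  set B := bernoulli (p - 7)
  set S := 120 * aco p 7 1 - 24 * aco p 7 2 + 12 * aco p 7 3 - 12 * aco p 7 4 + 24 * aco p 7 5
        - 120 * aco p 7 6 with hS
  have hSq : (S : ℚ) = 504 * aco p 7 1 + p * s := by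
    have : S = 504 * aco p 7 1 + p * s := by linear_combination hs
    rw [this]; push_cast; ring
  have h720 : ¬ (p : ℤ) ∣ 720 := by
    intro hd
    have h' : p ∣ (6 : ℕ).factorial := by
      have : ((720 : ℕ) : ℤ) = 720 := rfl
      rw [← this] at hd
      exact Int.natCast_dvd_natCast.1 hd
    rw [hp.dvd_factorial] at h'
    omega
  have hG : PI p (t + 2) (G + 504 * m * (B * (p : ℚ) ^ (t + 1))) := by
    apply PI.cancel hp (c := 720) h720
    have e : ((720 : ℤ) : ℚ) * (G + 504 * m * (B * (p : ℚ) ^ (t + 1))) =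
        ((p : ℚ) ^ (t + 1) * ((504 * m : ℤ) : ℚ)) * (aco p 7 1 + 720 * B) +
        (p ^ (t + 2) * ((m * s : ℤ) : ℚ) + p ^ (t + 2) * ((p ^ t * m ^ 2 * z : ℤ) : ℚ)) := by
      rw [hSq] at hz
      push_cast at hz ⊢
      rw [mul_add, hz]
      ring
    rw [e]
    exact ((PI.int hp (t + 1) _).mul hp ha).add hp ((PI.int hp _ _).add hp (PI.int hp _ _))
  have := h1.add hp hG
  rwa [show Z - G + (G + 504 * m * (B * (p : ℚ) ^ (t + 1))) =
    Z + 504 * m * (B * (p : ℚ) ^ (t + 1)) by ring] at this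

theorem stmt17 (r : ℕ) (hr : 2 ≤ r) (p : ℕ) (hp : p.Prime) (hp8 : 8 < p) :
    padicCong p r
      (7 * sigmaSum p 7 1 (2 * p ^ r) + 21 * sigmaSum p 7 2 (2 * p ^ r) +
        35 * sigmaSum p 7 3 (2 * p ^ r))
      (756 * bernoulli (p - 7) * (p : ℚ) ^ (r - 1)) := by
  apply PI.toCong hp
  rw [sigma_combo p hp hp8 (p ^ r)]
  have h1 := Z_cong hp hp8 r hr 1 one_pos
  have h2 := Z_cong hp hp8 r hr 2 two_pos
  rw [one_mul] at h1
  have h2' : ¬ (p : ℤ) ∣ 2 := by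
    intro hd
    exact absurd (Int.le_of_dvd (by norm_num) hd) (by omega)
  have h3 := PI.cancel hp (c := 2) h2' (x := (PowerSeries.coeff (p ^ r) (fPlus p ^ 7) +
    504 * (1 : ℕ) * (bernoulli (p - 7) * (p : ℚ) ^ (r - 1))) / 2) (by
      convert h1 using 1
      push_cast
      ring)
  have h4 := h3.sub hp h2
  convert h4 using 1
  push_cast
  ring
end

section
/- Let r ≥ 2 be an integer and let p be a prime with p > 9. Then 8·σ_8^{(1)}(2p^r, p) + 28·σ_8^{(2)}(2p^r, p) + 56·σ_8^{(3)}(2p^r, p) + 35·σ_8^{(4)}(2p^r, p) ≡ (2688/5)·B_{p−3}·B_{p−5}·p^{r−1} (mod p^r). -/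
open Finset

attribute [local instance] Classical.propDecidable

namespace S18

/-- `ι` is the inverse function on naturals prime to `p`, extended by `0`. -/
structure IsInv (p : ℕ) {R : Type*} [CommRing R] (ι : ℕ → R) : Prop where
  zero : ∀ l, p ∣ l → ι l = 0
  inv : ∀ l, ¬ p ∣ l → (l : R) * ι l = 1

lemma IsInv.map {p : ℕ} {R S : Type*} [CommRing R] [CommRing S] {ι : ℕ → R}
    (h : IsInv p ι) (φ : R →+* S) : IsInv p (fun l => φ (ι l)) := by
  refine ⟨fun l hl => by simp [h.zero l hl], fun l hl => ?_⟩
  have := congrArg φ (h.inv l hl)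
  simpa using this

section ps
variable {R : Type*} [CommRing R]

noncomputable def Phi (ι : ℕ → R) (p j : ℕ) : PowerSeries R :=
  PowerSeries.mk fun n => (-1) ^ j * (j.factorial : R) * ∏ i ∈ range (j + 1), ι (n + i * p)

noncomputable def uu (ι : ℕ → R) (p j : ℕ) : PowerSeries R :=
  PowerSeries.mk fun n => if n < p then
    (-1) ^ j * (j.factorial : R) * ∏ i ∈ range (j + 1), ι (n + i * p) else 0

noncomputable def VV (R : Type*) [CommRing R] (p K : ℕ) : PowerSeries R :=
  PowerSeries.mk fun n => if p ∣ n then ((n / p + K).choose K : R) else 0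

lemma one_sub_mul_coeff (p n : ℕ) (φ : PowerSeries R) :
    PowerSeries.coeff n ((1 - PowerSeries.X ^ p) * φ) =
      PowerSeries.coeff n φ - if p ≤ n then PowerSeries.coeff (n - p) φ else 0 := by
  rw [sub_mul, one_mul, map_sub, PowerSeries.coeff_X_pow_mul']

lemma Phi_rec {ι : ℕ → R} {p : ℕ} (h : IsInv p ι) (j : ℕ) :
    (1 - PowerSeries.X ^ p) * Phi ι p j =
      uu ι p j + (p : PowerSeries R) * PowerSeries.X ^ p * Phi ι p (j + 1) := by
  ext n
  rw [one_sub_mul_coeff, map_add, mul_assoc, ← map_natCast (PowerSeries.C (R := R)) p,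
    PowerSeries.coeff_C_mul, PowerSeries.coeff_X_pow_mul']
  simp only [Phi, uu, PowerSeries.coeff_mk]
  by_cases hn : n < p
  · simp [hn, not_le.mpr hn]
  · have hn' : p ≤ n := not_lt.mp hn
    simp only [hn, hn', if_true, if_false, zero_add]
    obtain ⟨m, rfl⟩ := Nat.exists_eq_add_of_le hn'
    rw [Nat.add_sub_cancel_left]
    by_cases hd : p ∣ m
    · have e1 : ∏ i ∈ range (j + 1), ι (p + m + i * p) = 0 :=
        prod_eq_zero (i := 0) (by simp) (h.zero _ (by simpa using hd))
      have e2 : ∏ i ∈ range (j + 1), ι (m + i * p) = 0 :=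
        prod_eq_zero (i := 0) (by simp) (h.zero _ (by simpa using hd))
      have e3 : ∏ i ∈ range (j + 1 + 1), ι (m + i * p) = 0 :=
        prod_eq_zero (i := 0) (by simp) (h.zero _ (by simpa using hd))
      rw [e1, e2, e3]; simp
    · have e1 : ∏ i ∈ range (j + 1 + 1), ι (m + i * p) =
        (∏ i ∈ range (j + 1), ι (p + m + i * p)) * ι m := by
        rw [prod_range_succ']
        congr 1
        · exact prod_congr rfl fun i _ => by congr 1; ring
        · simp
      have e2 : ∏ i ∈ range (j + 1 + 1), ι (m + i * p) =
        (∏ i ∈ range (j + 1), ι (m + i * p)) * ι (m + (j + 1) * p) := prod_range_succ _ _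
      have h1 := h.inv m hd
      have h2 := h.inv (m + (j + 1) * p) (by
        rwa [Nat.dvd_add_left (Dvd.intro_left _ rfl)])
      push_cast at h2
      set Q := ∏ i ∈ range (j + 1 + 1), ι (m + i * p)
      set A := ∏ i ∈ range (j + 1), ι (p + m + i * p)
      set B := ∏ i ∈ range (j + 1), ι (m + i * p)
      have hA : A = Q * m := by rw [e1]; linear_combination (-A) * h1
      have hB : B = Q * (m + (j + 1) * p) := by rw [e2]; linear_combination (-B) * h2
      rw [hA, hB, Nat.factorial_succ, pow_succ]; push_cast; ring

lemma VV_zero {p : ℕ} (hp : 0 < p) : (1 - PowerSeries.X ^ p) * VV R p 0 = 1 := by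
  ext n
  rw [one_sub_mul_coeff]
  simp only [VV, PowerSeries.coeff_mk, PowerSeries.coeff_one]
  by_cases hn : p ≤ n
  · have : n ≠ 0 := by omega
    simp [hn, this, Nat.dvd_sub_iff_left hn]
  · by_cases h0 : n = 0
    · simp [h0]; omega
    · have : ¬ p ∣ n := fun h => hn (Nat.le_of_dvd (by omega) h)
      simp [hn, h0, this]

lemma VV_succ {p : ℕ} (hp : 0 < p) (K : ℕ) :
    (1 - PowerSeries.X ^ p) * VV R p (K + 1) = VV R p K := by
  ext n
  rw [one_sub_mul_coeff]
  simp only [VV, PowerSeries.coeff_mk]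
  by_cases hd : p ∣ n
  · obtain ⟨a, rfl⟩ := hd
    rcases a with _ | a
    · simp; intro h; omega
    · have h1 : p ≤ p * (a + 1) := Nat.le_mul_of_pos_right _ (by omega)
      have h2 : p * (a + 1) - p = p * a := by rw [mul_add, mul_one, Nat.add_sub_cancel]
      rw [if_pos (by simp), if_pos h1, h2, if_pos (by simp), if_pos (by simp),
        Nat.mul_div_cancel_left _ hp, Nat.mul_div_cancel_left _ hp]
      have : (a + 1 + (K + 1)).choose (K + 1) = (a + 1 + K).choose K + (a + (K + 1)).choose (K + 1) := by
        rw [show a + 1 + (K + 1) = (a + 1 + K) + 1 by ring, Nat.choose_succ_succ]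
        congr 2; ring
      rw [this]; push_cast; ring
  · by_cases hn : p ≤ n
    · have : ¬ p ∣ n - p := by
        rwa [Nat.dvd_sub_iff_left hn (dvd_refl p)]
      simp [hd, this]
    · simp [hd, hn]

lemma VV_eq {p : ℕ} (hp : 0 < p) (K : ℕ) : VV R p K = VV R p 0 ^ (K + 1) := by
  induction K with
  | zero => simp
  | succ K ih =>
    rw [pow_succ, ← ih, ← VV_succ hp K]
    linear_combination (-VV R p (K + 1)) * VV_zero (R := R) hp

lemma Phi_eq {ι : ℕ → R} {p : ℕ} (hp : 0 < p) (h : IsInv p ι) (k : ℕ) :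
    Phi ι p 0 = ∑ j ∈ range k, (p : PowerSeries R) ^ j * PowerSeries.X ^ (p * j) *
        VV R p 0 ^ (j + 1) * uu ι p j +
      (p : PowerSeries R) ^ k * PowerSeries.X ^ (p * k) * VV R p 0 ^ k * Phi ι p k := by
  induction k with
  | zero => simp
  | succ k ih =>
    rw [ih, sum_range_succ]
    have h1 := Phi_rec h k
    have h2 := VV_zero (R := R) hp
    have h3 : Phi ι p k = VV R p 0 * (uu ι p k +
        (p : PowerSeries R) * PowerSeries.X ^ p * Phi ι p (k + 1)) := by
      rw [← h1]; linear_combination (-Phi ι p k) * h2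
    conv_lhs => rw [h3]
    rw [mul_add p k 1, pow_add PowerSeries.X, pow_succ (p : PowerSeries R) k]
    ring

/-- coefficients of `X^{pJ} V^{J+8}` -/
lemma coeff_T {p : ℕ} (hp : 0 < p) (J n : ℕ) :
    PowerSeries.coeff n (PowerSeries.X ^ (p * J) * VV R p 0 ^ (J + 8)) =
      if p ∣ n then ((n / p + 7).choose (J + 7) : R) else 0 := by
  rw [show J + 8 = (J + 7) + 1 by ring, ← VV_eq hp, PowerSeries.coeff_X_pow_mul']
  simp only [VV, PowerSeries.coeff_mk]
  by_cases hd : p ∣ n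
  · obtain ⟨a, rfl⟩ := hd
    rw [if_pos (Dvd.intro _ rfl), Nat.mul_div_cancel_left _ hp]
    by_cases hJ : J ≤ a
    · rw [if_pos (Nat.mul_le_mul_left _ hJ), ← Nat.mul_sub, if_pos (Dvd.intro _ rfl),
        Nat.mul_div_cancel_left _ hp]
      congr 2; omega
    · rw [if_neg (by simpa [hp] using hJ), Nat.choose_eq_zero_of_lt (by omega)]; simp
  · by_cases hJ : p * J ≤ n
    · have : ¬ p ∣ n - p * J := by
        rwa [Nat.dvd_sub_iff_left hJ (Dvd.intro _ rfl)]
      simp [hd, this]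
    · simp [hd, hJ]

lemma coeff_TU {p : ℕ} (hp : 0 < p) (J A : ℕ) (U : PowerSeries R) :
    PowerSeries.coeff (p * A) (PowerSeries.X ^ (p * J) * VV R p 0 ^ (J + 8) * U) =
      ∑ c ∈ range (A + 1), PowerSeries.coeff (p * c) U * ((A - c + 7).choose (J + 7) : R) := by
  rw [mul_comm (PowerSeries.X ^ (p * J) * VV R p 0 ^ (J + 8)) U, PowerSeries.coeff_mul, Finset.Nat.sum_antidiagonal_eq_sum_range_succ_mk]
  simp only [coeff_T hp]
  symm
  apply sum_of_injOn (fun c => p * c)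
  · intro a _ b _ hab; exact Nat.eq_of_mul_eq_mul_left hp hab
  · intro c hc
    simp only [coe_range, Set.mem_Iio] at hc ⊢
    have := Nat.mul_le_mul_left p (show c ≤ A by omega)
    omega
  · intro i hi hi'
    rw [if_neg, mul_zero]
    intro hd
    apply hi'
    have hi2 : i ≤ p * A := by simp at hi; omega
    have : p ∣ i := by
      rw [Nat.dvd_sub_iff_right hi2 (Dvd.intro _ rfl)] at hd; exact hd
    obtain ⟨c, rfl⟩ := this
    exact ⟨c, by simp; exact Nat.le_of_mul_le_mul_left hi2 hp, rfl⟩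
  · intro c hc
    simp only [mem_range] at hc
    rw [← Nat.mul_sub, if_pos (Dvd.intro _ rfl), Nat.mul_div_cancel_left _ hp]

end ps

lemma key_dvd {p r A e J : ℕ} (hp : p.Prime) (hp9 : 9 < p) (hr : 1 ≤ r) (hA : p ^ (r - 1) ∣ A)
    (he : e ≤ 6) (hJ : 1 ≤ J) : p ^ r ∣ p ^ J * (A + e).choose (J + 7) := by
  rw [Nat.add_choose_eq, mul_sum]
  apply dvd_sum
  rintro ⟨a, b⟩ hab
  rw [Finset.HasAntidiagonal.mem_antidiagonal] at hab
  simp only at hab ⊢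
  by_cases hb : b ≤ e
  · have ha : 1 ≤ a := by omega
    have haJ : ¬ p ^ J ∣ a := by
      intro h
      have h1 := Nat.le_of_dvd (by omega) h
      have h2 : (9 + 1) ^ J ≤ p ^ J := Nat.pow_le_pow_left hp9 J
      have h3 : 1 + J * 9 ≤ (9 + 1) ^ J := by
        have := one_add_mul_le_pow (R := ℤ) (a := 9) (by norm_num) J
        zify
        rw [add_comm (9:ℤ) 1]; linarith
      omega
    have hA' : p ^ (r - 1) ∣ a * A.choose a := by
      rcases A with _ | A
      · rw [Nat.choose_eq_zero_of_lt (by omega)]; simp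
      · obtain ⟨a, rfl⟩ : ∃ k, a = k + 1 := ⟨a - 1, by omega⟩
        have := Nat.add_one_mul_choose_eq A a
        rw [mul_comm (a + 1), ← this]
        exact Dvd.dvd.mul_right hA _
    obtain ⟨v, m, hm, rfl⟩ : ∃ v m, ¬ p ∣ m ∧ a = p ^ v * m := by
      exact Nat.exists_eq_pow_mul_and_not_dvd (by omega) p hp.ne_one
    have hv : v < J := by
      by_contra hv
      exact haJ (Dvd.dvd.mul_right (pow_dvd_pow p (not_lt.mp hv)) m)
    have h4 : p ^ (r - 1) ∣ p ^ v * A.choose (p ^ v * m) := by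
      have : Nat.Coprime (p ^ (r - 1)) m := Nat.Coprime.pow_left _ ((Nat.Prime.coprime_iff_not_dvd hp).2 hm)
      refine this.dvd_of_dvd_mul_left ?_
      convert hA' using 1; ring
    have h5 : p ^ r ∣ p ^ J * A.choose (p ^ v * m) := by
      have : p ^ r = p ^ (r - 1) * p := by rw [← pow_succ]; congr 1; omega
      rw [this]
      have h6 : p ^ J = p ^ v * p * p ^ (J - v - 1) := by
        rw [← pow_succ, ← pow_add]; congr 1; omega
      rw [h6]
      obtain ⟨w, hw⟩ := h4
      exact ⟨w * p ^ (J - v - 1), by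
        calc _ = (p ^ v * A.choose (p ^ v * m)) * p * p ^ (J - v - 1) := by ring
          _ = _ := by rw [hw]; ring⟩
    rw [← mul_assoc]; exact Dvd.dvd.mul_right h5 _
  · rw [Nat.choose_eq_zero_of_lt (show e < b by omega)]; simp

section ps2
variable {R : Type*} [CommRing R]

lemma coeff_mul_bound {φ ψ : PowerSeries R} {a b : ℕ}
    (h1 : ∀ n, a < n → PowerSeries.coeff n φ = 0) (h2 : ∀ n, b < n → PowerSeries.coeff n ψ = 0)
    (n : ℕ) (hn : a + b < n) : PowerSeries.coeff n (φ * ψ) = 0 := by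
  rw [PowerSeries.coeff_mul]
  apply sum_eq_zero
  rintro ⟨i, k⟩ hik
  rw [Finset.HasAntidiagonal.mem_antidiagonal] at hik
  simp only at hik ⊢
  by_cases hi : a < i
  · rw [h1 i hi, zero_mul]
  · rw [h2 k (by omega), mul_zero]

lemma coeff_prod_bound {α : Type*} (s : Finset α) (φ : α → PowerSeries R) {a : ℕ}
    (h : ∀ i, ∀ n, a < n → PowerSeries.coeff n (φ i) = 0) :
    ∀ n, s.card * a < n → PowerSeries.coeff n (∏ i ∈ s, φ i) = 0 := by
  induction s using Finset.induction_on with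
  | empty =>
    intro n hn
    rw [prod_empty, PowerSeries.coeff_one, if_neg]
    simp at hn; omega
  | insert i s hi ih =>
    intro n hn
    rw [prod_insert hi]
    apply coeff_mul_bound (h i) ih
    rw [card_insert_of_notMem hi] at hn
    linarith [add_mul s.card 1 a]

lemma uu_coeff_zero {ι : ℕ → R} {p : ℕ} (hp : p.Prime) (h : IsInv p ι) (j : ℕ) :
    PowerSeries.coeff 0 (uu ι p j) = 0 := by
  simp only [uu, PowerSeries.coeff_mk]
  have : ∏ i ∈ range (j + 1), ι (0 + i * p) = 0 :=
    prod_eq_zero (i := 0) (by simp) (h.zero _ (by simp))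
  rw [if_pos hp.pos, this, mul_zero]

/-- The main expansion: reduces the sum at `p * A` to short sums. -/
lemma coeff_pow8 {ι : ℕ → R} {p r A : ℕ} (hp : p.Prime) (hp9 : 9 < p) (h : IsInv p ι)
    (hr : 1 ≤ r) (hpr : (p : R) ^ r = 0) (hA : p ^ (r - 1) ∣ A) :
    PowerSeries.coeff (p * A) (PowerSeries.mk ι ^ 8) =
      ∑ c ∈ range (A + 1), PowerSeries.coeff (p * c) (uu ι p 0 ^ 8) *
        ((A - c + 7).choose 7 : R) := by
  have hF : PowerSeries.mk ι = ∑ j ∈ range r, (p : PowerSeries R) ^ j * PowerSeries.X ^ (p * j) *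
        VV R p 0 ^ (j + 1) * uu ι p j := by
    have h1 := Phi_eq hp.pos h r
    have h2 : (p : PowerSeries R) ^ r = 0 := by
      rw [← map_natCast (PowerSeries.C (R := R)) p, ← map_pow, hpr, map_zero]
    rw [h2] at h1
    simp only [zero_mul, add_zero] at h1
    rw [← h1]
    ext n; simp [Phi]
  have hpow : PowerSeries.mk ι ^ 8 = ∏ _i : Fin 8, PowerSeries.mk ι := by simp
  rw [hpow, hF, Finset.prod_univ_sum, map_sum]
  rw [sum_eq_single (fun _ : Fin 8 => 0)]
  · have := coeff_TU (R := R) hp.pos 0 A (uu ι p 0 ^ 8)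
    rw [zero_add] at this
    rw [← this]
    congr 1
    simp; ring
  · intro j hj hj0
    have hprod : ∏ i : Fin 8, (p : PowerSeries R) ^ j i * PowerSeries.X ^ (p * j i) *
        VV R p 0 ^ (j i + 1) * uu ι p (j i) =
        PowerSeries.C ((p : R) ^ (∑ i, j i)) * (PowerSeries.X ^ (p * ∑ i, j i) * VV R p 0 ^ (∑ i, j i + 8)
          * ∏ i, uu ι p (j i)) := by
      rw [map_pow, map_natCast, prod_mul_distrib, prod_mul_distrib, prod_mul_distrib,
        prod_pow_eq_pow_sum, prod_pow_eq_pow_sum, prod_pow_eq_pow_sum, mul_sum, sum_add_distrib]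
      simp; ring
    rw [hprod, PowerSeries.coeff_C_mul, coeff_TU hp.pos, mul_sum]
    apply sum_eq_zero
    intro c hc
    simp only [mem_range] at hc
    by_cases hc0 : c = 0
    · subst hc0
      have : PowerSeries.coeff (p * 0) (∏ i, uu ι p (j i)) = 0 := by
        rw [mul_zero, PowerSeries.coeff_zero_eq_constantCoeff, map_prod]
        apply prod_eq_zero (i := 0) (by simp)
        rw [← PowerSeries.coeff_zero_eq_constantCoeff]
        exact uu_coeff_zero hp h _
      rw [this]; simp
    · by_cases hc8 : 8 ≤ c
      · have : PowerSeries.coeff (p * c) (∏ i, uu ι p (j i)) = 0 := by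
          apply coeff_prod_bound (a := p - 1)
          · intro i n hn
            simp only [uu, PowerSeries.coeff_mk]
            rw [if_neg (by omega)]
          · simp only [card_univ, Fintype.card_fin]
            have := Nat.mul_le_mul_left p hc8
            have := hp.pos
            omega
        rw [this]; simp
      · set J := ∑ i, j i with hJ
        have hJ1 : 1 ≤ J := by
          rw [Nat.one_le_iff_ne_zero]
          intro h0
          apply hj0
          funext i
          exact (sum_eq_zero_iff.mp h0) i (mem_univ i)
        have hd := key_dvd (e := 7 - c) hp hp9 hr hA (by omega) hJ1
        have he : A - c + 7 = A + (7 - c) := by omega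
        rw [he]
        obtain ⟨w, hw⟩ := hd
        have : (p : R) ^ J * ((A + (7 - c)).choose (J + 7) : R) = 0 := by
          have := congrArg (Nat.cast (R := R)) hw
          push_cast at this
          rw [this, hpr, zero_mul]
        calc _ = PowerSeries.coeff (p * c) (∏ i, uu ι p (j i)) *
              ((p : R) ^ J * ((A + (7 - c)).choose (J + 7) : R)) := by ring
          _ = 0 := by rw [this, mul_zero]
  · intro hj
    exfalso; apply hj
    simp; omega

lemma uu_pow_zero {ι : ℕ → R} {p : ℕ} (hp : p.Prime) (h : IsInv p ι) (c : ℕ)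
    (hc : c = 0 ∨ 8 ≤ c) : PowerSeries.coeff (p * c) (uu ι p 0 ^ 8) = 0 := by
  rcases hc with rfl | hc
  · rw [mul_zero, PowerSeries.coeff_zero_eq_constantCoeff, map_pow,
      ← PowerSeries.coeff_zero_eq_constantCoeff]
    rw [uu_coeff_zero hp h]
    simp
  · have hpow : uu ι p 0 ^ 8 = ∏ _i : Fin 8, uu ι p 0 := by simp
    rw [hpow]
    apply coeff_prod_bound (a := p - 1)
    · intro i n hn
      simp only [uu, PowerSeries.coeff_mk]
      rw [if_neg (by omega)]
    · simp only [card_univ, Fintype.card_fin]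
      have := Nat.mul_le_mul_left p hc
      have := hp.pos
      omega

end ps2

end S18
namespace S18
open Polynomial in
/-- the truncated logarithm as a polynomial -/
noncomputable def gP {R : Type*} [CommRing R] (ι : ℕ → R) (p : ℕ) : R[X] :=
  ∑ s ∈ range p, monomial s (ι s)

section cartier
open Polynomial

lemma gP_coeff {R : Type*} [CommRing R] (ι : ℕ → R) (p n : ℕ) :
    (gP ι p).coeff n = if n < p then ι n else 0 := by
  simp [gP, finsetSum_coeff, coeff_monomial]

lemma gP_coe {R : Type*} [CommRing R] (ι : ℕ → R) (p : ℕ) :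
    ((gP ι p : R[X]) : PowerSeries R) = uu ι p 0 := by
  ext n
  rw [Polynomial.coeff_coe, gP_coeff]
  simp [uu]

variable {p : ℕ} [hpf : Fact p.Prime] {ι : ℕ → ZMod p}

lemma gP_deriv (h : IsInv p ι) :
    X * (1 - X) * derivative (gP ι p) = X - X ^ p := by
  have hp := hpf.out
  have e : X * derivative (gP ι p) = ∑ s ∈ range p, (if s = 0 then 0 else X ^ s) := by
    rw [gP, derivative_sum, mul_sum]
    apply sum_congr rfl
    intro s hs
    rw [mem_range] at hs
    split_ifs with h0
    · simp [h0]
    · have hns : ¬ p ∣ s := fun hd => absurd (Nat.le_of_dvd (by omega) hd) (by omega)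
      have := h.inv s hns
      rw [derivative_monomial, mul_comm (ι s), this, ← C_mul_X_pow_eq_monomial, map_one, one_mul,
        ← pow_succ']
      congr 1; omega
  have e2 : ∑ s ∈ range p, (if s = 0 then (0 : (ZMod p)[X]) else X ^ s) =
      (∑ s ∈ range p, X ^ s) - 1 := by
    obtain ⟨q, rfl⟩ : ∃ q, p = q + 1 := ⟨p - 1, by have := hp.pos; omega⟩
    rw [sum_range_succ', sum_range_succ']
    simp
  have e3 := geom_sum_mul (X : (ZMod p)[X]) p
  calc _ = (1 - X) * (X * derivative (gP ι p)) := by ring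
    _ = (1 - X) * ((∑ s ∈ range p, X ^ s) - 1) := by rw [e, e2]
    _ = _ := by linear_combination -e3

lemma X1X_ne : (X * (1 - X) : (ZMod p)[X]) ≠ 0 := by
  apply mul_ne_zero X_ne_zero
  intro h
  have := congrArg (fun q => q.coeff 0) h
  simp at this

lemma deriv_zero_const {q : (ZMod p)[X]} (hd : derivative q = 0) (hq : ∀ n, p ≤ n → q.coeff n = 0) :
    q = C (q.coeff 0) := by
  ext n
  rw [coeff_C]
  split_ifs with h0
  · rw [h0]
  · by_cases hn : p ≤ n
    · exact hq n hn
    · have h1 := congrArg (fun q => q.coeff (n - 1)) hd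
      simp only [coeff_derivative, coeff_zero] at h1
      rw [show n - 1 + 1 = n by omega] at h1
      have h2 : ((n - 1 : ℕ) : ZMod p) + 1 = (n : ZMod p) := by
        have : n - 1 + 1 = n := by omega
        exact_mod_cast congrArg (Nat.cast (R := ZMod p)) this
      rw [h2] at h1
      rcases mul_eq_zero.mp h1 with h | h
      · exact h
      · rw [ZMod.natCast_eq_zero_iff] at h
        exact absurd (Nat.le_of_dvd (by omega) h) hn

lemma gP_natDegree : (gP ι p).natDegree ≤ p - 1 := by
  rw [natDegree_le_iff_coeff_eq_zero]
  intro n hn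
  rw [gP_coeff, if_neg (by omega)]

lemma sum_inv_zero (h : IsInv p ι) (hp2 : 2 < p) : ∑ s ∈ range p, ι s = 0 := by
  have hp := hpf.out
  obtain ⟨q, hq⟩ : ∃ q, p = q + 1 := ⟨p - 1, by have := hp.pos; omega⟩
  have h1 : ∑ s ∈ range p, ι s = ∑ s ∈ range q, ι (s + 1) := by
    have hr : range p = range (q + 1) := by rw [hq]
    rw [hr, sum_range_succ', h.zero 0 (by simp), add_zero]
  have h2 : ∑ s ∈ range q, ι (s + 1) = - ∑ s ∈ range q, ι (s + 1) := by
    conv_lhs => rw [← sum_range_reflect]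
    rw [← sum_neg_distrib]
    apply sum_congr rfl
    intro s hs
    rw [mem_range] at hs
    have e : q - 1 - s + 1 + (s + 1) = p := by omega
    have ha : ¬ p ∣ (s + 1) := fun hd => absurd (Nat.le_of_dvd (by omega) hd) (by omega)
    have hb : ¬ p ∣ (q - 1 - s + 1) := fun hd => absurd (Nat.le_of_dvd (by omega) hd) (by omega)
    have hia := h.inv _ ha
    have hib := h.inv _ hb
    have e' := congrArg (Nat.cast (R := ZMod p)) e
    rw [Nat.cast_add, ZMod.natCast_self] at e'
    set a := ((s + 1 : ℕ) : ZMod p)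
    set b := ((q - 1 - s + 1 : ℕ) : ZMod p)
    linear_combination ι (q - 1 - s + 1) * ι (s + 1) * e' - ι (q - 1 - s + 1) * hia
      - ι (s + 1) * hib
  have h3 : (2 : ZMod p) * ∑ s ∈ range q, ι (s + 1) = 0 := by linear_combination h2
  rcases mul_eq_zero.mp h3 with h4 | h4
  · exfalso
    have : ((2 : ℕ) : ZMod p) = 0 := by exact_mod_cast h4
    rw [ZMod.natCast_eq_zero_iff] at this
    exact absurd (Nat.le_of_dvd (by omega) this) (by omega)
  · rw [h1, h4]

lemma one_sub_X_pow : ((1 - X) ^ p : (ZMod p)[X]) = 1 - X ^ p := by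
  rw [sub_pow_char, one_pow]

lemma natDegree_one_sub_X : (1 - X : (ZMod p)[X]).natDegree ≤ 1 := by
  compute_degree

lemma gP_comp (h : IsInv p ι) (hp2 : 2 < p) : (gP ι p).comp (1 - X) = gP ι p := by
  set q := (gP ι p).comp (1 - X) - gP ι p with hq
  have hd : derivative q = 0 := by
    apply mul_left_cancel₀ (X1X_ne (p := p))
    have h1 := gP_deriv h
    have h2 := congrArg (fun q => q.comp (1 - X)) h1
    simp only [mul_comp, sub_comp, X_comp, one_comp, pow_comp] at h2
    rw [one_sub_X_pow] at h2
    rw [hq, derivative_sub, derivative_comp]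
    simp only [derivative_sub, derivative_one, derivative_X]
    linear_combination -h1 - h2
  have hb : ∀ n, p ≤ n → q.coeff n = 0 := by
    intro n hn
    have hpp := hpf.out.pos
    rw [hq, coeff_sub, coeff_eq_zero_of_natDegree_lt, coeff_eq_zero_of_natDegree_lt, sub_zero]
    · have := gP_natDegree (p := p) (ι := ι); omega
    · have h1 := natDegree_comp_le (p := gP ι p) (q := (1 - X : (ZMod p)[X]))
      have h2 := gP_natDegree (p := p) (ι := ι)
      have h3 := Nat.mul_le_mul h2 (natDegree_one_sub_X (p := p))
      omega
  have := deriv_zero_const hd hb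
  have h0 : q.coeff 0 = 0 := by
    rw [coeff_zero_eq_eval_zero, hq]
    simp only [eval_sub, eval_comp, eval_one, eval_X, sub_zero]
    have e1 : (gP ι p).eval 1 = 0 := by
      rw [gP, eval_finsetSum]; simpa using sum_inv_zero h hp2
    have e0 : (gP ι p).eval 0 = 0 := by
      rw [← coeff_zero_eq_eval_zero, gP_coeff, h.zero 0 (by simp)]; simp
    rw [e1, e0, sub_zero]
  rw [h0, map_zero] at this
  exact sub_eq_zero.mp this

/-- `L q = y · Λ(q)`, `Λ` the Cartier operator. -/
noncomputable def LL (p : ℕ) (q : (ZMod p)[X]) : (ZMod p)[X] := contract p (X * q)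

lemma LL_add (a b : (ZMod p)[X]) : LL p (a + b) = LL p a + LL p b := by
  rw [LL, mul_add, contract_add hpf.out.ne_zero]; rfl

lemma LL_sub (a b : (ZMod p)[X]) : LL p (a - b) = LL p a - LL p b := by
  have := LL_add (a - b) b
  rw [sub_add_cancel] at this
  rw [this]; ring

lemma LL_expand (a b : (ZMod p)[X]) : LL p (a * expand (ZMod p) p b) = LL p a * b := by
  rw [LL, ← mul_assoc, contract_mul_expand hpf.out.ne_zero]; rfl

lemma LL_deriv (a : (ZMod p)[X]) : LL p (derivative a) = 0 := by
  ext n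
  rw [LL, coeff_contract hpf.out.ne_zero, coeff_zero]
  rcases Nat.eq_zero_or_pos (n * p) with h | h
  · rw [h]; simp
  · obtain ⟨m, hm⟩ : ∃ m, n * p = m + 1 := ⟨n * p - 1, by omega⟩
    rw [hm, coeff_X_mul, coeff_derivative]
    have : ((m : ZMod p) + 1) = 0 := by
      have := congrArg (Nat.cast (R := ZMod p)) hm
      push_cast at this
      rw [← this]; simp
    rw [this, mul_zero]

lemma LL_small (q : (ZMod p)[X]) (hq : q.natDegree ≤ p - 1) : LL p q = C (q.coeff (p - 1)) * X := by
  have hpp := hpf.out.pos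
  ext n
  rw [LL, coeff_contract hpf.out.ne_zero, coeff_C_mul_X]
  rcases n with _ | _ | n
  · simp
  · simp only [zero_add, one_mul, if_true]
    obtain ⟨m, hm⟩ : ∃ m, p = m + 1 := ⟨p - 1, by omega⟩
    have h1 : (X * q).coeff (m + 1) = q.coeff m := coeff_X_mul _ _
    rw [show p - 1 = m by omega, ← h1, ← hm]
  · rw [if_neg (by omega), coeff_eq_zero_of_natDegree_lt]
    have h1 := natDegree_mul_le (p := (X : (ZMod p)[X])) (q := q)
    have h2 := natDegree_X_le (R := ZMod p)
    have : 2 * p ≤ (n + 1 + 1) * p := Nat.mul_le_mul_right _ (by omega)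
    omega

lemma expand_comp (a : (ZMod p)[X]) :
    (expand (ZMod p) p a).comp (1 - X) = expand (ZMod p) p (a.comp (1 - X)) := by
  rw [expand_eq_comp_X_pow, expand_eq_comp_X_pow, comp_assoc, comp_assoc]
  simp [one_sub_X_pow]

lemma LL_comp (q : (ZMod p)[X]) (hp2 : 2 < p) :
    (1 - X) * LL p (q.comp (1 - X)) = X * (LL p q).comp (1 - X) := by
  have hpp := hpf.out.pos
  induction q using Polynomial.induction_on' with
  | add a b ha hb =>
    rw [add_comp, LL_add, LL_add, add_comp, mul_add, mul_add, ha, hb]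
  | monomial n a =>
    have e : monomial n a = X ^ (n % p) * expand (ZMod p) p (C a * X ^ (n / p)) := by
      rw [map_mul, map_pow, expand_C, expand_X, ← pow_mul, mul_left_comm, ← pow_add,
        Nat.mod_add_div, C_mul_X_pow_eq_monomial]
    have hlt := Nat.mod_lt n hpp
    rw [e, mul_comp (X ^ (n % p)), expand_comp, LL_expand, LL_expand, mul_comp (LL p _), ← mul_assoc,
      ← mul_assoc]
    congr 1
    rw [X_pow_comp, LL_small, LL_small]
    · rw [mul_comp, C_comp, X_comp, coeff_X_pow]
      by_cases hm : p - 1 = n % p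
      · rw [if_pos hm, ← hm]
        have : ((1 - X : (ZMod p)[X]) ^ (p - 1)).coeff (p - 1) = 1 := by
          have h1 : (1 - X : (ZMod p)[X]) = C (-1) * (X + C (-1)) := by
            simp; ring
          have hev : Even (p - 1) := by
            have := hpf.out.eq_two_or_odd'
            rcases this with h | h
            · omega
            · obtain ⟨k, hk⟩ := h; exact ⟨k, by omega⟩
          rw [h1, mul_pow, ← map_pow, hev.neg_one_pow, map_one, one_mul]
          have hmon : ((X + C (-1) : (ZMod p)[X]) ^ (p - 1)).Monic := (monic_X_add_C _).pow _
          have hdeg : ((X + C (-1) : (ZMod p)[X]) ^ (p - 1)).natDegree = p - 1 := by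
            rw [natDegree_pow, natDegree_X_add_C, mul_one]
          have := hmon.coeff_natDegree
          rwa [hdeg] at this
        rw [this]; simp; ring
      · rw [if_neg hm, coeff_eq_zero_of_natDegree_lt]
        · simp
        · have h1 := natDegree_pow_le (p := (1 - X : (ZMod p)[X])) (n := n % p)
          have h2 := Nat.mul_le_mul_left (n % p) (natDegree_one_sub_X (p := p))
          omega
    · rw [natDegree_X_pow]; omega
    · have h1 := natDegree_pow_le (p := (1 - X : (ZMod p)[X])) (n := n % p)
      have h2 := Nat.mul_le_mul_left (n % p) (natDegree_one_sub_X (p := p))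
      omega

/-- the symmetry `H(1-y) = H(y)` -/
lemma HH_symm (h : IsInv p ι) (hp9 : 9 < p) :
    (contract p (gP ι p ^ 8)).comp (1 - X) = contract p (gP ι p ^ 8) := by
  have hp2 : 2 < p := by omega
  have h0 : (gP ι p).coeff 0 = 0 := by rw [gP_coeff, h.zero 0 (by simp)]; simp
  obtain ⟨g1, hg1⟩ := X_dvd_iff.mpr h0
  set G := g1 * gP ι p ^ 7 with hG
  have hXG : X * G = gP ι p ^ 8 := by rw [hG, pow_succ' _ 7, hg1]; ring
  have hXG' : (1 - X) * G.comp (1 - X) = gP ι p ^ 8 := by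
    have := congrArg (fun q => q.comp (1 - X)) hXG
    simpa [gP_comp h hp2] using this
  have hder : C (9 : ZMod p) * (G.comp (1 - X) * expand (ZMod p) p (1 - X)
      - G * expand (ZMod p) p X) = derivative (gP ι p ^ 9) := by
    apply mul_left_cancel₀ (X1X_ne (p := p))
    have h1 := gP_deriv h
    rw [derivative_pow]
    simp only [map_sub, map_one, expand_X, Nat.cast_ofNat]
    rw [show 9 - 1 = 8 from rfl]
    linear_combination (C 9 * X * (1 - X ^ p)) * hXG' - C 9 * (1 - X) * X ^ p * hXG
      - C 9 * gP ι p ^ 8 * h1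
  have h9 : (9 : ZMod p) ≠ 0 := by
    intro h
    have : ((9 : ℕ) : ZMod p) = 0 := by exact_mod_cast h
    rw [ZMod.natCast_eq_zero_iff] at this
    exact absurd (Nat.le_of_dvd (by omega) this) (by omega)
  have hL := LL_deriv (p := p) (gP ι p ^ 9)
  rw [← hder] at hL
  have hC : (C (9 : ZMod p) : (ZMod p)[X]) = expand (ZMod p) p (C 9) := by rw [expand_C]
  rw [mul_comm, hC, LL_expand] at hL
  have hL2 := (mul_eq_zero.mp hL).resolve_right (by simpa using h9)
  rw [LL_sub, LL_expand, LL_expand] at hL2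
  have h3 := LL_comp G hp2
  have h4 : LL p G = contract p (gP ι p ^ 8) := by rw [LL, hXG]
  rw [← h4]
  apply mul_left_cancel₀ (X_ne_zero (R := ZMod p))
  rw [← h3]
  linear_combination hL2

lemma gP_reflect (h : IsInv p ι) : reflect p (gP ι p) = - gP ι p := by
  ext n
  rw [coeff_reflect, coeff_neg, gP_coeff, gP_coeff]
  by_cases hn : n ≤ p
  · rw [revAt_le hn]
    by_cases h0 : n = 0
    · simp [h0, h.zero 0 (by simp)]
    · by_cases hn2 : n = p
      · subst hn2; simp [h.zero 0 (by simp)]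
      · rw [if_pos (by omega), if_pos (by omega)]
        have ha : ¬ p ∣ n := fun hd => absurd (Nat.le_of_dvd (by omega) hd) (by omega)
        have hb : ¬ p ∣ (p - n) := fun hd => absurd (Nat.le_of_dvd (by omega) hd) (by omega)
        have hia := h.inv _ ha
        have hib := h.inv _ hb
        rw [Nat.cast_sub hn, ZMod.natCast_self] at hib
        linear_combination - ι (p - n) * hia - ι n * hib
  · rw [revAt_eq_self_of_lt (by omega), if_neg (by omega)]; simp

lemma gP_pow_reflect (h : IsInv p ι) (k : ℕ) :
    reflect (p * k) (gP ι p ^ k) = (- gP ι p) ^ k := by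
  have hd := gP_natDegree (p := p) (ι := ι)
  induction k with
  | zero => simp
  | succ k ih =>
    rw [pow_succ, mul_add, mul_one, reflect_mul _ _ _ (by omega), ih, gP_reflect h, pow_succ]
    have := natDegree_pow_le_of_le k hd
    have h2 := Nat.mul_le_mul_left k (show p - 1 ≤ p by omega)
    rw [mul_comm p k]; omega

lemma hc_pal (h : IsInv p ι) (c : ℕ) (hc : c ≤ 8) :
    (gP ι p ^ 8).coeff (p * c) = (gP ι p ^ 8).coeff (p * (8 - c)) := by
  have := gP_pow_reflect h 8
  have h2 := congrArg (fun q => q.coeff (p * c)) this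
  simp only [coeff_reflect] at h2
  rw [revAt_le (Nat.mul_le_mul_left _ hc), ← Nat.mul_sub] at h2
  have e8 : (-gP ι p) ^ 8 = gP ι p ^ 8 := Even.neg_pow (by decide) _
  rw [e8] at h2
  exact h2.symm

lemma hh_rel (h : IsInv p ι) (hp9 : 9 < p) (h1 : (gP ι p ^ 8).coeff (p * 1) = 0) :
    (gP ι p ^ 8).coeff (p * 3) = - 3 * (gP ι p ^ 8).coeff (p * 2) ∧
    (gP ι p ^ 8).coeff (p * 4) = 4 * (gP ι p ^ 8).coeff (p * 2) := by
  have hH := HH_symm h hp9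
  set H := contract p (gP ι p ^ 8) with hHdef
  have hp := hpf.out
  have hco : ∀ c, H.coeff c = (gP ι p ^ 8).coeff (p * c) := fun c => by
    rw [hHdef, coeff_contract hp.ne_zero, mul_comm]
  have hz : ∀ c, c = 0 ∨ 8 ≤ c → H.coeff c = 0 := by
    intro c hc
    rw [hco, ← Polynomial.coeff_coe, Polynomial.coe_pow, gP_coe]
    exact uu_pow_zero hp h c hc
  have hdeg : H.natDegree < 8 := by
    have : H.natDegree ≤ 7 := by
      rw [natDegree_le_iff_coeff_eq_zero]
      intro n hn; exact hz n (Or.inr (by omega))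
    omega
  have hev : ∀ x, H.eval x = ∑ i ∈ range 8, H.coeff i * x ^ i := fun x =>
    eval_eq_sum_range' hdeg x
  have e1 : H.eval 0 = H.eval 1 := by
    have := congrArg (eval 1) hH
    simpa using this
  have e2 : H.eval (-1) = H.eval 2 := by
    have := congrArg (eval 2) hH
    simp only [eval_comp, eval_sub, eval_one, eval_X] at this
    rw [← this]; congr 1; ring
  rw [hev, hev] at e1 e2
  simp only [sum_range_succ, range_zero, sum_empty] at e1 e2
  have p1 := hc_pal h 1 (by norm_num)
  have p2 := hc_pal h 2 (by norm_num)
  have p3 := hc_pal h 3 (by norm_num)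
  norm_num only at p1 p2 p3
  rw [hz 0 (Or.inl rfl)] at e1 e2
  simp only [hco] at e1 e2
  rw [mul_one] at p1 h1
  rw [← p1, ← p2, ← p3] at e1 e2
  simp only [mul_one] at e1 e2
  rw [h1] at e1 e2
  have h12 : (12 : ZMod p) ≠ 0 := by
    intro h
    have : ((12 : ℕ) : ZMod p) = 0 := by exact_mod_cast h
    rw [ZMod.natCast_eq_zero_iff, show 12 = 2 * 2 * 3 by norm_num, hp.dvd_mul, hp.dvd_mul] at this
    rcases this with (h | h) | h <;> exact absurd (Nat.le_of_dvd (by omega) h) (by omega)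
  have k3 : (gP ι p ^ 8).coeff (p * 3) = - 3 * (gP ι p ^ 8).coeff (p * 2) := by
    apply mul_left_cancel₀ h12
    linear_combination 15 * e1 - e2
  refine ⟨k3, ?_⟩
  linear_combination - e1 - 2 * k3

end cartier
end S18
namespace S18
open PowerSeries

lemma coeff_prod_mk {R : Type*} [CommRing R] {n : ℕ} (F : Fin n → ℕ → R) (N : ℕ) :
    coeff N (∏ i, PowerSeries.mk (F i)) =
      ∑ l ∈ Finset.Nat.antidiagonalTuple n N, ∏ i, F i (l i) := by
  rw [PowerSeries.coeff_prod]
  refine Finset.sum_bij' (fun l _ => (l : Fin n → ℕ)) (fun l _ => Finsupp.equivFunOnFinite.symm l)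
    ?_ ?_ ?_ ?_ ?_
  · intro l hl
    rw [Finset.mem_finsuppAntidiag] at hl
    rw [Finset.Nat.mem_antidiagonalTuple]; exact hl.1
  · intro l hl
    rw [Finset.Nat.mem_antidiagonalTuple] at hl
    rw [Finset.mem_finsuppAntidiag]
    refine ⟨by simpa using hl, by simp⟩
  · intro l hl; ext; simp
  · intro l hl; ext; simp
  · intro l hl; simp

/-- rational inverse function -/
noncomputable def iQ (p : ℕ) (l : ℕ) : ℚ := if p ∣ l then 0 else (l : ℚ)⁻¹

lemma iQ_inv (p : ℕ) : IsInv p (iQ p) := by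
  refine ⟨fun l hl => by simp [iQ, hl], fun l hl => ?_⟩
  have : (l : ℚ) ≠ 0 := by
    rintro h; have : l = 0 := by exact_mod_cast h
    simp [this] at hl
  simp [iQ, hl, this]

noncomputable def fQ (p : ℕ) : PowerSeries ℚ := PowerSeries.mk (iQ p)

lemma sigma_eq (p b N : ℕ) :
    sigmaSum p 8 b N = coeff N (∏ i : Fin 8, if (i : ℕ) < b then rescale (-1) (fQ p) else fQ p) := by
  have e : ∀ i : Fin 8, (if (i : ℕ) < b then rescale (-1) (fQ p) else fQ p) =
      PowerSeries.mk (fun l => (if (i : ℕ) < b then (-1) ^ l else 1) * iQ p l) := by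
    intro i
    ext n
    split_ifs <;> simp [fQ, coeff_rescale]
  rw [Finset.prod_congr rfl (fun i _ => e i), coeff_prod_mk, sigmaSum, Finset.sum_filter]
  refine Finset.sum_congr rfl fun l _ => ?_
  split_ifs with hl
  · rw [Finset.prod_mul_distrib, ← Finset.prod_pow_eq_pow_sum, Finset.prod_filter]
    congr 1
    exact Finset.prod_congr rfl fun i _ => by simp [iQ, (hl i).2]
  · push Not at hl
    obtain ⟨i, hi⟩ := hl
    symm
    apply Finset.prod_eq_zero (Finset.mem_univ i)
    have : p ∣ l i := by
      by_cases h0 : 0 < l i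
      · exact hi h0
      · have : l i = 0 := by omega
        simp [this]
    simp [iQ, this]

lemma f_add {p : ℕ} (hp : p.Prime) (h2 : 2 < p) :
    fQ p + rescale (-1) (fQ p) = expand 2 two_ne_zero (fQ p) := by
  ext n
  rw [map_add, coeff_rescale, coeff_expand]
  simp only [fQ, coeff_mk]
  have hc : Nat.Coprime p 2 := (Nat.coprime_primes hp Nat.prime_two).2 (by omega)
  split_ifs with h
  · obtain ⟨m, rfl⟩ := h
    rw [Nat.mul_div_cancel_left _ (by norm_num)]
    rw [pow_mul]; simp only [even_two, Even.neg_pow, one_pow, one_mul]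
    have : p ∣ 2 * m ↔ p ∣ m := by
      constructor
      · exact hc.dvd_of_dvd_mul_left
      · intro h; exact Dvd.dvd.mul_left h 2
    simp only [iQ, this]
    split_ifs
    · simp
    · push_cast; rw [mul_inv]; ring
  · have : Odd n := Nat.not_even_iff_odd.1 (fun h' => h h'.two_dvd)
    rw [this.neg_one_pow]; ring

lemma step1 {p : ℕ} (hp : p.Prime) (h2 : 2 < p) (q : ℕ) :
    2 * ((8 * sigmaSum p 8 1 (2 * q) + 28 * sigmaSum p 8 2 (2 * q) +
        56 * sigmaSum p 8 3 (2 * q) + 35 * sigmaSum p 8 4 (2 * q)) + coeff (2 * q) (fQ p ^ 8))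
      = coeff q (fQ p ^ 8) := by
  set g := rescale (-1) (fQ p) with hg
  have hgg : rescale (-1) g = fQ p := by
    rw [hg, rescale_rescale]; simp
  have sym : ∀ a b, coeff (2 * q) (g ^ a * fQ p ^ b) = coeff (2 * q) (fQ p ^ a * g ^ b) := by
    intro a b
    have : rescale (-1) (g ^ a * fQ p ^ b) = fQ p ^ a * g ^ b := by
      rw [map_mul, map_pow, map_pow, hgg]
    rw [← this, coeff_rescale, pow_mul]; simp
  have s1 : sigmaSum p 8 1 (2 * q) = coeff (2 * q) (g ^ 1 * fQ p ^ 7) := by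
    rw [sigma_eq]; congr 1; simp [Fin.prod_univ_eight]; ring
  have s2 : sigmaSum p 8 2 (2 * q) = coeff (2 * q) (g ^ 2 * fQ p ^ 6) := by
    rw [sigma_eq]; congr 1; simp [Fin.prod_univ_eight]; ring
  have s3 : sigmaSum p 8 3 (2 * q) = coeff (2 * q) (g ^ 3 * fQ p ^ 5) := by
    rw [sigma_eq]; congr 1; simp [Fin.prod_univ_eight]; ring
  have s4 : sigmaSum p 8 4 (2 * q) = coeff (2 * q) (g ^ 4 * fQ p ^ 4) := by
    rw [sigma_eq]; congr 1; simp [Fin.prod_univ_eight]; ring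
  have key : coeff (2 * q) ((fQ p + g) ^ 8) = coeff q (fQ p ^ 8) := by
    rw [f_add hp h2, ← map_pow, coeff_expand_mul]
  rw [← key]
  have ex : (fQ p + g) ^ 8 = fQ p ^ 8 * g ^ 0 + g ^ 8 * fQ p ^ 0 + (8 : ℚ) • (g ^ 1 * fQ p ^ 7 + fQ p ^ 1 * g ^ 7)
     + (28 : ℚ) • (g ^ 2 * fQ p ^ 6 + fQ p ^ 2 * g ^ 6) + (56 : ℚ) • (g ^ 3 * fQ p ^ 5 + fQ p ^ 3 * g ^ 5)
     + (70 : ℚ) • (g ^ 4 * fQ p ^ 4) := by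
    simp only [smul_eq_C_mul, map_ofNat]; ring
  rw [ex]
  simp only [map_add, map_smul, ← sym, smul_eq_mul]
  rw [s1, s2, s3, s4]
  simp only [sym 8 0]
  simp only [pow_zero, mul_one]
  ring

end S18
namespace S18

lemma binom_red {R : Type*} [CommRing R] (A : ℕ) (hA : 7 ≤ A) (h2 : (A : R) ^ 2 = 0)
    (H : ℕ → R) (hH : ∀ c, c = 0 ∨ 8 ≤ c → H c = 0) :
    5040 * ∑ c ∈ range (A + 1), H c * ((A - c + 7).choose 7 : R) =
      A * (720 * H 1 - 120 * H 2 + 48 * H 3 - 36 * H 4 + 48 * H 5 - 120 * H 6 + 720 * H 7) := by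
  have ch : ∀ n k : ℕ, n = k + 6 → 5040 * (n.choose 7 : R) =
      (k : R) * (k + 1) * (k + 2) * (k + 3) * (k + 4) * (k + 5) * (k + 6) := by
    rintro n k rfl
    have e := Nat.descFactorial_eq_factorial_mul_choose (k + 6) 7
    have e2 : (k + 6).descFactorial 7 =
        k * (k + 1) * (k + 2) * (k + 3) * (k + 4) * (k + 5) * (k + 6) := by
      simp [Nat.descFactorial]; ring
    rw [e2] at e
    have e3 := congrArg (Nat.cast (R := R)) e
    push_cast [Nat.factorial] at e3
    rw [e3]
  have c1 : 5040 * ((A - 1 + 7).choose 7 : R) = A * (720) := by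
    have := ch (A - 1 + 7) (A - 1 + 1) rfl
    rw [this, show ((A - 1 + 1 : ℕ) : R) = A - 0 by
      rw [Nat.cast_add, Nat.cast_sub (by omega)]; push_cast; ring]
    linear_combination ((1764) * (A : R) ^ 0 + (1624) * (A : R) ^ 1 + (735) * (A : R) ^ 2 + (175) * (A : R) ^ 3 + (21) * (A : R) ^ 4 + (1) * (A : R) ^ 5) * h2
  have c2 : 5040 * ((A - 2 + 7).choose 7 : R) = A * (-120) := by
    have := ch (A - 2 + 7) (A - 2 + 1) rfl
    rw [this, show ((A - 2 + 1 : ℕ) : R) = A - 1 by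
      rw [Nat.cast_add, Nat.cast_sub (by omega)]; push_cast; ring]
    linear_combination ((-154) * (A : R) ^ 0 + (49) * (A : R) ^ 1 + (140) * (A : R) ^ 2 + (70) * (A : R) ^ 3 + (14) * (A : R) ^ 4 + (1) * (A : R) ^ 5) * h2
  have c3 : 5040 * ((A - 3 + 7).choose 7 : R) = A * (48) := by
    have := ch (A - 3 + 7) (A - 3 + 1) rfl
    rw [this, show ((A - 3 + 1 : ℕ) : R) = A - 2 by
      rw [Nat.cast_add, Nat.cast_sub (by omega)]; push_cast; ring]
    linear_combination ((28) * (A : R) ^ 0 + (-56) * (A : R) ^ 1 + (-35) * (A : R) ^ 2 + (7) * (A : R) ^ 3 + (7) * (A : R) ^ 4 + (1) * (A : R) ^ 5) * h2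
  have c4 : 5040 * ((A - 4 + 7).choose 7 : R) = A * (-36) := by
    have := ch (A - 4 + 7) (A - 4 + 1) rfl
    rw [this, show ((A - 4 + 1 : ℕ) : R) = A - 3 by
      rw [Nat.cast_add, Nat.cast_sub (by omega)]; push_cast; ring]
    linear_combination ((0) * (A : R) ^ 0 + (49) * (A : R) ^ 1 + (0) * (A : R) ^ 2 + (-14) * (A : R) ^ 3 + (0) * (A : R) ^ 4 + (1) * (A : R) ^ 5) * h2
  have c5 : 5040 * ((A - 5 + 7).choose 7 : R) = A * (48) := by
    have := ch (A - 5 + 7) (A - 5 + 1) rfl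
    rw [this, show ((A - 5 + 1 : ℕ) : R) = A - 4 by
      rw [Nat.cast_add, Nat.cast_sub (by omega)]; push_cast; ring]
    linear_combination ((-28) * (A : R) ^ 0 + (-56) * (A : R) ^ 1 + (35) * (A : R) ^ 2 + (7) * (A : R) ^ 3 + (-7) * (A : R) ^ 4 + (1) * (A : R) ^ 5) * h2
  have c6 : 5040 * ((A - 6 + 7).choose 7 : R) = A * (-120) := by
    have := ch (A - 6 + 7) (A - 6 + 1) rfl
    rw [this, show ((A - 6 + 1 : ℕ) : R) = A - 5 by
      rw [Nat.cast_add, Nat.cast_sub (by omega)]; push_cast; ring]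
    linear_combination ((154) * (A : R) ^ 0 + (49) * (A : R) ^ 1 + (-140) * (A : R) ^ 2 + (70) * (A : R) ^ 3 + (-14) * (A : R) ^ 4 + (1) * (A : R) ^ 5) * h2
  have c7 : 5040 * ((A - 7 + 7).choose 7 : R) = A * (720) := by
    have := ch (A - 7 + 7) (A - 7 + 1) rfl
    rw [this, show ((A - 7 + 1 : ℕ) : R) = A - 6 by
      rw [Nat.cast_add, Nat.cast_sub (by omega)]; push_cast; ring]
    linear_combination ((-1764) * (A : R) ^ 0 + (1624) * (A : R) ^ 1 + (-735) * (A : R) ^ 2 + (175) * (A : R) ^ 3 + (-21) * (A : R) ^ 4 + (1) * (A : R) ^ 5) * h2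
  have hs : ∑ c ∈ range (A + 1), H c * ((A - c + 7).choose 7 : R) =
      ∑ c ∈ range 8, H c * ((A - c + 7).choose 7 : R) := by
    symm
    apply Finset.sum_subset
    · intro c hc; simp only [Finset.mem_range] at hc ⊢; omega
    · intro c _ hc
      rw [hH c (Or.inr (by simpa using hc)), zero_mul]
  rw [hs]
  simp only [Finset.sum_range_succ, Finset.sum_range_zero]
  rw [hH 0 (Or.inl rfl)]
  linear_combination H 1 * c1 + H 2 * c2 + H 3 * c3 + H 4 * c4 + H 5 * c5 + H 6 * c6 + H 7 * c7

lemma uu_map {R S : Type*} [CommRing R] [CommRing S] (φ : R →+* S) (ι : ℕ → R) (p n : ℕ) :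
    PowerSeries.coeff n (uu (fun l => φ (ι l)) p 0 ^ 8) = φ (PowerSeries.coeff n (uu ι p 0 ^ 8)) := by
  have e : uu (fun l => φ (ι l)) p 0 = PowerSeries.map φ (uu ι p 0) := by
   ext k
   simp only [uu, PowerSeries.coeff_mk, PowerSeries.coeff_map]
   split_ifs <;> simp
  rw [← PowerSeries.coeff_map, map_pow (PowerSeries.map φ), e]

lemma mk_map {R S : Type*} [CommRing R] [CommRing S] (φ : R →+* S) (ι : ℕ → R) (n : ℕ) :
    PowerSeries.coeff n (PowerSeries.mk (fun l => φ (ι l)) ^ 8) =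
      φ (PowerSeries.coeff n (PowerSeries.mk ι ^ 8)) := by
  have e : PowerSeries.mk (fun l => φ (ι l)) = PowerSeries.map φ (PowerSeries.mk ι) := by
    ext k
    simp
  rw [← PowerSeries.coeff_map, map_pow (PowerSeries.map φ), e]

section padic
variable {p : ℕ} [hpf : Fact p.Prime] {ι : ℕ → ℤ_[p]}

lemma dvd_of_toZModPow {r : ℕ} {x : ℤ_[p]} (h : PadicInt.toZModPow r x = 0) :
    (p : ℤ_[p]) ^ r ∣ x := by
  rw [← Ideal.mem_span_singleton, ← PadicInt.ker_toZModPow]; exact h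

lemma dvd_iff_toZMod {x : ℤ_[p]} : (p : ℤ_[p]) ∣ x ↔ PadicInt.toZMod x = 0 := by
  rw [← Ideal.mem_span_singleton, ← PadicInt.maximalIdeal_eq_span_p, ← PadicInt.ker_toZMod]; rfl

/-- the coefficients `h_c` -/
noncomputable def hcf (p : ℕ) {R : Type*} [CommRing R] (ι : ℕ → R) (c : ℕ) : R :=
  PowerSeries.coeff (p * c) (uu ι p 0 ^ 8)

lemma hcf_rel (h : IsInv p ι) (hp9 : 9 < p) (h1 : (p : ℤ_[p]) ∣ hcf p ι 1) :
    ∃ s : ℤ_[p], 720 * hcf p ι 1 - 120 * hcf p ι 2 + 48 * hcf p ι 3 - 36 * hcf p ι 4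
      + 48 * hcf p ι 5 - 120 * hcf p ι 6 + 720 * hcf p ι 7 = -672 * hcf p ι 2 + p * s := by
  set φ : ℤ_[p] →+* ZMod p := PadicInt.toZMod
  have h' := h.map φ
  have hc : ∀ c, φ (hcf p ι c) = (gP (fun l => φ (ι l)) p ^ 8).coeff (p * c) := by
    intro c
    rw [← Polynomial.coeff_coe, Polynomial.coe_pow, gP_coe, uu_map]; rfl
  have h1' := dvd_iff_toZMod.1 h1
  have r := hh_rel h' hp9 (by rw [← hc]; exact h1')
  have p1 := hc_pal h' 1 (by norm_num)
  have p2 := hc_pal h' 2 (by norm_num)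
  have p3 := hc_pal h' 3 (by norm_num)
  simp only [← hc] at r p1 p2 p3
  norm_num only at p1 p2 p3
  obtain ⟨r3, r4⟩ := r
  have : (p : ℤ_[p]) ∣ 720 * hcf p ι 1 - 120 * hcf p ι 2 + 48 * hcf p ι 3 - 36 * hcf p ι 4
      + 48 * hcf p ι 5 - 120 * hcf p ι 6 + 720 * hcf p ι 7 - (-672 * hcf p ι 2) := by
    rw [dvd_iff_toZMod]
    change φ _ = 0
    simp only [map_add, map_sub, map_mul, map_neg, map_ofNat]
    linear_combination 1440 * h1' - 720 * p1 + 120 * p2 - 48 * p3 + 96 * r3 - 36 * r4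
  obtain ⟨s, hs⟩ := this
  exact ⟨s, by linear_combination hs⟩

lemma step2 (h : IsInv p ι) (hp9 : 9 < p) (h1 : (p : ℤ_[p]) ∣ hcf p ι 1) (r : ℕ) (hr : 2 ≤ r)
    (m : ℕ) (hm : 1 ≤ m) :
    ∃ y : ℤ_[p], 5040 * PowerSeries.coeff (m * p ^ r) (PowerSeries.mk ι ^ 8) =
      m * p ^ (r - 1) * (-672 * hcf p ι 2) + p ^ r * y := by
  have hp := hpf.out
  obtain ⟨s, hs⟩ := hcf_rel h hp9 h1
  set φ : ℤ_[p] →+* ZMod (p ^ r) := PadicInt.toZModPow r with hφ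
  have hpr : ((p : ℕ) : ZMod (p ^ r)) ^ r = 0 := by
    have := ZMod.natCast_self (p ^ r)
    push_cast at this; exact this
  obtain ⟨k, rfl⟩ : ∃ k, r = k + 2 := ⟨r - 2, by omega⟩
  have hk : k + 2 - 1 = k + 1 := by omega
  rw [hk]
  have hA : 7 ≤ m * p ^ (k + 1) := by
    have : p ^ 1 ≤ p ^ (k + 1) := Nat.pow_le_pow_right hp.pos (by omega)
    nlinarith
  have e := coeff_pow8 (A := m * p ^ (k + 1)) (r := k + 2) hp hp9 (h.map φ) (by omega) hpr
    (by rw [hk]; exact Dvd.intro_left _ rfl)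
  rw [mk_map] at e
  simp only [uu_map] at e
  have b := binom_red (R := ZMod (p ^ (k + 2))) (m * p ^ (k + 1)) hA (by
      push_cast
      have : ((m : ZMod (p ^ (k + 2))) * (p : ZMod (p ^ (k + 2))) ^ (k + 1)) ^ 2 =
        (p : ZMod (p ^ (k + 2))) ^ (k + 2) * (p ^ k * m ^ 2) := by ring
      rw [this, hpr, zero_mul])
    (fun c => φ (hcf p ι c)) (fun c hc => by
      change φ _ = 0
      rw [hcf, uu_pow_zero hp h c hc, map_zero])
  have e' : φ (PowerSeries.coeff (p * (m * p ^ (k + 1))) (PowerSeries.mk ι ^ 8)) =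
    ∑ c ∈ range (m * p ^ (k + 1) + 1), φ (hcf p ι c) *
      ((m * p ^ (k + 1) - c + 7).choose 7 : ZMod (p ^ (k + 2))) := e
  rw [← e'] at b
  have : (p : ℤ_[p]) ^ (k + 2) ∣ 5040 * PowerSeries.coeff (p * (m * p ^ (k + 1))) (PowerSeries.mk ι ^ 8)
     - m * p ^ (k + 1) * (-672 * hcf p ι 2 + p * s) := by
    apply dvd_of_toZModPow
    rw [← hs]
    change φ _ = 0
    simp only [map_add, map_sub, map_mul, map_ofNat, map_pow, map_natCast]
    rw [b]; push_cast; ring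
  obtain ⟨y, hy⟩ := this
  refine ⟨m * s + y, ?_⟩
  rw [show m * p ^ (k + 2) = p * (m * p ^ (k + 1)) by ring]
  linear_combination hy

lemma h12 (h : IsInv p ι) (hp9 : 9 < p) :
    (p : ℤ_[p]) ∣ PowerSeries.coeff p (PowerSeries.mk ι ^ 8) - hcf p ι 1 ∧
    (p : ℤ_[p]) ∣ PowerSeries.coeff (2 * p) (PowerSeries.mk ι ^ 8) - (8 * hcf p ι 1 + hcf p ι 2) := by
  have hp := hpf.out
  set φ : ℤ_[p] →+* ZMod p := PadicInt.toZMod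
  have z : φ (hcf p ι 0) = 0 := by rw [hcf, uu_pow_zero hp h 0 (Or.inl rfl), map_zero]
  have e1 := coeff_pow8 (A := 1) (r := 1) hp hp9 (h.map φ) (by omega) (by simp) (by simp)
  have e2 := coeff_pow8 (A := 2) (r := 1) hp hp9 (h.map φ) (by omega) (by simp) (by simp)
  rw [mk_map] at e1 e2
  have fold : ∀ c, PowerSeries.coeff (p * c) (uu ι p 0 ^ 8) = hcf p ι c := fun c => rfl
  simp only [uu_map, fold, sum_range_succ, sum_range_zero, z] at e1 e2
  simp at e1 e2
  constructor
  · rw [dvd_iff_toZMod]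
    change φ _ = 0
    rw [map_sub, e1, sub_self]
  · rw [dvd_iff_toZMod]
    change φ _ = 0
    rw [mul_comm 2 p]
    simp only [map_add, map_sub, map_mul, map_ofNat]
    rw [e2]; ring
end padic
end S18
namespace S18
section logseries
open PowerSeries

noncomputable def ell : PowerSeries ℚ := PowerSeries.mk fun l => (l : ℚ)⁻¹

lemma ell_deriv : (1 - X) * derivative ℚ ell = 1 := by
  ext n
  rw [sub_mul, one_mul, map_sub]
  rcases n with _ | n
  · simp [coeff_derivative, ell]
  · rw [coeff_succ_X_mul, coeff_derivative, coeff_derivative]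
    simp only [ell, coeff_mk, coeff_one]
    push_cast
    have h1 : (n : ℚ) + 1 ≠ 0 := by positivity
    have h2 : (n : ℚ) + 1 + 1 ≠ 0 := by positivity
    field_simp
    simp

lemma ell_rec (n N : ℕ) :
    ((N : ℚ) + 1) * coeff (N + 1) (ell ^ (n + 1)) - N * coeff N (ell ^ (n + 1)) =
      (n + 1) * coeff N (ell ^ n) := by
  have h : (1 - X) * derivative ℚ (ell ^ (n + 1)) = C ((n : ℚ) + 1) * ell ^ n := by
    rw [Derivation.leibniz_pow]
    simp only [Nat.add_sub_cancel, smul_eq_mul, nsmul_eq_mul]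
    have := ell_deriv
    push_cast
    rw [map_add, map_natCast, map_one]
    linear_combination ((n : PowerSeries ℚ) + 1) * ell ^ n * this
  have h2 := congrArg (coeff N) h
  rw [coeff_C_mul] at h2
  rw [← h2, sub_mul, one_mul, map_sub, coeff_derivative]
  rcases N with _ | N
  · simp
  · rw [coeff_succ_X_mul, coeff_derivative]; push_cast; ring

noncomputable def wP {R : Type*} [CommRing R] (ι : ℕ → R) (a b : ℕ) : Polynomial R :=
  ∏ j ∈ Finset.Ico a b, (1 + Polynomial.C (ι j) * Polynomial.X)

lemma ell_const : coeff 0 ell = 0 := by simp [ell]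

lemma ell_coeff (N : ℕ) (hN : 1 ≤ N) : ∀ n : ℕ, (N : ℚ) * coeff N (ell ^ (n + 1)) =
    (n + 1).factorial * (wP (fun l => (l : ℚ)⁻¹) 1 N).coeff n := by
  induction N, hN using Nat.le_induction with
  | base =>
    intro n
    have := ell_rec n 0
    simp only [wP, Finset.Ico_self, Finset.prod_empty, Polynomial.coeff_one]
    rcases n with _ | n
    · simp at this; simp [this]
    · have h0 : constantCoeff ell = 0 := by
        rw [← coeff_zero_eq_constantCoeff_apply]; exact ell_const
      simp [h0] at this
      simp [this]
  | succ N hN ih =>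
    intro n
    have hr := ell_rec n N
    have hw : wP (fun l => (l : ℚ)⁻¹) 1 (N + 1) = wP (fun l => (l : ℚ)⁻¹) 1 N +
        Polynomial.C ((N : ℚ)⁻¹) * (wP (fun l => (l : ℚ)⁻¹) 1 N * Polynomial.X) := by
      rw [wP, Finset.prod_Ico_succ_top hN, ← wP]; ring
    have hN0 : (N : ℚ) ≠ 0 := by positivity
    rw [hw, Polynomial.coeff_add, Polynomial.coeff_C_mul]
    push_cast
    rcases n with _ | n
    · have i0 := ih 0
      have : coeff N (1 : PowerSeries ℚ) = 0 := by rw [coeff_one, if_neg (by omega)]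
      simp [this] at hr
      simp at i0 ⊢
      linarith
    · rw [Polynomial.coeff_mul_X]
      have i1 := ih (n + 1)
      have i2 := ih n
      have i2' : coeff N (ell ^ (n + 1)) = (N : ℚ)⁻¹ * ((n + 1).factorial * (wP (fun l => (l : ℚ)⁻¹) 1 N).coeff n) := by
        rw [← i2]; field_simp
      rw [i2'] at hr
      rw [Nat.factorial_succ (n + 1)] at i1 ⊢
      push_cast at *
      linear_combination hr + i1

lemma fQ_eq {p : ℕ} (hp : p.Prime) : fQ p = ell - C ((p : ℚ)⁻¹) * expand p hp.ne_zero ell := by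
  ext n
  rw [map_sub, coeff_C_mul, coeff_expand]
  simp only [fQ, ell, coeff_mk, iQ]
  split_ifs with h
  · obtain ⟨m, rfl⟩ := h
    rw [Nat.mul_div_cancel_left _ hp.pos]; push_cast; rw [mul_inv]; ring
  · simp

lemma E_eq {p : ℕ} (hp : p.Prime) : ∃ v, expand p hp.ne_zero ell = X ^ p * (1 + X ^ p * v) := by
  have h1 : ∃ v, ell = X * (1 + X * v) := by
    refine ⟨PowerSeries.mk fun l => ((l + 2 : ℕ) : ℚ)⁻¹, ?_⟩
    ext n
    rcases n with _ | _ | n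
    · simp [ell]
    · rw [coeff_succ_X_mul]; simp [ell]
    · rw [coeff_succ_X_mul, map_add, coeff_succ_X_mul]; simp [ell, coeff_one]; ring
  obtain ⟨v, hv⟩ := h1
  refine ⟨expand p hp.ne_zero v, ?_⟩
  conv_lhs => rw [hv]
  simp

lemma Zp_eq {p : ℕ} (hp : p.Prime) :
    coeff p (fQ p ^ 8) = coeff p (ell ^ 8) ∧
    coeff (2 * p) (fQ p ^ 8) = coeff (2 * p) (ell ^ 8) - 8 * (p : ℚ)⁻¹ * coeff p (ell ^ 7) := by
  obtain ⟨v, hv⟩ := E_eq hp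
  have h0 : constantCoeff ell = 0 := by
    rw [← coeff_zero_eq_constantCoeff_apply]; exact ell_const
  have hp0 := hp.ne_zero
  obtain ⟨S, hS, hS0⟩ : ∃ S : PowerSeries ℚ, fQ p ^ 8 = ell ^ 8 + X ^ p * (C (- (8 * (p : ℚ)⁻¹)) * ell ^ 7)
      + X ^ (2 * p) * S ∧ constantCoeff S = 0 := by
    have hC : (C (-(8 * (p : ℚ)⁻¹)) : PowerSeries ℚ) = - (8 * C ((p : ℚ)⁻¹)) := by
      rw [map_neg, map_mul, map_ofNat]
    rw [fQ_eq hp, hv, hC]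
    generalize C ((p : ℚ)⁻¹) = a
    have hY : constantCoeff ((X : PowerSeries ℚ) ^ p) = 0 := by simp [hp0]
    rw [mul_comm 2 p, pow_mul]
    generalize (X : PowerSeries ℚ) ^ p = Y at *
    refine ⟨- (8 * a * v * ell ^ 7) + (1 + Y * v) ^ 2 * (28 * a ^ 2 * ell ^ 6 - 56 * a ^ 3 * ell ^ 5 * (Y * (1 + Y * v))
      + 70 * a ^ 4 * ell ^ 4 * (Y * (1 + Y * v)) ^ 2 - 56 * a ^ 5 * ell ^ 3 * (Y * (1 + Y * v)) ^ 3
      + 28 * a ^ 6 * ell ^ 2 * (Y * (1 + Y * v)) ^ 4 - 8 * a ^ 7 * ell * (Y * (1 + Y * v)) ^ 5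
      + a ^ 8 * (Y * (1 + Y * v)) ^ 6), ?_, ?_⟩
    · generalize hE : 1 + Y * v = F
      have hv' : Y * v = F - 1 := by rw [← hE]; ring
      have : Y ^ 2 * v = Y * (F - 1) := by rw [← hv']; ring
      linear_combination 8 * a * ell ^ 7 * this
    · simp [h0, hY]
  rw [hS]
  simp only [map_add, coeff_X_pow_mul', coeff_C_mul]
  have hl : p < 2 * p := by have := hp.pos; omega
  rw [if_pos le_rfl, if_neg (by omega), if_pos hl.le, if_pos le_rfl]
  rw [show 2 * p - p = p by omega, Nat.sub_self, Nat.sub_self, coeff_zero_eq_constantCoeff_apply,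
    coeff_zero_eq_constantCoeff_apply, hS0, map_pow constantCoeff, h0]
  constructor <;> ring

lemma Zp_final {p : ℕ} (hp : p.Prime) :
    (p : ℚ) * coeff p (fQ p ^ 8) = 40320 * (wP (iQ p) 1 p).coeff 7 ∧
    2 * (p : ℚ) ^ 2 * coeff (2 * p) (fQ p ^ 8) = 40320 *
      (p * (wP (iQ p) 1 p * wP (iQ p) (p + 1) (2 * p)).coeff 7 +
        (wP (iQ p) 1 p * wP (iQ p) (p + 1) (2 * p)).coeff 6 - 2 * (wP (iQ p) 1 p).coeff 6) := by
  obtain ⟨z1, z2⟩ := Zp_eq hp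
  have hp1 := hp.one_lt
  have hpp : (p : ℚ) ≠ 0 := by exact_mod_cast hp.ne_zero
  have w1 : wP (fun l => (l : ℚ)⁻¹) 1 p = wP (iQ p) 1 p := by
    apply Finset.prod_congr rfl
    intro j hj
    rw [Finset.mem_Ico] at hj
    have : ¬ p ∣ j := fun h => absurd (Nat.le_of_dvd (by omega) h) (by omega)
    simp [iQ, this]
  have w2 : wP (fun l => (l : ℚ)⁻¹) (p + 1) (2 * p) = wP (iQ p) (p + 1) (2 * p) := by
    apply Finset.prod_congr rfl
    intro j hj
    rw [Finset.mem_Ico] at hj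
    have : ¬ p ∣ j := fun h => by
      obtain ⟨k, rfl⟩ := h
      have h1 : 1 < k := by by_contra hk; have : k ≤ 1 := by omega
                            nlinarith
      nlinarith
    simp [iQ, this]
  have w3 : wP (fun l => (l : ℚ)⁻¹) 1 (2 * p) = wP (iQ p) 1 p * wP (iQ p) (p + 1) (2 * p) +
      Polynomial.C ((p : ℚ)⁻¹) * ((wP (iQ p) 1 p * wP (iQ p) (p + 1) (2 * p)) * Polynomial.X) := by
    rw [← w1, ← w2]
    have : wP (fun l => (l : ℚ)⁻¹) 1 (2 * p) = wP (fun l => (l : ℚ)⁻¹) 1 p *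
      ((1 + Polynomial.C ((p : ℚ)⁻¹) * Polynomial.X) * wP (fun l => (l : ℚ)⁻¹) (p + 1) (2 * p)) := by
      unfold wP
      rw [← Finset.prod_Ico_consecutive _ hp1.le (show p ≤ 2 * p by omega),
        Finset.prod_eq_prod_Ico_succ_bot (show p < 2 * p by omega)]
    rw [this]; ring
  have a1 := ell_coeff p hp1.le 7
  have a2 := ell_coeff (2 * p) (by omega) 7
  have a3 := ell_coeff p hp1.le 6
  rw [w3, Polynomial.coeff_add, Polynomial.coeff_C_mul, Polynomial.coeff_mul_X] at a2
  rw [w1] at a1 a3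
  rw [z1, z2]
  norm_num [Nat.factorial] at a1 a2 a3
  refine ⟨a1, ?_⟩
  have i : (p : ℚ) * (p : ℚ)⁻¹ = 1 := mul_inv_cancel₀ hpp
  generalize (p : ℚ)⁻¹ = y at *
  generalize Polynomial.coeff (wP (iQ p) 1 p * wP (iQ p) (p + 1) (2 * p)) 6 = e6 at *
  linear_combination p * a2 + (40320 * e6 - 16 * p * coeff p (ell ^ 7)) * i - 16 * a3

end logseries
end S18
namespace S18
section bern
variable {p : ℕ} [hpf : Fact p.Prime] {ι : ℕ → ℤ_[p]}

lemma bern_int (h : IsInv p ι) (i : ℕ) : i < p - 1 →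
    ∃ b : ℤ_[p], (b : ℚ_[p]) = ((bernoulli i : ℚ) : ℚ_[p]) := by
  induction i using Nat.strong_induction_on with
  | _ i ih =>
  intro hi
  have hs := sum_bernoulli (i + 1)
  rw [Finset.sum_range_succ] at hs
  have hmem : ∀ k ∈ range i, ((bernoulli k : ℚ) : ℚ_[p]) ∈ PadicInt.subring p := by
    intro k hk
    rw [Finset.mem_range] at hk
    obtain ⟨b, hb⟩ := ih k hk (by omega)
    rw [← hb]; exact b.2
  have hs' := congrArg (fun x : ℚ => (x : ℚ_[p])) hs
  push_cast at hs'
  have hnd : ¬ p ∣ (i + 1) := fun hd => absurd (Nat.le_of_dvd (by omega) hd) (by omega)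
  have hinv := congrArg (fun x : ℤ_[p] => (x : ℚ_[p])) (h.inv _ hnd)
  push_cast at hinv
  have e : ((bernoulli i : ℚ) : ℚ_[p]) = (ι (i + 1) : ℚ_[p]) *
      (((if i + 1 = 1 then (1 : ℚ) else 0 : ℚ) : ℚ_[p]) -
        ∑ k ∈ range i, ((i + 1).choose k : ℚ_[p]) * ((bernoulli k : ℚ) : ℚ_[p])) := by
    have hc : (i + 1).choose i = i + 1 := by
      rw [Nat.choose_succ_self_right]
    rw [hc] at hs'
    push_cast at hs' ⊢
    rw [← hs']
    linear_combination - ((bernoulli i : ℚ) : ℚ_[p]) * hinv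
  have : ((bernoulli i : ℚ) : ℚ_[p]) ∈ PadicInt.subring p := by
    rw [e]
    refine mul_mem (ι (i+1)).2 (sub_mem ?_ (sum_mem fun k hk => mul_mem ?_ (hmem k hk)))
    · split_ifs <;> simp [one_mem, zero_mem]
    · exact natCast_mem _ _
  exact ⟨⟨_, this⟩, rfl⟩

lemma P_cong (h : IsInv p ι) (β : ℕ → ℤ_[p])
    (hβ : ∀ i < p - 1, (β i : ℚ_[p]) = ((bernoulli i : ℚ) : ℚ_[p])) (m : ℕ) (hm : m < p - 1) :
    ∃ z : ℤ_[p], ∑ j ∈ range p, (j : ℤ_[p]) ^ m = p * β m + p ^ 2 * z := by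
  have hf := sum_range_pow p m
  have e : ((m : ℤ_[p]) + 1) * ∑ j ∈ range p, (j : ℤ_[p]) ^ m =
      ∑ i ∈ range (m + 1), β i * ((m + 1).choose i : ℤ_[p]) * (p : ℤ_[p]) ^ (m + 1 - i) := by
    have h1 : ((m : ℚ) + 1) * ∑ k ∈ range p, (k : ℚ) ^ m =
        ∑ i ∈ range (m + 1), bernoulli i * ((m + 1).choose i) * (p : ℚ) ^ (m + 1 - i) := by
      rw [hf, Finset.mul_sum]
      refine Finset.sum_congr rfl fun i _ => ?_
      have : (m : ℚ) + 1 ≠ 0 := by positivity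
      field_simp
    have h2 := congrArg (fun x : ℚ => (x : ℚ_[p])) h1
    push_cast at h2
    apply PadicInt.ext
    push_cast [PadicInt.coe_sum]
    rw [h2]
    refine Finset.sum_congr rfl fun i hi => ?_
    rw [Finset.mem_range] at hi
    rw [hβ i (by omega)]
  rw [Finset.sum_range_succ] at e
  have hd : (p : ℤ_[p]) ^ 2 ∣ ∑ i ∈ range m, β i * ((m + 1).choose i : ℤ_[p]) * (p : ℤ_[p]) ^ (m + 1 - i) := by
    apply Finset.dvd_sum
    intro i hi
    rw [Finset.mem_range] at hi
    exact Dvd.dvd.mul_left (pow_dvd_pow _ (by omega)) _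
  obtain ⟨y, hy⟩ := hd
  rw [hy, Nat.choose_succ_self_right, show m + 1 - m = 1 by omega] at e
  have hnd : ¬ p ∣ (m + 1) := fun hd => absurd (Nat.le_of_dvd (by omega) hd) (by omega)
  have hinv := h.inv _ hnd
  push_cast at e hinv
  refine ⟨ι (m + 1) * y, ?_⟩
  linear_combination ι (m + 1) * e - (∑ j ∈ range p, (j : ℤ_[p]) ^ m - p * β m) * hinv

lemma newton {R : Type*} [CommRing R] (n : ℕ) (x : Fin n → R) (k : ℕ) :
    (k : R) * (univ.val.map x).esymm k = (-1) ^ (k + 1) *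
      ∑ a ∈ antidiagonal k with a.1 < k, (-1) ^ a.1 * (univ.val.map x).esymm a.1 * ∑ i, x i ^ a.2 := by
  have := congrArg (MvPolynomial.aeval x) (MvPolynomial.mul_esymm_eq_sum (Fin n) R k)
  simp only [map_mul, map_natCast, map_pow, map_neg, map_one, map_sum,
    MvPolynomial.aeval_esymm_eq_multiset_esymm] at this
  rw [this]
  congr 1
  refine Finset.sum_congr ?_ fun a _ => ?_
  · ext; simp
  · simp [MvPolynomial.psum]

/-- elementary symmetric functions of `1, …, p-1` -/
noncomputable def cE (p : ℕ) [Fact p.Prime] (k : ℕ) : ℤ_[p] :=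
  (univ.val.map (fun i : Fin (p - 1) => ((i : ℕ) : ℤ_[p]) + 1)).esymm k

lemma psum_eq (m : ℕ) (hm : 1 ≤ m) :
    ∑ i : Fin (p - 1), (((i : ℕ) : ℤ_[p]) + 1) ^ m = ∑ j ∈ range p, (j : ℤ_[p]) ^ m := by
  have hp := hpf.out.pos
  rw [Fin.sum_univ_eq_sum_range (fun i => ((i : ℤ_[p]) + 1) ^ m)]
  obtain ⟨q, hq⟩ : ∃ q, p = q + 1 := ⟨p - 1, by omega⟩
  have : range p = range (q + 1) := by rw [hq]
  rw [this, Finset.sum_range_succ', show p - 1 = q by omega]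
  have hm0 : m ≠ 0 := by omega
  simp [hm0]

lemma cE_newton (h : IsInv p ι) (β : ℕ → ℤ_[p])
    (hβ : ∀ i < p - 1, (β i : ℚ_[p]) = ((bernoulli i : ℚ) : ℚ_[p])) (k : ℕ) (hk : 1 ≤ k)
    (hkp : k < p - 1) : (p : ℤ_[p]) ∣ cE p k ∧
      ∃ z : ℤ_[p], (k : ℤ_[p]) * cE p k = (-1) ^ (k + 1) * (p * β k) + p ^ 2 * z := by
  induction k using Nat.strong_induction_on with
  | _ k ih =>
  have hN := newton (p - 1) (fun i : Fin (p - 1) => ((i : ℕ) : ℤ_[p]) + 1) k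
  change (k : ℤ_[p]) * cE p k = (-1) ^ (k + 1) * ∑ a ∈ antidiagonal k with a.1 < k,
     (-1) ^ a.1 * cE p a.1 * _ at hN
  have hP : ∀ m, 1 ≤ m → m < p - 1 → ∃ z : ℤ_[p],
      ∑ i : Fin (p - 1), (((i : ℕ) : ℤ_[p]) + 1) ^ m = p * β m + p ^ 2 * z := by
    intro m hm hm2
    obtain ⟨z, hz⟩ := P_cong h β hβ m hm2
    exact ⟨z, by rw [psum_eq m hm, hz]⟩
  have h0 : cE p 0 = 1 := by simp only [cE, Multiset.esymm, Multiset.powersetCard_zero_left]; simp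
  have hmem : ((0, k) : ℕ × ℕ) ∈ (antidiagonal k).filter (fun a => a.1 < k) := by
    rw [Finset.mem_filter, Finset.HasAntidiagonal.mem_antidiagonal]; simp; omega
  rw [← Finset.add_sum_erase _ _ hmem] at hN
  have hd : (p : ℤ_[p]) ^ 2 ∣ ∑ a ∈ ((antidiagonal k).filter (fun a => a.1 < k)).erase (0, k),
      (-1) ^ a.1 * cE p a.1 * ∑ i : Fin (p - 1), (((i : ℕ) : ℤ_[p]) + 1) ^ a.2 := by
    apply Finset.dvd_sum
    rintro ⟨a, b⟩ hab
    rw [Finset.mem_erase, Finset.mem_filter, Finset.HasAntidiagonal.mem_antidiagonal] at hab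
    obtain ⟨hne, hsum, hlt⟩ := hab
    simp only at hsum hlt ⊢
    have ha : 1 ≤ a := by
      by_contra ha
      have : a = 0 := by omega
      subst this
      exact hne (by simp at hsum; rw [hsum])
    obtain ⟨z, hz⟩ := hP b (by omega) (by omega)
    obtain ⟨y, hy⟩ := (ih a hlt ha (by omega)).1
    rw [hz, hy]
    exact ⟨(-1) ^ a * y * (β b + p * z), by ring⟩
  obtain ⟨y, hy⟩ := hd
  obtain ⟨z, hz⟩ := hP k hk hkp
  rw [hy] at hN
  simp only [pow_zero, one_mul, h0] at hN
  rw [hz] at hN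
  have main : (k : ℤ_[p]) * cE p k = (-1) ^ (k + 1) * (p * β k) + p ^ 2 * ((-1) ^ (k + 1) * (z + y)) := by
    rw [hN]; ring
  refine ⟨?_, _, main⟩
  have hnd : ¬ p ∣ k := fun hd => absurd (Nat.le_of_dvd (by omega) hd) (by omega)
  have hinv := h.inv _ hnd
  refine ⟨ι k * ((-1) ^ (k + 1) * β k + p * ((-1) ^ (k + 1) * (z + y))), ?_⟩
  linear_combination ι k * main - cE p k * hinv

lemma wP_cE (h : IsInv p ι) (n : ℕ) (hn : n ≤ p - 1) :
    ((p - 1).factorial : ℤ_[p]) * (wP ι 1 p).coeff n = cE p (p - 1 - n) := by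
  have hp := hpf.out
  have h1 := Multiset.prod_X_add_C_coeff' (univ.val : Multiset (Fin (p - 1)))
    (fun i : Fin (p - 1) => ((i : ℕ) : ℤ_[p]) + 1) (k := n) (by simpa using hn)
  have hcard : Multiset.card (univ.val : Multiset (Fin (p - 1))) = p - 1 := by simp
  rw [hcard] at h1
  rw [cE, ← h1, ← Polynomial.coeff_C_mul]
  congr 1
  change _ = ∏ i : Fin (p - 1), (Polynomial.X + Polynomial.C (((i : ℕ) : ℤ_[p]) + 1))
  rw [Fin.prod_univ_eq_prod_range (fun i : ℕ => (Polynomial.X + Polynomial.C ((i : ℤ_[p]) + 1))),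
    wP, Finset.prod_Ico_eq_prod_range, ← Finset.prod_range_add_one_eq_factorial, Nat.cast_prod,
    map_prod, ← Finset.prod_mul_distrib]
  refine Finset.prod_congr rfl fun i hi => ?_
  rw [Finset.mem_range] at hi
  have hnd : ¬ p ∣ (1 + i) := fun hd => absurd (Nat.le_of_dvd (by omega) hd) (by omega)
  have hinv := congrArg (Polynomial.C) (h.inv _ hnd)
  rw [map_mul, map_one] at hinv
  have e1 : (Polynomial.C ((1 + i : ℕ) : ℤ_[p])) = Polynomial.C ((i + 1 : ℕ) : ℤ_[p]) := by
    rw [add_comm]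
  rw [e1] at hinv
  push_cast at hinv ⊢
  linear_combination Polynomial.X * hinv

lemma wP_facts (h : IsInv p ι) (β : ℕ → ℤ_[p])
    (hβ : ∀ i < p - 1, (β i : ℚ_[p]) = ((bernoulli i : ℚ) : ℚ_[p])) (n : ℕ) (hn : 1 ≤ n)
    (hnp : n < p - 1) (hp2 : 2 < p) : (p : ℤ_[p]) ∣ (wP ι 1 p).coeff n ∧
      (Even n → ∃ z : ℤ_[p], ((n : ℤ_[p]) + 1) * (wP ι 1 p).coeff n = - (p * β (p - 1 - n)) + p ^ 2 * z) := by
  have hp := hpf.out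
  obtain ⟨⟨y, hy⟩, z, hz⟩ := cE_newton h β hβ (p - 1 - n) (by omega) (by omega)
  have hw := wP_cE h n (by omega)
  obtain ⟨t, ht⟩ : (p : ℤ_[p]) ∣ ((p - 1).factorial : ℤ_[p]) + 1 := by
    rw [dvd_iff_toZMod, map_add, map_natCast, ZMod.wilsons_lemma]; simp
  have hpe : (wP ι 1 p).coeff n = p * (t * (wP ι 1 p).coeff n - y) := by
    linear_combination (wP ι 1 p).coeff n * ht - hw - hy
  refine ⟨⟨_, hpe⟩, fun hev => ?_⟩
  set e := (wP ι 1 p).coeff n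
  set e' := (t * e - y)
  have hodd : Odd (p - 1 - n + 1) := by
    have : Odd p := hp.odd_of_ne_two (by omega)
    have h2 : p - 1 - n + 1 + n = p := by omega
    by_contra hcon
    rw [Nat.not_odd_iff_even] at hcon
    have := hcon.add hev
    rw [h2] at this
    exact (Nat.not_even_iff_odd.2 ‹Odd p›) this
  rw [hodd.neg_one_pow] at hz
  have hk : ((p - 1 - n : ℕ) : ℤ_[p]) = p - 1 - n := by
    rw [Nat.cast_sub (by omega), Nat.cast_sub (by omega)]; simp
  rw [hk, ← hw] at hz
  have hD : ((p - 1).factorial : ℤ_[p]) = p * t - 1 := by linear_combination ht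
  rw [hD] at hz
  refine ⟨z - (- e' - (n + 1) * t * e' + p * t * e'), ?_⟩
  linear_combination hz - (p * (t * (p - 1 - n) - 1)) * hpe

end bern
end S18
namespace S18
section polyfacts
open Polynomial

lemma taylor_trunc {R : Type*} [CommRing R] (f : R[X]) (r : R) (k : ℕ) :
    ∃ z : R, (taylor r f).coeff k = f.coeff k + (k + 1 : ℕ) * r * f.coeff (k + 1) +
      ((k + 2).choose 2 : ℕ) * r ^ 2 * f.coeff (k + 2) + r ^ 3 * z := by
  have hg : ∀ g : R[X], g.eval r = g.coeff 0 + r * (divX g).eval r := by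
    intro g
    conv_lhs => rw [← divX_mul_X_add g]
    simp; ring
  rw [taylor_coeff, hg, hg, hg]
  refine ⟨eval r (divX (divX (divX (hasseDeriv k f)))), ?_⟩
  simp only [coeff_divX, hasseDeriv_coeff]
  have c1 : (0 + 1 + k).choose k = k + 1 := by
    rw [show 0 + 1 + k = k + 1 by ring, Nat.choose_succ_self_right]
  have c2 : (0 + 1 + 1 + k).choose k = (k + 2).choose 2 := by
    rw [show 0 + 1 + 1 + k = k + 2 by ring]
    rw [Nat.choose_symm_add]
  rw [c1, c2]
  simp only [zero_add, Nat.choose_self]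
  rw [show 1 + k = k + 1 by ring, show 1 + 1 + k = k + 2 by ring]
  push_cast
  ring

variable {p : ℕ} [hpf : Fact p.Prime] {ι : ℕ → ℤ_[p]}

lemma wP_shift (h : IsInv p ι) :
    C ((taylor (p : ℤ_[p]) (wP ι 1 p)).coeff 0) * wP ι (p + 1) (2 * p) = taylor (p : ℤ_[p]) (wP ι 1 p) := by
  have hp := hpf.out.one_lt
  rw [taylor_coeff_zero, taylor_apply]
  have e2 : wP ι (p + 1) (2 * p) = ∏ j ∈ Ico 1 p, (1 + C (ι (p + j)) * X) := by
    rw [wP, Finset.prod_Ico_eq_prod_range, Finset.prod_Ico_eq_prod_range]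
    rw [show 2 * p - (p + 1) = p - 1 by omega]
    refine Finset.prod_congr rfl fun i _ => by rw [add_assoc]
  rw [e2, wP, eval_prod, map_prod, Polynomial.prod_comp, ← Finset.prod_mul_distrib]
  refine Finset.prod_congr rfl fun j hj => ?_
  rw [Finset.mem_Ico] at hj
  have h1 : ¬ p ∣ j := fun hd => absurd (Nat.le_of_dvd (by omega) hd) (by omega)
  have h2 : ¬ p ∣ (p + j) := fun hd => h1 ((Nat.dvd_add_right (dvd_refl p)).1 hd)
  have i1 := congrArg C (h.inv _ h1)
  have i2 := congrArg C (h.inv _ h2)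
  simp only [map_mul, map_one, Nat.cast_add, map_add] at i1 i2
  simp only [eval_add, eval_one, eval_mul, eval_C, eval_X, map_add, map_mul, map_one,
    add_comp, one_comp, mul_comp, C_comp, X_comp]
  linear_combination X * C (ι j) * i2 - X * C (ι (p + j)) * i1

lemma wP_refl (h : IsInv p ι) (hp2 : 2 < p) :
    (taylor (-(p : ℤ_[p])) (wP ι 1 p)).comp (-X) = wP ι 1 p := by
  have hp := hpf.out
  have hodd : Odd p := hp.odd_of_ne_two (by omega)
  have hnd : ∀ j ∈ Ico 1 p, ¬ p ∣ j := fun j hj hd => by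
    rw [Finset.mem_Ico] at hj
    exact absurd (Nat.le_of_dvd (by omega) hd) (by omega)
  have hrefl : ∀ (M : Type) [CommMonoid M] (F : ℕ → M), ∏ j ∈ Ico 1 p, F (p - j) = ∏ j ∈ Ico 1 p, F j := by
    intro M _ F
    refine Finset.prod_bij' (fun j _ => p - j) (fun j _ => p - j) ?_ ?_ ?_ ?_ ?_
    all_goals intro j hj; rw [Finset.mem_Ico] at hj
    · rw [Finset.mem_Ico]; omega
    · rw [Finset.mem_Ico]; omega
    · show p - (p - j) = j
      omega
    · show p - (p - j) = j
      omega
  have hcon : ∏ j ∈ Ico 1 p, (-(C (ι j)) * C ((p - j : ℕ) : ℤ_[p])) = (1 : ℤ_[p][X]) := by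
    rw [Finset.prod_mul_distrib, hrefl _ (fun j => C ((j : ℕ) : ℤ_[p])), ← Finset.prod_mul_distrib]
    have : ∀ j ∈ Ico 1 p, (-(C (ι j)) * C ((j : ℕ) : ℤ_[p])) = (-1 : ℤ_[p][X]) := by
      intro j hj
      have i1 := congrArg C (h.inv _ (hnd j hj))
      rw [map_mul, map_one] at i1
      linear_combination - i1
    rw [Finset.prod_congr rfl this, Finset.prod_const, Nat.card_Ico]
    exact Even.neg_one_pow (by obtain ⟨k, hk⟩ := hodd; exact ⟨k, by omega⟩)
  rw [taylor_apply, comp_assoc]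
  conv_rhs => rw [← one_mul (wP ι 1 p), ← hcon, wP, ← hrefl _ (fun j => 1 + C (ι j) * X), ← Finset.prod_mul_distrib]
  rw [wP, Polynomial.prod_comp]
  refine Finset.prod_congr rfl fun j hj => ?_
  have hj' := hj
  rw [Finset.mem_Ico] at hj
  have i1 := congrArg C (h.inv _ (hnd j hj'))
  have i2 := congrArg C (h.inv (p - j) (hnd (p - j) (by rw [Finset.mem_Ico]; omega)))
  rw [map_mul, map_one] at i1 i2
  simp only [map_neg, add_comp, neg_comp, one_comp, mul_comp, C_comp, X_comp]
  have i3 : (C ((p - j : ℕ) : ℤ_[p]) : ℤ_[p][X]) = C (p : ℤ_[p]) - C (j : ℤ_[p]) := by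
    rw [Nat.cast_sub (by omega), map_sub]
  rw [i3] at i2 ⊢
  linear_combination - i1 + C (ι j) * X * i2

lemma odd_facts (h : IsInv p ι) (hp9 : 9 < p)
    (hd : ∀ n, 1 ≤ n → n < p - 1 → (p : ℤ_[p]) ∣ (wP ι 1 p).coeff n) (k : ℕ) (hk : Odd k) (hk2 : k < p - 2) :
    (p : ℤ_[p]) ^ 2 ∣ (wP ι 1 p).coeff k := by
  have hr := congrArg (fun f : ℤ_[p][X] => f.coeff k) (wP_refl h (by omega))
  have hX : (-X : ℤ_[p][X]) = C (-1) * X := by simp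
  simp only [hX, comp_C_mul_X_coeff, hk.neg_one_pow] at hr
  obtain ⟨z, hz⟩ := taylor_trunc (wP ι 1 p) (-(p : ℤ_[p])) k
  obtain ⟨y, hy⟩ := hd (k + 1) (by omega) (by omega)
  have hi := h.inv 2 (fun hd => absurd (Nat.le_of_dvd (by omega) hd) (by omega))
  push_cast at hi
  rw [hz, hy] at hr
  refine ⟨ι 2 * ((k + 1 : ℕ) * y - ((k + 2).choose 2 : ℕ) * (wP ι 1 p).coeff (k + 2) + p * z), ?_⟩
  linear_combination - ι 2 * hr - (wP ι 1 p).coeff k * hi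

lemma wP_coeff_zero {R : Type*} [CommRing R] (ι : ℕ → R) (a b : ℕ) : (wP ι a b).coeff 0 = 1 := by
  rw [wP, coeff_zero_prod]; simp

lemma wP_main (h : IsInv p ι) (hp9 : 9 < p)
    (hd : ∀ n, 1 ≤ n → n < p - 1 → (p : ℤ_[p]) ∣ (wP ι 1 p).coeff n) :
    (∃ z, (wP ι 1 p).coeff 7 = p ^ 2 * z) ∧
    (∃ z, (wP ι 1 p * wP ι (p + 1) (2 * p)).coeff 7 = p ^ 2 * z) ∧
    (∃ z, (wP ι 1 p * wP ι (p + 1) (2 * p)).coeff 6 = 2 * (wP ι 1 p).coeff 6 +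
      2 * (wP ι 1 p).coeff 2 * (wP ι 1 p).coeff 4 + p ^ 3 * z) := by
  have hodd := odd_facts h hp9 hd
  set w := wP ι 1 p with hw
  set v := wP ι (p + 1) (2 * p) with hv
  have w0 : w.coeff 0 = 1 := wP_coeff_zero _ _ _
  have v0 : v.coeff 0 = 1 := wP_coeff_zero _ _ _
  obtain ⟨a1, ha1⟩ := hodd 1 (by decide) (by omega)
  obtain ⟨a3, ha3⟩ := hodd 3 (by decide) (by omega)
  obtain ⟨a5, ha5⟩ := hodd 5 (by decide) (by omega)
  obtain ⟨a7, ha7⟩ := hodd 7 (by decide) (by omega)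
  obtain ⟨a2, ha2⟩ := hd 2 (by omega) (by omega)
  obtain ⟨a4, ha4⟩ := hd 4 (by omega) (by omega)
  obtain ⟨a6, ha6⟩ := hd 6 (by omega) (by omega)
  obtain ⟨a8, ha8⟩ := hd 8 (by omega) (by omega)
  have hs := wP_shift h
  rw [← hw, ← hv] at hs
  have hco : ∀ k, (taylor (p : ℤ_[p]) w).coeff 0 * v.coeff k = (taylor (p : ℤ_[p]) w).coeff k := by
    intro k
    rw [← coeff_C_mul, hs]
  obtain ⟨z0, hz0⟩ := taylor_trunc w (p : ℤ_[p]) 0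
  have hu : (taylor (p : ℤ_[p]) w).coeff 0 = 1 + p ^ 3 * (a1 + a2 + z0) := by
    rw [hz0]
    simp only [Nat.zero_add, w0, ha1, ha2]
    norm_num
    ring
  rw [hu] at hco
  -- odd coefficients of v
  have vodd : ∀ k, Odd k → k < 8 → ∃ b, v.coeff k = p ^ 2 * b := by
    intro k hk hk8
    obtain ⟨x, hx⟩ := hodd k hk (by omega)
    obtain ⟨y, hy⟩ := hd (k + 1) (by omega) (by omega)
    obtain ⟨z, hz⟩ := taylor_trunc w (p : ℤ_[p]) k
    have := hco k
    rw [hz, hx, hy] at this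
    refine ⟨x + (k + 1 : ℕ) * y + ((k + 2).choose 2 : ℕ) * w.coeff (k + 2) + p * z
      - p * (a1 + a2 + z0) * v.coeff k, ?_⟩
    linear_combination this
  have veven : ∀ k, Odd (k + 1) → 1 ≤ k → k < 7 → ∃ b, v.coeff k = w.coeff k + p ^ 3 * b := by
    intro k hk hk1 hk8
    obtain ⟨x, hx⟩ := hodd (k + 1) hk (by omega)
    obtain ⟨y, hy⟩ := hd (k + 2) (by omega) (by omega)
    obtain ⟨z, hz⟩ := taylor_trunc w (p : ℤ_[p]) k
    have := hco k
    rw [hz, hx, hy] at this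
    refine ⟨(k + 1 : ℕ) * x + ((k + 2).choose 2 : ℕ) * y + z - (a1 + a2 + z0) * v.coeff k, ?_⟩
    linear_combination this
  obtain ⟨b1, hb1⟩ := vodd 1 (by decide) (by omega)
  obtain ⟨b3, hb3⟩ := vodd 3 (by decide) (by omega)
  obtain ⟨b5, hb5⟩ := vodd 5 (by decide) (by omega)
  obtain ⟨b7, hb7⟩ := vodd 7 (by decide) (by omega)
  obtain ⟨b2, hb2⟩ := veven 2 (by decide) (by omega) (by omega)
  obtain ⟨b4, hb4⟩ := veven 4 (by decide) (by omega) (by omega)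
  obtain ⟨b6, hb6⟩ := veven 6 (by decide) (by omega) (by omega)
  refine ⟨⟨a7, ha7⟩, ?_, ?_⟩
  · rw [coeff_mul, Finset.Nat.sum_antidiagonal_eq_sum_range_succ (fun i j => w.coeff i * v.coeff j)]
    simp only [Finset.sum_range_succ, Finset.sum_range_zero]
    norm_num only
    rw [w0, v0, ha1, ha3, ha5, ha7, hb1, hb3, hb5, hb7]
    refine ⟨b7 + a1 * v.coeff 6 + w.coeff 2 * b5 + a3 * v.coeff 4 + w.coeff 4 * b3 + a5 * v.coeff 2
      + w.coeff 6 * b1 + a7, ?_⟩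
    ring
  · rw [coeff_mul, Finset.Nat.sum_antidiagonal_eq_sum_range_succ (fun i j => w.coeff i * v.coeff j)]
    simp only [Finset.sum_range_succ, Finset.sum_range_zero]
    norm_num only
    rw [w0, v0, ha1, ha3, ha5, hb1, hb3, hb5, hb2, hb4, hb6]
    refine ⟨b6 + p * a1 * b5 + w.coeff 2 * b4 + p * a3 * b3 + w.coeff 4 * b2 + p * a5 * b1, ?_⟩
    ring

end polyfacts
end S18
namespace S18
section final

lemma IsInv.unique {p : ℕ} {R : Type*} [CommRing R] {ι κ : ℕ → R} (h : IsInv p ι) (h' : IsInv p κ) :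
    ι = κ := by
  funext l
  by_cases hl : p ∣ l
  · rw [h.zero l hl, h'.zero l hl]
  · linear_combination κ l * h.inv l hl - ι l * h'.inv l hl

lemma wP_map {R S : Type*} [CommRing R] [CommRing S] (φ : R →+* S) (ι : ℕ → R) (a b : ℕ) :
    wP (fun l => φ (ι l)) a b = (wP ι a b).map φ := by
  simp [wP, Polynomial.map_prod]

variable {p : ℕ} [hpf : Fact p.Prime]

lemma ext_hom (x y : ℤ_[p]) (h : PadicInt.Coe.ringHom (p := p) x = PadicInt.Coe.ringHom (p := p) y) : x = y :=
  PadicInt.ext h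

/-- `p`-adic inverse function -/
noncomputable def iP (p : ℕ) [Fact p.Prime] (l : ℕ) : ℤ_[p] := if p ∣ l then 0 else Ring.inverse (l : ℤ_[p])

lemma iP_inv : IsInv p (iP p) := by
  refine ⟨fun l hl => by simp [iP, hl], fun l hl => ?_⟩
  rw [iP, if_neg hl]
  apply Ring.mul_inverse_cancel
  rw [← IsLocalRing.notMem_maximalIdeal, ← PadicInt.ker_toZMod, RingHom.mem_ker, map_natCast,
    ZMod.natCast_eq_zero_iff]
  exact hl

lemma transfer : (fun l => PadicInt.Coe.ringHom (iP p l)) = fun l => Rat.castHom ℚ_[p] (iQ p l) :=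
  IsInv.unique (iP_inv.map _) ((iQ_inv p).map _)

lemma Z_transfer (n : ℕ) : PadicInt.Coe.ringHom (p := p) (PowerSeries.coeff n (PowerSeries.mk (iP p) ^ 8)) =
    ((PowerSeries.coeff n (fQ p ^ 8) : ℚ) : ℚ_[p]) := by
  have h1 := mk_map (PadicInt.Coe.ringHom (p := p)) (iP p) n
  have h2 := mk_map (Rat.castHom ℚ_[p]) (iQ p) n
  rw [transfer, h2] at h1
  exact h1.symm

lemma w_transfer (f : ∀ (R : Type) [CommRing R], (ℕ → R) → Polynomial R)
    (hf : ∀ (R S : Type) [CommRing R] [CommRing S] (φ : R →+* S) (ι : ℕ → R),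
      f S (fun l => φ (ι l)) = (f R ι).map φ) (n : ℕ) :
    PadicInt.Coe.ringHom (p := p) ((f _ (iP p)).coeff n) = (((f _ (iQ p)).coeff n : ℚ) : ℚ_[p]) := by
  have h1 := hf _ _ (PadicInt.Coe.ringHom (p := p)) (iP p)
  have h2 := hf _ _ (Rat.castHom ℚ_[p]) (iQ p)
  rw [transfer, h2] at h1
  have h3 := congrArg (fun g => Polynomial.coeff g n) h1
  simp only [Polynomial.coeff_map] at h3
  exact h3.symm

lemma h2_main (hp9 : 9 < p) (β : ℕ → ℤ_[p])
    (hβ : ∀ i < p - 1, (β i : ℚ_[p]) = ((bernoulli i : ℚ) : ℚ_[p])) :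
    (p : ℤ_[p]) ∣ hcf p (iP p) 1 ∧
    ∃ y : ℤ_[p], 15 * hcf p (iP p) 2 = 40320 * (β (p - 3) * β (p - 5)) + p * y := by
  have hp := hpf.out
  have hp0 : (p : ℤ_[p]) ≠ 0 := by exact_mod_cast hp.ne_zero
  have h := iP_inv (p := p)
  have hw := wP_facts h β hβ
  have hd : ∀ n, 1 ≤ n → n < p - 1 → (p : ℤ_[p]) ∣ (wP (iP p) 1 p).coeff n := fun n h1 h2 =>
    (hw n h1 h2 (by omega)).1
  obtain ⟨u, hu⟩ := (hw 2 (by omega) (by omega) (by omega)).2 (by decide)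
  obtain ⟨v, hv⟩ := (hw 4 (by omega) (by omega) (by omega)).2 (by decide)
  rw [show p - 1 - 2 = p - 3 by omega] at hu
  rw [show p - 1 - 4 = p - 5 by omega] at hv
  obtain ⟨⟨s7, hs7⟩, ⟨t7, ht7⟩, ⟨t6, ht6⟩⟩ := wP_main h hp9 hd
  obtain ⟨q1, q2⟩ := Zp_final hp
  have T1 := w_transfer (p := p) (fun R _ ι => wP ι 1 p) (fun R S _ _ φ ι => wP_map φ ι 1 p)
  have T2 := w_transfer (p := p) (fun R _ ι => wP ι 1 p * wP ι (p + 1) (2 * p)) (fun R S _ _ φ ι => by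
    rw [wP_map φ ι 1 p, wP_map φ ι (p + 1) (2 * p), Polynomial.map_mul])
  beta_reduce at T1 T2
  have z1 : (p : ℤ_[p]) * PowerSeries.coeff p (PowerSeries.mk (iP p) ^ 8) =
      40320 * (wP (iP p) 1 p).coeff 7 := by
    apply ext_hom
    simp only [map_mul, map_add, map_sub, map_neg, map_pow, map_natCast, map_ofNat, map_one]
    rw [Z_transfer, T1]
    exact_mod_cast congrArg (fun x : ℚ => (x : ℚ_[p])) q1
  have z2 : 2 * (p : ℤ_[p]) ^ 2 * PowerSeries.coeff (2 * p) (PowerSeries.mk (iP p) ^ 8) = 40320 *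
      (p * (wP (iP p) 1 p * wP (iP p) (p + 1) (2 * p)).coeff 7 +
        (wP (iP p) 1 p * wP (iP p) (p + 1) (2 * p)).coeff 6 - 2 * (wP (iP p) 1 p).coeff 6) := by
    apply ext_hom
    simp only [map_mul, map_add, map_sub, map_neg, map_pow, map_natCast, map_ofNat, map_one]
    rw [Z_transfer, T1, T2, T2]
    exact_mod_cast congrArg (fun x : ℚ => (x : ℚ_[p])) q2
  rw [hs7] at z1
  rw [ht7, ht6] at z2
  obtain ⟨⟨x1, hx1⟩, ⟨x2, hx2⟩⟩ := h12 h hp9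
  have Z1 : PowerSeries.coeff p (PowerSeries.mk (iP p) ^ 8) = p * (40320 * s7) := by
    apply mul_left_cancel₀ hp0
    linear_combination z1
  have H1 : hcf p (iP p) 1 = p * (40320 * s7 - x1) := by linear_combination Z1 - hx1
  refine ⟨⟨_, H1⟩, ?_⟩
  push_cast at hu hv
  have Z2 : 15 * PowerSeries.coeff (2 * p) (PowerSeries.mk (iP p) ^ 8) =
      40320 * (β (p - 3) * β (p - 5)) +
        p * (40320 * (- β (p - 3) * v - β (p - 5) * u + p * u * v) + 302400 * (t7 + t6)) := by
    have h20 : (2 * (p : ℤ_[p]) ^ 2) ≠ 0 := mul_ne_zero two_ne_zero (pow_ne_zero _ hp0)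
    apply mul_left_cancel₀ h20
    have e24 : 15 * ((wP (iP p) 1 p).coeff 2 * (wP (iP p) 1 p).coeff 4) =
        (-(↑p * β (p - 3)) + ↑p ^ 2 * u) * (-(↑p * β (p - 5)) + ↑p ^ 2 * v) := by
      rw [← hu, ← hv]; ring
    linear_combination 15 * z2 + 80640 * e24
  refine ⟨40320 * (- β (p - 3) * v - β (p - 5) * u + p * u * v) + 302400 * (t7 + t6)
    - 15 * x2 - 120 * (40320 * s7 - x1), ?_⟩
  linear_combination Z2 - 15 * hx2 - 120 * H1

lemma cong_of_norm (r : ℕ) (x y : ℚ) (Y : ℤ_[p])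
    (h : ((x : ℚ) : ℚ_[p]) - ((y : ℚ) : ℚ_[p]) = (p : ℚ_[p]) ^ r * PadicInt.Coe.ringHom (p := p) Y) : padicCong p r x y := by
  by_cases hxy : x = y
  · exact Or.inl hxy
  right
  have hp := hpf.out
  have hne : x - y ≠ 0 := sub_ne_zero.2 hxy
  have hn : ‖((x - y : ℚ) : ℚ_[p])‖ ≤ (p : ℝ) ^ (-(r : ℤ)) := by
    push_cast
    rw [h, norm_mul, Padic.norm_p_pow]
    have := Y.2
    exact mul_le_of_le_one_right (by positivity) this
  rw [Padic.eq_padicNorm, padicNorm.eq_zpow_of_nonzero hne] at hn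
  push_cast at hn
  have h1 : (1 : ℝ) < p := by exact_mod_cast hp.one_lt
  have := (zpow_le_zpow_iff_right₀ h1).1 hn
  omega

end final
end S18

theorem stmt18 (r : ℕ) (hr : 2 ≤ r) (p : ℕ) (hp : p.Prime) (hp9 : 9 < p) :
    padicCong p r
      (8 * sigmaSum p 8 1 (2 * p ^ r) + 28 * sigmaSum p 8 2 (2 * p ^ r) +
        56 * sigmaSum p 8 3 (2 * p ^ r) + 35 * sigmaSum p 8 4 (2 * p ^ r))
      (2688 / 5 * bernoulli (p - 3) * bernoulli (p - 5) * (p : ℚ) ^ (r - 1)) := by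
  have hpf : Fact p.Prime := ⟨hp⟩
  have h := S18.iP_inv (p := p)
  have hb : ∀ i, ∃ b : ℤ_[p], i < p - 1 → (b : ℚ_[p]) = ((bernoulli i : ℚ) : ℚ_[p]) := by
    intro i
    by_cases hi : i < p - 1
    · obtain ⟨b, hb⟩ := S18.bern_int h i hi
      exact ⟨b, fun _ => hb⟩
    · exact ⟨0, fun hh => absurd hh hi⟩
  choose β hβ using hb
  obtain ⟨h1, y, hy⟩ := S18.h2_main hp9 β hβ
  obtain ⟨y1, hy1⟩ := S18.step2 h hp9 h1 r hr 1 le_rfl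
  obtain ⟨y2, hy2⟩ := S18.step2 h hp9 h1 r hr 2 (by norm_num)
  have s1 := S18.step1 hp (by omega) (p ^ r)
  generalize (8 * sigmaSum p 8 1 (2 * p ^ r) + 28 * sigmaSum p 8 2 (2 * p ^ r) +
        56 * sigmaSum p 8 3 (2 * p ^ r) + 35 * sigmaSum p 8 4 (2 * p ^ r)) = T at *
  have hnd : ¬ p ∣ 151200 := by
    rw [show 151200 = 2 ^ 5 * 3 ^ 3 * 5 ^ 2 * 7 by norm_num, hp.dvd_mul, hp.dvd_mul, hp.dvd_mul]
    rintro (((hd | hd) | hd) | hd)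
    · exact absurd (Nat.le_of_dvd (by norm_num) (hp.dvd_of_dvd_pow hd)) (by omega)
    · exact absurd (Nat.le_of_dvd (by norm_num) (hp.dvd_of_dvd_pow hd)) (by omega)
    · exact absurd (Nat.le_of_dvd (by norm_num) (hp.dvd_of_dvd_pow hd)) (by omega)
    · exact absurd (Nat.le_of_dvd (by norm_num) hd) (by omega)
  have hinv := congrArg (PadicInt.Coe.ringHom (p := p)) (h.inv _ hnd)
  simp only [map_mul, map_add, map_sub, map_neg, map_pow, map_natCast, map_ofNat, map_one] at hinv
  push_cast at hinv
  obtain ⟨k, rfl⟩ : ∃ k, r = k + 1 := ⟨r - 1, by omega⟩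
  rw [Nat.add_sub_cancel] at *
  rw [one_mul] at hy1
  have s1' := congrArg (fun x : ℚ => (x : ℚ_[p])) s1
  push_cast at s1'
  rw [← S18.Z_transfer, ← S18.Z_transfer] at s1'
  have hy' := congrArg (PadicInt.Coe.ringHom (p := p)) hy
  have hy1' := congrArg (PadicInt.Coe.ringHom (p := p)) hy1
  have hy2' := congrArg (PadicInt.Coe.ringHom (p := p)) hy2
  simp only [map_mul, map_add, map_sub, map_neg, map_pow, map_natCast, map_ofNat, map_one] at hy' hy1' hy2'
  push_cast at hy' hy1' hy2'
  have hβ' : ∀ i < p - 1, PadicInt.Coe.ringHom (p := p) (β i) = ((bernoulli i : ℚ) : ℚ_[p]) := hβ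
  rw [hβ' (p - 3) (by omega), hβ' (p - 5) (by omega)] at hy'
  apply S18.cong_of_norm (k + 1) _ _ (S18.iP p 151200 * (2016 * y + 15 * y1 - 30 * y2))
  push_cast
  simp only [map_mul, map_add, map_sub, map_neg, map_pow, map_natCast, map_ofNat, map_one]
  generalize ((bernoulli (p - 3) : ℚ) : ℚ_[p]) = B3 at *
  generalize ((bernoulli (p - 5) : ℚ) : ℚ_[p]) = B5 at *
  have key : 151200 * ((T : ℚ_[p]) - 2688 / 5 * B3 * B5 * (p : ℚ_[p]) ^ k) =
      (p : ℚ_[p]) ^ (k + 1) * (2016 * PadicInt.Coe.ringHom (p := p) y + 15 * PadicInt.Coe.ringHom (p := p) y1 - 30 * PadicInt.Coe.ringHom (p := p) y2) := by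
    linear_combination 75600 * s1' + 15 * hy1' - 30 * hy2' + 2016 * (p : ℚ_[p]) ^ k * hy'
  linear_combination PadicInt.Coe.ringHom (p := p) (S18.iP p 151200) * key
    - ((T : ℚ_[p]) - 2688 / 5 * B3 * B5 * (p : ℚ_[p]) ^ k) * hinv
end
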